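/- Let q = pᵏ be a prime power with q ∉ {2,3} and F_q the finite field with q elements. Then the set {(t,b) ∈ F_q × F_q : P(t,b) = 0} has at least 5 elements. -/

import Mathlib

namespace StepanovCurve

section Fixed
variable {R : Type*} [CommRing R]

/-- A contraction on power series has a fixed point, which is the coefficientwise limit of the
iterates at zero. -/
lemma exists_fixed (Ψ : PowerSeries R → PowerSeries R)
    (h0 : ∀ a, (PowerSeries.X : PowerSeries R) ∣ a → (PowerSeries.X : PowerSeries R) ∣ Ψ a)
    (hc : ∀ a b (k : ℕ), (PowerSeries.X : PowerSeries R) ∣ a → (PowerSeries.X : PowerSeries R) ∣ b →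
      (PowerSeries.X : PowerSeries R) ^ k ∣ a - b →
      (PowerSeries.X : PowerSeries R) ^ (k + 1) ∣ Ψ a - Ψ b) :
    ∃ Z : PowerSeries R, PowerSeries.X ∣ Z ∧ Ψ Z = Z ∧
      ∀ m, ∃ n, PowerSeries.coeff m Z = PowerSeries.coeff m (Ψ^[n] 0) := by
  have hX : ∀ n, (PowerSeries.X : PowerSeries R) ∣ Ψ^[n] 0 := by
    intro n
    induction n with
    | zero => simp
    | succ n ih => rw [Function.iterate_succ_apply']; exact h0 _ ih
  have hstep : ∀ n, (PowerSeries.X : PowerSeries R) ^ n ∣ Ψ^[n + 1] 0 - Ψ^[n] 0 := by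
    intro n
    induction n with
    | zero => simp
    | succ n ih =>
      rw [Function.iterate_succ_apply' Ψ (n + 1), Function.iterate_succ_apply' Ψ n]
      exact hc _ _ _ (by rw [← Function.iterate_succ_apply' Ψ n]; exact hX _) (hX _)
        (by rw [← Function.iterate_succ_apply' Ψ n]; exact ih)
  have hst : ∀ n k, (PowerSeries.X : PowerSeries R) ^ n ∣ Ψ^[n + k] 0 - Ψ^[n] 0 := by
    intro n k
    induction k with
    | zero => simp
    | succ k ih =>
      have h1 := (pow_dvd_pow (PowerSeries.X : PowerSeries R) (Nat.le_add_right n k)).trans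
        (hstep (n + k))
      have := dvd_add h1 ih
      rw [← add_assoc]
      simpa using this
  let Z : PowerSeries R := PowerSeries.mk fun m => PowerSeries.coeff m (Ψ^[m + 1] 0)
  have hZ : ∀ n, (PowerSeries.X : PowerSeries R) ^ n ∣ Z - Ψ^[n] 0 := by
    intro n
    rw [PowerSeries.X_pow_dvd_iff]
    intro m hm
    obtain ⟨k, rfl⟩ := Nat.exists_eq_add_of_le (Nat.succ_le_of_lt hm)
    have := (PowerSeries.X_pow_dvd_iff.1 (hst (m + 1) k)) m (Nat.lt_succ_self m)
    rw [map_sub, sub_eq_zero] at this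
    rw [map_sub, PowerSeries.coeff_mk, sub_eq_zero]
    exact this.symm
  have hXZ : (PowerSeries.X : PowerSeries R) ∣ Z := by
    have h1 := hZ 1
    rw [pow_one] at h1
    have := dvd_add h1 (hX 1)
    simpa using this
  refine ⟨Z, hXZ, ?_, fun m => ⟨m + 1, by rw [PowerSeries.coeff_mk]⟩⟩
  have key : ∀ n, (PowerSeries.X : PowerSeries R) ^ (n + 1) ∣ Ψ Z - Z := by
    intro n
    have h1 := hc _ _ n hXZ (hX n) (hZ n)
    have h2 := hZ (n + 1)
    rw [Function.iterate_succ_apply'] at h2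
    have := dvd_sub h1 h2
    have e : Ψ Z - Ψ (Ψ^[n] 0) - (Z - Ψ (Ψ^[n] 0)) = Ψ Z - Z := by ring
    rwa [e] at this
  ext m
  have := (PowerSeries.X_pow_dvd_iff.1 (key m)) m (Nat.lt_succ_self m)
  rw [map_sub, sub_eq_zero] at this
  exact this

end Fixed

section Filtration
variable {F : Type*} [Field F] {R : Type*} [CommRing R] [Algebra F R]

/-- Weighted filtration: `x` has weight `1`, `y` has weight `3`. -/
def W (F : Type*) [Field F] {R : Type*} [CommRing R] [Algebra F R] (x y : R) (n : ℤ) :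
    Submodule F R :=
  Submodule.span F {r | ∃ a j : ℕ, (a : ℤ) + 3 * j ≤ n ∧ r = x ^ a * y ^ j}

variable {x y : R}

lemma W_mono {n m : ℤ} (h : n ≤ m) : W F x y n ≤ W F x y m := by
  apply Submodule.span_mono
  rintro r ⟨a, j, h1, rfl⟩
  exact ⟨a, j, by omega, rfl⟩

lemma W_mul {n m : ℤ} {r s : R} (hr : r ∈ W F x y n) (hs : s ∈ W F x y m) :
    r * s ∈ W F x y (n + m) := by
  have h : W F x y n * W F x y m ≤ W F x y (n + m) := by
    unfold W
    rw [Submodule.span_mul_span]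
    apply Submodule.span_mono
    rintro _ ⟨_, ⟨a, j, h1, rfl⟩, _, ⟨a', j', h2, rfl⟩, rfl⟩
    refine ⟨a + a', j + j', by push_cast; omega, by simp only; ring⟩
  exact h (Submodule.mul_mem_mul hr hs)

lemma W_mon (a j : ℕ) : x ^ a * y ^ j ∈ W F x y ((a : ℤ) + 3 * j) :=
  Submodule.subset_span ⟨a, j, le_rfl, rfl⟩

lemma W_one : (1 : R) ∈ W F x y 0 := by simpa using W_mon (F := F) (x := x) (y := y) 0 0
lemma W_x : x ∈ W F x y 1 := by simpa using W_mon (F := F) (x := x) (y := y) 1 0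
lemma W_y : y ∈ W F x y 3 := by simpa using W_mon (F := F) (x := x) (y := y) 0 1
lemma W_xpow (a : ℕ) : x ^ a ∈ W F x y a := by simpa using W_mon (F := F) (x := x) (y := y) a 0
lemma W_ypow (a : ℕ) : y ^ a ∈ W F x y (3 * a) := by
  simpa using W_mon (F := F) (x := x) (y := y) 0 a

lemma W_natCast_mul {n : ℤ} {r : R} (k : ℕ) (hr : r ∈ W F x y n) : (k : R) * r ∈ W F x y n := by
  rw [← nsmul_eq_mul]; exact nsmul_mem hr k

lemma W_aeval (c : Polynomial F) (n : ℕ) (hn : c.natDegree ≤ n) :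
    Polynomial.aeval x c ∈ W F x y n := by
  rw [Polynomial.aeval_eq_sum_range]
  refine Submodule.sum_mem _ fun i hi => Submodule.smul_mem _ _ ?_
  refine W_mono ?_ (W_xpow i)
  have := Finset.mem_range.1 hi
  omega

/-- The weighted filtration on power series: the variable has weight `-17`. -/
def InT (F : Type*) [Field F] {R : Type*} [CommRing R] [Algebra F R] (x y : R) (n : ℤ)
    (p : PowerSeries R) : Prop :=
  ∀ m : ℕ, PowerSeries.coeff m p ∈ W F x y (n + 17 * m)

lemma InT.mono {n m : ℤ} {p : PowerSeries R} (hp : InT F x y n p) (h : n ≤ m) : InT F x y m p :=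
  fun k => W_mono (by omega) (hp k)

lemma InT.zero {n : ℤ} : InT F x y n 0 := fun k => by simp

lemma InT.add {n : ℤ} {p q : PowerSeries R} (hp : InT F x y n p) (hq : InT F x y n q) :
    InT F x y n (p + q) := fun k => by rw [map_add]; exact add_mem (hp k) (hq k)

lemma InT.neg {n : ℤ} {p : PowerSeries R} (hp : InT F x y n p) :
    InT F x y n (-p) := fun k => by rw [map_neg]; exact neg_mem (hp k)

lemma InT.mul {n m : ℤ} {p q : PowerSeries R} (hp : InT F x y n p) (hq : InT F x y m q) :
    InT F x y (n + m) (p * q) := fun k => by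
  rw [PowerSeries.coeff_mul]
  refine Submodule.sum_mem _ fun i hi => ?_
  have := Finset.HasAntidiagonal.mem_antidiagonal.1 hi
  refine W_mono ?_ (W_mul (hp i.1) (hq i.2))
  omega

lemma InT.C {n : ℤ} {r : R} (hr : r ∈ W F x y n) : InT F x y n (PowerSeries.C r) := fun k => by
  rw [PowerSeries.coeff_C]
  split_ifs with h
  · subst h; simpa using hr
  · exact zero_mem _

lemma InT.one : InT F x y 0 1 := by
  have := InT.C (W_one (F := F) (x := x) (y := y))
  simpa using this

lemma InT.X : InT F x y (-17) (PowerSeries.X : PowerSeries R) := fun k => by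
  rw [PowerSeries.coeff_X]
  split_ifs with h
  · subst h; simpa using W_one (F := F) (x := x) (y := y)
  · exact zero_mem _

lemma InT.pow {n : ℤ} {p : PowerSeries R} (hp : InT F x y n p) (k : ℕ) :
    InT F x y (k * n) (p ^ k) := by
  induction k with
  | zero => simpa using InT.one
  | succ k ih =>
    rw [pow_succ]
    refine (ih.mul hp).mono ?_
    push_cast
    linarith

lemma InT.natCast_mul {n : ℤ} {p : PowerSeries R} (k : ℕ) (hp : InT F x y n p) :
    InT F x y n ((k : PowerSeries R) * p) := fun m => by
  rw [← nsmul_eq_mul, map_nsmul]; exact nsmul_mem (hp m) k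

lemma InT.algebraMap_mul {n : ℤ} {p : PowerSeries R} (r : F) (hp : InT F x y n p) :
    InT F x y n (PowerSeries.C (algebraMap F R r) * p) := fun m => by
  rw [PowerSeries.coeff_C_mul, ← Algebra.smul_def]
  exact Submodule.smul_mem _ _ (hp m)

lemma taylor_pow (δ : PowerSeries R) (hδ : InT F x y 1 δ) (i : ℕ) :
    ∃ e, InT F x y ((i : ℤ) - 2) e ∧ (PowerSeries.C x + δ) ^ i =
      PowerSeries.C (x ^ i) + PowerSeries.C ((i : R) * x ^ (i - 1)) * δ + δ ^ 2 * e := by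
  induction i with
  | zero => exact ⟨0, InT.zero, by simp⟩
  | succ i ih =>
    obtain ⟨e, he, h⟩ := ih
    refine ⟨(PowerSeries.C x + δ) * e + PowerSeries.C ((i : R) * x ^ (i - 1)), ?_, ?_⟩
    · refine InT.add ?_ ?_
      · refine (((InT.C W_x).add hδ).mul he).mono ?_
        push_cast; linarith
      · cases i with
        | zero => simpa using InT.zero
        | succ i =>
          refine InT.C (W_natCast_mul _ (W_mono ?_ (W_xpow _)))
          simp only [Nat.add_sub_cancel]
          push_cast
          omega
    · rw [pow_succ, h]
      cases i with
      | zero => simp; ring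
      | succ i =>
        simp only [Nat.add_sub_cancel, map_mul, map_pow, map_natCast, Nat.cast_add, Nat.cast_one,
          map_add, map_one]
        ring

lemma taylor_poly (δ : PowerSeries R) (hδ : InT F x y 1 δ) (c : Polynomial F) (n : ℕ)
    (hn : c.natDegree ≤ n) :
    ∃ e, InT F x y ((n : ℤ) - 2) e ∧ Polynomial.aeval (PowerSeries.C x + δ) c =
      PowerSeries.C (Polynomial.aeval x c) +
        PowerSeries.C (Polynomial.aeval x (Polynomial.derivative c)) * δ + δ ^ 2 * e := by
  refine Polynomial.induction_with_natDegree_le (motive := fun c =>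
    ∃ e, InT F x y ((n : ℤ) - 2) e ∧ Polynomial.aeval (PowerSeries.C x + δ) c =
      PowerSeries.C (Polynomial.aeval x c) +
        PowerSeries.C (Polynomial.aeval x (Polynomial.derivative c)) * δ + δ ^ 2 * e)
    n ?_ ?_ ?_ c hn
  · exact ⟨0, InT.zero, by simp⟩
  · intro i r hr hi
    obtain ⟨e, he, h⟩ := taylor_pow δ hδ i
    refine ⟨PowerSeries.C (algebraMap F R r) * e, InT.algebraMap_mul _ (he.mono (by omega)), ?_⟩
    have e1 : algebraMap F (PowerSeries R) r = PowerSeries.C (algebraMap F R r) := by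
      rw [PowerSeries.algebraMap_apply]
    simp only [map_mul, map_pow, Polynomial.aeval_X, Polynomial.aeval_C,
      Polynomial.derivative_C_mul_X_pow, h, map_natCast, e1]
    ring
  · intro f g hfg hg hf' hg'
    obtain ⟨e, he, h⟩ := hf'
    obtain ⟨e', he', h'⟩ := hg'
    refine ⟨e + e', he.add he', ?_⟩
    simp only [map_add, h, h']
    ring

end Filtration
end StepanovCurve

namespace StepanovCurve

section Quad
variable {F : Type*} [Field F] {R : Type*} [CommRing R] [Algebra F R] {x y : R}

open PowerSeries in
/-- Hensel-type solution of a quartic equation, with weights. -/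
lemma exists_quad (L0 L1 P0 P1 P2 : PowerSeries R) (h0 : PowerSeries.X ∣ L0)
    (h1 : PowerSeries.X ∣ L1) (w0 : InT F x y (-6) L0) (w1 : InT F x y 0 L1)
    (w2 : InT F x y 6 P0) (w3 : InT F x y 12 P1) (w4 : InT F x y 18 P2) :
    ∃ Z : PowerSeries R, PowerSeries.X ∣ Z ∧ InT F x y (-6) Z ∧
      Z + (L0 + L1 * Z + Z ^ 2 * P0 + Z ^ 3 * P1 + Z ^ 4 * P2) = 0 := by
  let Ψ : PowerSeries R → PowerSeries R := fun Z =>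
    -(L0 + L1 * Z + Z ^ 2 * P0 + Z ^ 3 * P1 + Z ^ 4 * P2)
  have H1 : ∀ a, (PowerSeries.X : PowerSeries R) ∣ a → (PowerSeries.X : PowerSeries R) ∣ Ψ a := by
    intro a ha
    refine (dvd_neg).2 ?_
    refine dvd_add (dvd_add (dvd_add (dvd_add h0 (Dvd.dvd.mul_right h1 _)) ?_) ?_) ?_
    · exact Dvd.dvd.mul_right (dvd_pow ha (by norm_num)) _
    · exact Dvd.dvd.mul_right (dvd_pow ha (by norm_num)) _
    · exact Dvd.dvd.mul_right (dvd_pow ha (by norm_num)) _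
  have H2 : ∀ a b (k : ℕ), (PowerSeries.X : PowerSeries R) ∣ a → (PowerSeries.X : PowerSeries R) ∣ b →
      (PowerSeries.X : PowerSeries R) ^ k ∣ a - b →
      (PowerSeries.X : PowerSeries R) ^ (k + 1) ∣ Ψ a - Ψ b := by
    intro a b k ha hb hab
    have e : Ψ a - Ψ b = -((a - b) * (L1 + ((a + b) * P0 + (a * a + a * b + b * b) * P1 +
        (a + b) * ((a ^ 2 + b ^ 2) * P2)))) := by
      simp only [Ψ]; ring
    rw [e, dvd_neg, pow_succ]
    refine mul_dvd_mul hab (dvd_add h1 (dvd_add (dvd_add ?_ ?_) ?_))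
    · exact Dvd.dvd.mul_right (dvd_add ha hb) _
    · exact Dvd.dvd.mul_right (dvd_add (dvd_add (Dvd.dvd.mul_right ha _)
        (Dvd.dvd.mul_right ha _)) (Dvd.dvd.mul_right hb _)) _
    · exact Dvd.dvd.mul_right (dvd_add ha hb) _
  obtain ⟨Z, hXZ, hZ, hco⟩ := exists_fixed Ψ H1 H2
  refine ⟨Z, hXZ, ?_, ?_⟩
  · have hit : ∀ n, InT F x y (-6) (Ψ^[n] 0) := by
      intro n
      induction n with
      | zero => exact InT.zero
      | succ n ih =>
        rw [Function.iterate_succ_apply']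
        refine InT.neg ?_
        refine (((w0.add ?_).add ?_).add ?_).add ?_
        · exact (w1.mul ih).mono (by omega)
        · exact ((ih.pow 2).mul w2).mono (by norm_num)
        · exact ((ih.pow 3).mul w3).mono (by norm_num)
        · exact ((ih.pow 4).mul w4).mono (by norm_num)
    intro m
    obtain ⟨n, hn⟩ := hco m
    rw [hn]
    exact hit n m
  · have : Z + -(Ψ Z) = 0 := by rw [hZ]; ring
    simpa only [Ψ, neg_neg] using this

end Quad

section Curve
open Polynomial
variable (F : Type*) [Field F]

noncomputable def k3 : F[X] := 2 * X - 1
noncomputable def k2 : F[X] := X ^ 6 + 2 * X ^ 5 - 2 * X ^ 3 + 3 * X ^ 2 - X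
noncomputable def k1 : F[X] := 2 * X ^ 6 + 3 * X ^ 5 - 4 * X ^ 4 + X ^ 3
noncomputable def k0 : F[X] := X ^ 10 + 4 * X ^ 9 + 2 * X ^ 8 - 4 * X ^ 7 + X ^ 6

lemma k3_deg : (k3 F).natDegree ≤ 3 := by unfold k3; compute_degree!
lemma k2_deg : (k2 F).natDegree ≤ 6 := by unfold k2; compute_degree!
lemma k1_deg : (k1 F).natDegree ≤ 9 := by unfold k1; compute_degree!
lemma k0_deg : (k0 F).natDegree ≤ 12 := by unfold k0; compute_degree!

/-- The model of the curve that is monic in the second variable. -/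
noncomputable def fpoly : F[X][X] :=
  X ^ 4 + C (k3 F) * X ^ 3 + C (k2 F) * X ^ 2 + C (k1 F) * X + C (k0 F)

lemma fpoly_natDegree : (fpoly F).natDegree = 4 := by unfold fpoly; compute_degree!
lemma fpoly_monic : (fpoly F).Monic := by unfold fpoly; monicity!

variable {F}
variable {R : Type*} [CommRing R] [Algebra F R]

/-- The value of the partial derivative in the second variable. -/
noncomputable def gval (F : Type*) [Field F] {R : Type*} [CommRing R] [Algebra F R] (x y : R) : R :=
  4 * y ^ 3 + 3 * aeval x (k3 F) * y ^ 2 + 2 * aeval x (k2 F) * y + aeval x (k1 F)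

/-- The value of the curve equation. -/
noncomputable def fval (F : Type*) [Field F] {R : Type*} [CommRing R] [Algebra F R] (x y : R) : R :=
  y ^ 4 + aeval x (k3 F) * y ^ 3 + aeval x (k2 F) * y ^ 2 + aeval x (k1 F) * y + aeval x (k0 F)

lemma fpoly_eval₂ (x y : R) : (fpoly F).eval₂ ((aeval x : F[X] →ₐ[F] R) : F[X] →+* R) y =
    fval F x y := by
  simp [fpoly, fval, eval₂_add, eval₂_mul, eval₂_pow]

variable {x y : R}

lemma gval_mem : gval F x y ∈ W F x y 9 := by
  have h3 := W_aeval (x := x) (y := y) _ _ (k3_deg F)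
  have h2 := W_aeval (x := x) (y := y) _ _ (k2_deg F)
  have h1 := W_aeval (x := x) (y := y) _ _ (k1_deg F)
  unfold gval
  refine add_mem (add_mem (add_mem ?_ ?_) ?_) (by simpa using h1)
  · have := W_natCast_mul 4 (W_ypow (F := F) (x := x) (y := y) 3)
    simpa using this
  · have := W_natCast_mul 3 (W_mul h3 (W_ypow (F := F) (x := x) (y := y) 2))
    rw [← mul_assoc] at this
    simpa using this
  · have := W_natCast_mul 2 (W_mul h2 (W_ypow (F := F) (x := x) (y := y) 1))
    rw [← mul_assoc] at this
    simpa using this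

lemma exists_lift (hf : fval F x y = 0) :
    ∃ υ : PowerSeries R, InT F x y 3 υ ∧ PowerSeries.constantCoeff υ = y ∧
      fval F (PowerSeries.C x + PowerSeries.C (gval F x y ^ 2) * PowerSeries.X) υ = 0 := by
  set g := gval F x y with hg
  set cx : R →+* PowerSeries R := PowerSeries.C with hcx
  have gm : InT F x y 9 (cx g) := InT.C gval_mem
  have ym : InT F x y 3 (cx y) := InT.C W_y
  set T : PowerSeries R := PowerSeries.X with hT
  have Tm : InT F x y (-17) T := InT.X
  have hδ : InT F x y 1 (cx (g ^ 2) * T) := by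
    rw [map_pow]
    exact ((gm.pow 2).mul Tm).mono (by norm_num)
  have cm : ∀ (c : F[X]) (n : ℕ), c.natDegree ≤ n → InT F x y n (cx (aeval x c)) := fun c n hn =>
    InT.C (W_aeval c n hn)
  have dm : ∀ (c : F[X]) (n : ℕ), c.natDegree ≤ n + 1 → InT F x y n (cx (aeval x (derivative c))) :=
    fun c n hn => InT.C (W_aeval _ n ((natDegree_derivative_le c).trans (by omega)))
  obtain ⟨e3, m3, t3⟩ := taylor_poly _ hδ (k3 F) 3 (k3_deg F)
  obtain ⟨e2, m2, t2⟩ := taylor_poly _ hδ (k2 F) 6 (k2_deg F)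
  obtain ⟨e1, m1, t1⟩ := taylor_poly _ hδ (k1 F) 9 (k1_deg F)
  obtain ⟨e0, m0, t0⟩ := taylor_poly _ hδ (k0 F) 12 (k0_deg F)
  have c3m := cm _ _ (k3_deg F)
  have c2m := cm _ _ (k2_deg F)
  have c1m := cm _ _ (k1_deg F)
  have c0m := cm _ _ (k0_deg F)
  have d3m := dm _ 2 (k3_deg F)
  have d2m := dm _ 5 (k2_deg F)
  have d1m := dm _ 8 (k1_deg F)
  have d0m := dm _ 11 (k0_deg F)
  push_cast at m3 m2 m1 m0 c3m c2m c1m c0m d3m d2m d1m d0m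
  have hg' : cx g = 4 * cx y ^ 3 + 3 * cx (aeval x (k3 F)) * cx y ^ 2 +
      2 * cx (aeval x (k2 F)) * cx y + cx (aeval x (k1 F)) := by
    rw [hg, gval]
    simp only [map_add, map_mul, map_pow, map_ofNat]
  have hf' : cx y ^ 4 + cx (aeval x (k3 F)) * cx y ^ 3 + cx (aeval x (k2 F)) * cx y ^ 2 +
      cx (aeval x (k1 F)) * cx y + cx (aeval x (k0 F)) = 0 := by
    have := congrArg cx hf
    rw [fval] at this
    simpa only [map_add, map_mul, map_pow, map_zero] using this
  have nm : ∀ (k : ℕ) [k.AtLeastTwo] {n : ℤ} {p : PowerSeries R}, InT F x y n p →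
      InT F x y n ((OfNat.ofNat k : PowerSeries R) * p) := by
    intro k _ n p hp
    exact_mod_cast hp.natCast_mul k
  rw [map_pow] at t3 t2 t1 t0 hδ
  have hCx : (PowerSeries.C : R →+* PowerSeries R) x = cx x := rfl
  rw [hCx] at t3 t2 t1 t0
  unfold fval
  simp only [map_pow, t3, t2, t1, t0]
  generalize cx (aeval x (k3 F)) = c3 at *
  generalize cx (aeval x (k2 F)) = c2 at *
  generalize cx (aeval x (k1 F)) = c1 at *
  generalize cx (aeval x (k0 F)) = c0 at *
  generalize cx (aeval x (derivative (k3 F))) = d3 at *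
  generalize cx (aeval x (derivative (k2 F))) = d2 at *
  generalize cx (aeval x (derivative (k1 F))) = d1 at *
  generalize cx (aeval x (derivative (k0 F))) = d0 at *
  obtain ⟨G, hG⟩ : ∃ G, G = cx g := ⟨_, rfl⟩
  obtain ⟨v, hv⟩ : ∃ v, v = cx y := ⟨_, rfl⟩
  rw [← hv] at hf' ym hg'
  rw [← hG] at hg' gm hδ
  rw [← hG]
  -- the data of the quartic equation
  have Am : InT F x y 10 (e3 * v ^ 3 + e2 * v ^ 2 + e1 * v + e0) := by
    refine ((InT.add ?_ ?_).add ?_).add ?_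
    · exact (m3.mul (ym.pow 3)).mono (by norm_num)
    · exact (m2.mul (ym.pow 2)).mono (by norm_num)
    · exact (m1.mul ym).mono (by norm_num)
    · exact m0.mono (by norm_num)
  have fxm : InT F x y 11 (d3 * v ^ 3 + d2 * v ^ 2 + d1 * v + d0) := by
    refine ((InT.add ?_ ?_).add ?_).add ?_
    · exact (d3m.mul (ym.pow 3)).mono (by norm_num)
    · exact (d2m.mul (ym.pow 2)).mono (by norm_num)
    · exact (d1m.mul ym).mono (by norm_num)
    · exact d0m.mono (by norm_num)
  have Bm : InT F x y 8 (3 * ((d3 + G ^ 2 * T * e3) * v ^ 2) + 2 * ((d2 + G ^ 2 * T * e2) * v) +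
      (d1 + G ^ 2 * T * e1)) := by
    refine (InT.add ?_ ?_).add ?_
    · refine nm 3 (((d3m.add ((hδ.mul m3).mono (by norm_num))).mul (ym.pow 2)).mono (by norm_num))
    · refine nm 2 (((d2m.add ((hδ.mul m2).mono (by norm_num))).mul ym).mono (by norm_num))
    · exact (d1m.add ((hδ.mul m1).mono (by norm_num))).mono (by norm_num)
  have x3m : InT F x y 3 (c3 + d3 * (G ^ 2 * T) + (G ^ 2 * T) ^ 2 * e3) := by
    refine (c3m.add ?_).add ?_
    · exact (d3m.mul hδ).mono (by norm_num)
    · exact ((hδ.pow 2).mul m3).mono (by norm_num)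
  have x2m : InT F x y 6 (c2 + d2 * (G ^ 2 * T) + (G ^ 2 * T) ^ 2 * e2) := by
    refine (c2m.add ?_).add ?_
    · exact (d2m.mul hδ).mono (by norm_num)
    · exact ((hδ.pow 2).mul m2).mono (by norm_num)
  obtain ⟨X3, hX3⟩ : ∃ z, z = c3 + d3 * (G ^ 2 * T) + (G ^ 2 * T) ^ 2 * e3 := ⟨_, rfl⟩
  obtain ⟨X2, hX2⟩ : ∃ z, z = c2 + d2 * (G ^ 2 * T) + (G ^ 2 * T) ^ 2 * e2 := ⟨_, rfl⟩
  obtain ⟨B, hB⟩ : ∃ z, z = 3 * ((d3 + G ^ 2 * T * e3) * v ^ 2) + 2 * ((d2 + G ^ 2 * T * e2) * v) +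
      (d1 + G ^ 2 * T * e1) := ⟨_, rfl⟩
  rw [← hX3] at x3m ⊢
  rw [← hX2] at x2m ⊢
  rw [← hB] at Bm
  obtain ⟨Z, hXZ, Zm, hZ⟩ := exists_quad (F := F) (x := x) (y := y)
    ((d3 * v ^ 3 + d2 * v ^ 2 + d1 * v + d0) * T + G ^ 2 * T ^ 2 *
      (e3 * v ^ 3 + e2 * v ^ 2 + e1 * v + e0))
    (G * T * B)
    (6 * v ^ 2 + 3 * (X3 * v) + X2)
    (G * (4 * v + X3)) (G ^ 2)
    (dvd_add (Dvd.intro_left _ rfl) ⟨G ^ 2 * T * (e3 * v ^ 3 + e2 * v ^ 2 + e1 * v + e0), by ring⟩)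
    ⟨G * B, by ring⟩
    (by
      refine InT.add ?_ ?_
      · exact (fxm.mul Tm).mono (by norm_num)
      · exact (((gm.pow 2).mul (Tm.pow 2)).mul Am).mono (by norm_num))
    (((gm.mul Tm).mul Bm).mono (by norm_num))
    (by
      refine (InT.add ?_ ?_).add x2m
      · exact nm 6 ((ym.pow 2).mono (by norm_num))
      · exact nm 3 ((x3m.mul ym).mono (by norm_num)))
    ((gm.mul ((nm 4 ym).add x3m)).mono (by norm_num))
    ((gm.pow 2).mono (by norm_num))
  refine ⟨v + G * Z, ym.add ((gm.mul Zm).mono (by norm_num)), ?_, ?_⟩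
  · have hz : PowerSeries.constantCoeff Z = 0 := PowerSeries.X_dvd_iff.1 hXZ
    rw [map_add, map_mul, hz, hv, hcx]
    simp
  · have key : (v + G * Z) ^ 4 + X3 * (v + G * Z) ^ 3 + X2 * (v + G * Z) ^ 2 +
        (c1 + d1 * (G ^ 2 * T) + (G ^ 2 * T) ^ 2 * e1) * (v + G * Z) +
        (c0 + d0 * (G ^ 2 * T) + (G ^ 2 * T) ^ 2 * e0) =
        (v ^ 4 + c3 * v ^ 3 + c2 * v ^ 2 + c1 * v + c0) +
        G * Z * (4 * v ^ 3 + 3 * c3 * v ^ 2 + 2 * c2 * v + c1 - G) +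
        G ^ 2 * (Z + ((d3 * v ^ 3 + d2 * v ^ 2 + d1 * v + d0) * T + G ^ 2 * T ^ 2 *
      (e3 * v ^ 3 + e2 * v ^ 2 + e1 * v + e0) + G * T * B * Z +
        Z ^ 2 * (6 * v ^ 2 + 3 * (X3 * v) + X2) + Z ^ 3 * (G * (4 * v + X3)) + Z ^ 4 * G ^ 2)) := by
      rw [hB, hX3, hX2]
      ring
    rw [key, hZ, hf', ← hg']
    ring

end Curve
end StepanovCurve

namespace StepanovCurve
open Polynomial

section Ring
variable (F : Type*) [Field F]

/-- The coordinate ring of the curve. -/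
abbrev O : Type _ := AdjoinRoot (fpoly F)

noncomputable def xx : O F := AdjoinRoot.of (fpoly F) X
noncomputable def yy : O F := AdjoinRoot.root (fpoly F)

variable {F}

lemma aeval_xx (c : F[X]) : aeval (xx F) c = AdjoinRoot.of (fpoly F) c := by
  have h : (aeval (xx F) : F[X] →ₐ[F] O F) =
      (IsScalarTower.toAlgHom F F[X] (O F)) := by
    apply Polynomial.algHom_ext
    simp [xx]
  rw [h]
  simp

lemma fval_xx_yy : fval F (xx F) (yy F) = 0 := by
  have h := AdjoinRoot.eval₂_root (fpoly F)
  rw [← fpoly_eval₂]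
  have e : ((aeval (xx F) : F[X] →ₐ[F] O F) : F[X] →+* O F) = AdjoinRoot.of (fpoly F) :=
    RingHom.ext fun c => aeval_xx c
  rw [e]
  exact h

section EvalHom
variable {R : Type*} [CommRing R] [Algebra F R]

noncomputable def evalHom (x y : R) (h : fval F x y = 0) : O F →ₐ[F] R :=
  AdjoinRoot.liftAlgHom (fpoly F) (aeval x) y (by rw [← h, ← fpoly_eval₂])

variable {x y : R} {h : fval F x y = 0}

@[simp] lemma evalHom_of (c : F[X]) : evalHom x y h (AdjoinRoot.of (fpoly F) c) = aeval x c := by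
  simp [evalHom]

@[simp] lemma evalHom_xx : evalHom x y h (xx F) = x := by
  simp [xx]

@[simp] lemma evalHom_yy : evalHom x y h (yy F) = y := by
  simp [evalHom, yy]

lemma O_ext {a b : O F →ₐ[F] R} (hx : a (xx F) = b (xx F)) (hy : a (yy F) = b (yy F)) : a = b := by
  have key : ∀ p : F[X][X], a (AdjoinRoot.mk _ p) = b (AdjoinRoot.mk _ p) := by
    intro p
    induction p using Polynomial.induction_on' with
    | add p q hp hq => simp only [map_add, hp, hq]
    | monomial n c =>
      rw [← C_mul_X_pow_eq_monomial, map_mul, map_mul, map_mul, map_pow, map_pow, map_pow]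
      have e1 : AdjoinRoot.mk (fpoly F) X = yy F := rfl
      have e2 : AdjoinRoot.mk (fpoly F) (C c) = aeval (xx F) c := by
        rw [aeval_xx]; rfl
      rw [e1, e2, hy, ← aeval_algHom_apply, ← aeval_algHom_apply, hx]
  refine AlgHom.ext fun h => ?_
  obtain ⟨p, rfl⟩ := AdjoinRoot.mk_surjective h
  exact key p

end EvalHom

lemma map_fval {R S : Type*} [CommRing R] [Algebra F R] [CommRing S] [Algebra F S]
    (φ : R →ₐ[F] S) (x y : R) : φ (fval F x y) = fval F (φ x) (φ y) := by
  simp only [fval, map_add, map_mul, map_pow, ← aeval_algHom_apply]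

lemma map_gval {R S : Type*} [CommRing R] [Algebra F R] [CommRing S] [Algebra F S]
    (φ : R →ₐ[F] S) (x y : R) : φ (gval F x y) = gval F (φ x) (φ y) := by
  simp only [gval, map_add, map_mul, map_pow, ← aeval_algHom_apply, map_ofNat]

variable (F)
noncomputable def ups : PowerSeries (O F) := (exists_lift (fval_xx_yy (F := F))).choose
lemma ups_InT : InT F (xx F) (yy F) 3 (ups F) :=
  (exists_lift (fval_xx_yy (F := F))).choose_spec.1
lemma ups_const : PowerSeries.constantCoeff (ups F) = yy F :=
  (exists_lift (fval_xx_yy (F := F))).choose_spec.2.1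

/-- The derivative in the second variable as an element of the coordinate ring. -/
noncomputable def gg : O F := gval F (xx F) (yy F)

lemma ups_eq : fval F (PowerSeries.C (xx F) + PowerSeries.C (gg F ^ 2) * PowerSeries.X)
    (ups F) = 0 :=
  (exists_lift (fval_xx_yy (F := F))).choose_spec.2.2

noncomputable def tau : O F →ₐ[F] PowerSeries (O F) :=
  evalHom (PowerSeries.C (xx F) + PowerSeries.C (gg F ^ 2) * PowerSeries.X) (ups F) (ups_eq F)

variable {F}

lemma tau_InT {n : ℤ} {h : O F} (hh : h ∈ W F (xx F) (yy F) n) :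
    InT F (xx F) (yy F) n (tau F h) := by
  have hξ : InT F (xx F) (yy F) 1
      (PowerSeries.C (xx F) + PowerSeries.C (gg F ^ 2) * PowerSeries.X) := by
    refine (InT.C W_x).add ?_
    rw [map_pow]
    exact (((InT.C (gval_mem (F := F))).pow 2).mul InT.X).mono (by norm_num)
  unfold W at hh
  induction hh using Submodule.span_induction with
  | mem r hr =>
    obtain ⟨a, j, haj, rfl⟩ := hr
    rw [map_mul, map_pow, map_pow, tau, evalHom_xx, evalHom_yy]
    exact ((hξ.pow a).mul ((ups_InT F).pow j)).mono (by linarith)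
  | zero => rw [map_zero]; exact InT.zero
  | add p q _ _ hp hq => rw [map_add]; exact hp.add hq
  | smul r p _ hp =>
    rw [Algebra.smul_def, map_mul, AlgHom.commutes, PowerSeries.algebraMap_apply]
    exact hp.algebraMap_mul r

section Rho
variable {K : Type*} [Field K] [Algebra F K] {x y : K} (h : fval F x y = 0)

/-- Expansion at a nonsingular (unramified) point. -/
noncomputable def rho : O F →+* PowerSeries K :=
  (PowerSeries.rescale ((gval F x y ^ 2)⁻¹)).comp
    ((PowerSeries.map (evalHom x y h : O F →+* K)).comp (tau F : O F →+* PowerSeries (O F)))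

lemma coeff_rho (m : ℕ) (u : O F) : PowerSeries.coeff m (rho h u) =
    ((gval F x y ^ 2)⁻¹) ^ m * evalHom x y h (PowerSeries.coeff m (tau F u)) := by
  simp [rho]

lemma tau_const (u : O F) : PowerSeries.constantCoeff (tau F u) = u := by
  let κ : PowerSeries (O F) →ₐ[F] O F :=
    { (PowerSeries.constantCoeff : PowerSeries (O F) →+* O F) with
      commutes' := fun r => by
        simp [PowerSeries.algebraMap_apply] }
  have hk : ∀ p, κ p = PowerSeries.constantCoeff p := fun _ => rfl
  have : κ.comp (tau F) = AlgHom.id F (O F) := by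
    apply O_ext
    · simp [tau, hk]
    · simp [tau, hk, ups_const]
  have := DFunLike.congr_fun this u
  simpa [hk] using this

lemma rho_const (u : O F) : PowerSeries.constantCoeff (rho h u) = evalHom x y h u := by
  rw [← PowerSeries.coeff_zero_eq_constantCoeff_apply, coeff_rho,
    PowerSeries.coeff_zero_eq_constantCoeff_apply, tau_const]
  simp

lemma rho_algebraMap (r : F) : rho h (algebraMap F (O F) r) = PowerSeries.C (algebraMap F K r) := by
  ext m
  rw [coeff_rho, AlgHom.commutes, PowerSeries.algebraMap_apply, PowerSeries.coeff_C,
    PowerSeries.coeff_C]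
  split_ifs with hm
  · subst hm; simp
  · simp

lemma rho_xx (hg : gval F x y ≠ 0) : rho h (xx F) = PowerSeries.C x + PowerSeries.X := by
  have e : evalHom x y h (gg F) = gval F x y := by
    rw [gg, map_gval, evalHom_xx, evalHom_yy]
  rw [rho]
  simp only [RingHom.comp_apply, RingHom.coe_coe, tau, evalHom_xx, map_add, map_mul,
    PowerSeries.map_C, PowerSeries.map_X, PowerSeries.rescale_X]
  have hC : ∀ a b : K, PowerSeries.rescale a (PowerSeries.C b) = PowerSeries.C b := by
    intro a b
    ext m
    simp only [PowerSeries.coeff_rescale, PowerSeries.coeff_C]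
    split_ifs with hm
    · subst hm; simp
    · simp
  rw [hC, hC]
  simp only [RingHom.coe_coe, evalHom_xx, map_pow, e]
  rw [← mul_assoc, ← map_pow, ← map_mul]
  rw [mul_inv_cancel₀ (pow_ne_zero 2 hg), map_one, one_mul]

lemma rho_of (hg : gval F x y ≠ 0) (c : F[X]) :
    rho h (AdjoinRoot.of (fpoly F) c) = aeval (PowerSeries.C x + PowerSeries.X) c := by
  rw [← rho_xx h hg, ← aeval_xx]
  let r : O F →ₐ[F] PowerSeries K :=
    { rho h with
      commutes' := fun a => by
        have := rho_algebraMap h a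
        rw [PowerSeries.algebraMap_apply]
        exact this }
  exact (aeval_algHom_apply r (xx F) c).symm

end Rho
end Ring
end StepanovCurve

namespace StepanovCurve
open Polynomial

section Red
variable {F : Type*} [Field F] {R : Type*} [CommRing R] [Algebra F R]

/-- Span of reduced monomials of bounded weight. -/
def Red (F : Type*) [Field F] {R : Type*} [CommRing R] [Algebra F R] (x y z : R) (d n : ℕ) :
    Submodule F R :=
  Submodule.span F {r | ∃ a j k : ℕ, j < 4 ∧ k < d ∧ a + 3 * j + 3 * k ≤ n ∧
    r = x ^ a * y ^ j * z ^ k}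

variable {x y z : R} {d : ℕ}

lemma Red_mono {n m : ℕ} (h : n ≤ m) : Red F x y z d n ≤ Red F x y z d m := by
  apply Submodule.span_mono
  rintro r ⟨a, j, k, h1, h2, h3, rfl⟩
  exact ⟨a, j, k, h1, h2, by omega, rfl⟩

lemma Red_mul_of {n m : ℕ} (w : R) (hw : ∀ a j k : ℕ, j < 4 → k < d → a + 3 * j + 3 * k ≤ n →
    w * (x ^ a * y ^ j * z ^ k) ∈ Red F x y z d m) {r : R} (hr : r ∈ Red F x y z d n) :
    w * r ∈ Red F x y z d m := by
  unfold Red at hr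
  induction hr using Submodule.span_induction with
  | mem r hr =>
    obtain ⟨a, j, k, h1, h2, h3, rfl⟩ := hr
    exact hw a j k h1 h2 h3
  | zero => simp
  | add p q _ _ hp hq => rw [mul_add]; exact add_mem hp hq
  | smul c p _ hp => rw [mul_smul_comm]; exact Submodule.smul_mem _ _ hp

lemma Red_x {n : ℕ} {r : R} (hr : r ∈ Red F x y z d n) : x * r ∈ Red F x y z d (n + 1) := by
  refine Red_mul_of x (fun a j k h1 h2 h3 => ?_) hr
  exact Submodule.subset_span ⟨a + 1, j, k, h1, h2, by omega, by ring⟩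

lemma Red_xpow {n : ℕ} (i : ℕ) {r : R} (hr : r ∈ Red F x y z d n) :
    x ^ i * r ∈ Red F x y z d (n + i) := by
  induction i with
  | zero => simpa using hr
  | succ i ih => rw [pow_succ', mul_assoc]; exact Red_x ih

lemma Red_aeval {n : ℕ} (c : F[X]) (e : ℕ) (hc : c.natDegree ≤ e) {r : R}
    (hr : r ∈ Red F x y z d n) : aeval x c * r ∈ Red F x y z d (n + e) := by
  rw [aeval_eq_sum_range, Finset.sum_mul]
  refine Submodule.sum_mem _ fun i hi => ?_
  rw [smul_mul_assoc]
  refine Submodule.smul_mem _ _ (Red_mono ?_ (Red_xpow i hr))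
  have := Finset.mem_range.1 hi
  omega

lemma Red_y (hf : fval F x y = 0) {n : ℕ} {r : R} (hr : r ∈ Red F x y z d n) :
    y * r ∈ Red F x y z d (n + 3) := by
  refine Red_mul_of y (fun a j k h1 h2 h3 => ?_) hr
  by_cases hj : j = 3
  · subst hj
    have hm : ∀ j', j' < 4 → x ^ a * y ^ j' * z ^ k ∈ Red F x y z d (a + 3 * j' + 3 * k) :=
      fun j' h => Submodule.subset_span ⟨a, j', k, h, h2, le_rfl, rfl⟩
    have e : y * (x ^ a * y ^ 3 * z ^ k) =
        -(aeval x (k3 F) * (x ^ a * y ^ 3 * z ^ k) + aeval x (k2 F) * (x ^ a * y ^ 2 * z ^ k) +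
          aeval x (k1 F) * (x ^ a * y ^ 1 * z ^ k) + aeval x (k0 F) * (x ^ a * y ^ 0 * z ^ k)) := by
      rw [fval] at hf
      linear_combination (x ^ a * z ^ k) * hf
    rw [e]
    refine neg_mem (add_mem (add_mem (add_mem ?_ ?_) ?_) ?_)
    · exact Red_mono (by omega) (Red_aeval _ _ (k3_deg F) (hm 3 (by omega)))
    · exact Red_mono (by omega) (Red_aeval _ _ (k2_deg F) (hm 2 (by omega)))
    · exact Red_mono (by omega) (Red_aeval _ _ (k1_deg F) (hm 1 (by omega)))
    · exact Red_mono (by omega) (Red_aeval _ _ (k0_deg F) (hm 0 (by omega)))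
  · exact Submodule.subset_span ⟨a, j + 1, k, by omega, h2, by omega, by ring⟩

lemma Red_ypow (hf : fval F x y = 0) {n : ℕ} (i : ℕ) {r : R} (hr : r ∈ Red F x y z d n) :
    y ^ i * r ∈ Red F x y z d (n + 3 * i) := by
  induction i with
  | zero => simpa using hr
  | succ i ih => rw [pow_succ', mul_assoc]; exact Red_y hf ih

lemma W_le_Red (hd : 0 < d) (hf : fval F x y = 0) (n : ℕ) :
    W F x y n ≤ Red F x y z d n := by
  unfold W
  rw [Submodule.span_le]
  rintro r ⟨a, j, h, rfl⟩
  have h1 : (1 : R) ∈ Red F x y z d 0 := Submodule.subset_span ⟨0, 0, 0, by omega, hd, by omega,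
    by simp⟩
  have := Red_xpow a (Red_ypow hf j h1)
  rw [mul_one] at this
  exact Red_mono (by omega) this

/-- The residual cubic. -/
noncomputable def Gval (F : Type*) [Field F] {R : Type*} [CommRing R] [Algebra F R]
    (x y z : R) : R :=
  z ^ 3 + (y + aeval x (k3 F)) * z ^ 2 + (y ^ 2 + aeval x (k3 F) * y + aeval x (k2 F)) * z +
    (y ^ 3 + aeval x (k3 F) * y ^ 2 + aeval x (k2 F) * y + aeval x (k1 F))

lemma Red_z (hf : fval F x y = 0) (hG : Gval F x y z = 0) {n : ℕ} {r : R}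
    (hr : r ∈ Red F x y z 3 n) : z * r ∈ Red F x y z 3 (n + 3) := by
  refine Red_mul_of z (fun a j k h1 h2 h3 => ?_) hr
  by_cases hk : k = 2
  · subst hk
    have hm : ∀ k', k' < 3 → x ^ a * y ^ j * z ^ k' ∈ Red F x y z 3 (a + 3 * j + 3 * k') :=
      fun k' h => Submodule.subset_span ⟨a, j, k', h1, h, le_rfl, rfl⟩
    have e : z * (x ^ a * y ^ j * z ^ 2) =
        -((y * (x ^ a * y ^ j * z ^ 2) + aeval x (k3 F) * (x ^ a * y ^ j * z ^ 2)) +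
        (y ^ 2 * (x ^ a * y ^ j * z ^ 1) + aeval x (k3 F) * (y * (x ^ a * y ^ j * z ^ 1)) +
          aeval x (k2 F) * (x ^ a * y ^ j * z ^ 1)) +
        (y ^ 3 * (x ^ a * y ^ j * z ^ 0) + aeval x (k3 F) * (y ^ 2 * (x ^ a * y ^ j * z ^ 0)) +
          aeval x (k2 F) * (y * (x ^ a * y ^ j * z ^ 0)) +
          aeval x (k1 F) * (x ^ a * y ^ j * z ^ 0))) := by
      rw [Gval] at hG
      linear_combination (x ^ a * y ^ j) * hG
    have m2 := hm 2 (by omega)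
    have m1 := hm 1 (by omega)
    have m0 := hm 0 (by omega)
    rw [e]
    refine neg_mem (add_mem (add_mem (add_mem ?_ ?_) (add_mem (add_mem ?_ ?_) ?_))
      (add_mem (add_mem (add_mem ?_ ?_) ?_) ?_))
    · exact Red_mono (by omega) (Red_y hf m2)
    · exact Red_mono (by omega) (Red_aeval _ _ (k3_deg F) m2)
    · exact Red_mono (by omega) (Red_ypow hf 2 m1)
    · exact Red_mono (by omega) (Red_aeval _ _ (k3_deg F) (Red_y hf m1))
    · exact Red_mono (by omega) (Red_aeval _ _ (k2_deg F) m1)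
    · exact Red_mono (by omega) (Red_ypow hf 3 m0)
    · exact Red_mono (by omega) (Red_aeval _ _ (k3_deg F) (Red_ypow hf 2 m0))
    · exact Red_mono (by omega) (Red_aeval _ _ (k2_deg F) (Red_y hf m0))
    · exact Red_mono (by omega) (Red_aeval _ _ (k1_deg F) m0)
  · exact Submodule.subset_span ⟨a, j, k + 1, h1, by omega, by omega, by ring⟩

lemma Red_zpow (hf : fval F x y = 0) (hG : Gval F x y z = 0) {n : ℕ} (i : ℕ) {r : R}
    (hr : r ∈ Red F x y z 3 n) : z ^ i * r ∈ Red F x y z 3 (n + 3 * i) := by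
  induction i with
  | zero => simpa using hr
  | succ i ih => rw [pow_succ', mul_assoc]; exact Red_z hf hG ih

lemma Red_range (n : ℕ) : Red F x y z 3 n = Submodule.span F (Set.range
    (fun p : (Σ jk : Fin 4 × Fin 3, Fin (n + 1 - 3 * jk.1 - 3 * jk.2)) =>
      x ^ (p.2 : ℕ) * y ^ (p.1.1 : ℕ) * z ^ (p.1.2 : ℕ))) := by
  unfold Red
  congr 1
  ext r
  constructor
  · rintro ⟨a, j, k, h1, h2, h3, rfl⟩
    exact ⟨⟨(⟨j, h1⟩, ⟨k, h2⟩), ⟨a, by simp only; omega⟩⟩, rfl⟩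
  · rintro ⟨⟨⟨j, k⟩, a⟩, rfl⟩
    refine ⟨a, j, k, j.2, k.2, ?_, rfl⟩
    have := a.2
    simp only at this
    omega

instance Red_finite (n : ℕ) : Module.Finite F (Red F x y z 3 n) := by
  rw [Red_range]
  exact Module.Finite.span_of_finite F (Set.finite_range _)

lemma Red_finrank (n : ℕ) (hn : 15 ≤ n) :
    Module.finrank F (Red F x y z 3 n) ≤ 12 * n - 78 := by
  rw [Red_range]
  refine (finrank_range_le_card (R := F) _).trans ?_
  rw [Fintype.card_sigma]
  simp only [Fintype.card_fin, Fintype.sum_prod_type, Fin.sum_univ_four, Fin.sum_univ_three]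
  simp
  omega

end Red

section R2
variable (F : Type*) [Field F]

noncomputable def Gpoly : (O F)[X] :=
  X ^ 3 + C (yy F + aeval (xx F) (k3 F)) * X ^ 2 +
    C (yy F ^ 2 + aeval (xx F) (k3 F) * yy F + aeval (xx F) (k2 F)) * X +
    C (yy F ^ 3 + aeval (xx F) (k3 F) * yy F ^ 2 + aeval (xx F) (k2 F) * yy F + aeval (xx F) (k1 F))

abbrev R2 : Type _ := AdjoinRoot (Gpoly F)

variable {F}

noncomputable def iot : O F →ₐ[F] R2 F := IsScalarTower.toAlgHom F (O F) (R2 F)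
noncomputable def zz : R2 F := AdjoinRoot.root (Gpoly F)

lemma fval_iot : fval F (iot (xx F)) (iot (yy F)) = 0 := by
  rw [← map_fval, fval_xx_yy, map_zero]

lemma Gval_iot : Gval F (iot (xx F)) (iot (yy F)) (zz (F := F)) = 0 := by
  have h := AdjoinRoot.eval₂_root (Gpoly F)
  have e : ∀ u, AdjoinRoot.of (Gpoly F) u = iot u := fun u => rfl
  rw [Gpoly] at h
  simp only [eval₂_add, eval₂_mul, eval₂_pow, eval₂_X, eval₂_C] at h
  rw [← Gpoly] at h
  simp only [e, map_add, map_mul, map_pow, ← aeval_algHom_apply] at h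
  exact h

lemma exists_ev2 {K : Type*} [Field K] [Algebra F K] {x y z : K} (h : fval F x y = 0)
    (hz : fval F x z = 0) (hne : z ≠ y) :
    ∃ e : R2 F →ₐ[F] K, (∀ u, e (iot u) = evalHom x y h u) ∧ e zz = z := by
  have hG : Gval F x y z = 0 := by
    have : (z - y) * Gval F x y z = 0 := by
      rw [fval] at h hz
      rw [Gval]
      linear_combination hz - h
    exact (mul_eq_zero.1 this).resolve_left (sub_ne_zero.2 hne)
  refine ⟨AdjoinRoot.liftAlgHom (Gpoly F) (evalHom x y h) z ?_, ?_, ?_⟩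
  · rw [Gpoly]
    simp only [eval₂_add, eval₂_mul, eval₂_pow, eval₂_X, eval₂_C, RingHom.coe_coe,
      map_add, map_mul, map_pow, ← aeval_algHom_apply, evalHom_xx, evalHom_yy]
    exact hG
  · intro u
    exact AdjoinRoot.liftAlgHom_of (Gpoly F) (evalHom x y h) z _ u
  · exact AdjoinRoot.liftAlgHom_root (Gpoly F) (evalHom x y h) z _

end R2
end StepanovCurve

namespace StepanovCurve
open Polynomial

section Norm
variable (F : Type*) [Field F]

/-- The power basis of the coordinate ring. -/
noncomputable def bas : Module.Basis (Fin 4) F[X] (O F) :=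
  (AdjoinRoot.powerBasis' (fpoly_monic F)).basis.reindex
    (finCongr (by rw [AdjoinRoot.powerBasis'_dim, fpoly_natDegree]))

variable {F}

lemma bas_apply (i : Fin 4) : bas F i = yy F ^ (i : ℕ) := by
  simp [bas, yy]

lemma smul_eq_aeval (c : F[X]) (u : O F) : c • u = aeval (xx F) c * u := by
  rw [Algebra.smul_def, aeval_xx]; rfl

lemma repr_mem {n : ℕ} {u : O F} (hu : u ∈ Red F (xx F) (yy F) 1 1 n) (i : Fin 4) :
    (bas F).repr u i ∈ degreeLT F (n + 1 - 3 * i) := by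
  unfold Red at hu
  induction hu using Submodule.span_induction with
  | mem r hr =>
    obtain ⟨a, j, k, h1, h2, h3, rfl⟩ := hr
    have e : xx F ^ a * yy F ^ j * 1 ^ k = (X ^ a : F[X]) • bas F ⟨j, h1⟩ := by
      rw [bas_apply, smul_eq_aeval]; simp
    rw [e, map_smul, Module.Basis.repr_self, Finsupp.smul_single, Finsupp.single_apply]
    split_ifs with hij
    · subst hij
      rw [smul_eq_mul, mul_one, mem_degreeLT, degree_X_pow]
      have : a < n + 1 - 3 * j := by omega
      exact_mod_cast this
    · exact zero_mem _
  | zero => simp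
  | add p q _ _ hp hq => rw [map_add]; exact add_mem hp hq
  | smul c p _ hp =>
    have e : c • p = (C c : F[X]) • p := by
      rw [smul_eq_aeval, aeval_C, Algebra.smul_def]
    rw [e, map_smul, Finsupp.smul_apply, smul_eq_mul, ← smul_eq_C_mul]
    exact Submodule.smul_mem _ _ hp

lemma mat_deg {n : ℕ} {u : O F} (hu : u ∈ W F (xx F) (yy F) n) (i j : Fin 4) :
    Algebra.leftMulMatrix (bas F) u i j ∈ degreeLT F (n + 3 * j + 1 - 3 * i) := by
  rw [Algebra.leftMulMatrix_eq_repr_mul, bas_apply]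
  refine repr_mem (W_le_Red (by omega) fval_xx_yy _ ?_) i
  have := W_mul hu (W_ypow (F := F) (x := xx F) (y := yy F) j)
  exact_mod_cast this

lemma norm_deg {n : ℕ} {u : O F} (hu : u ∈ W F (xx F) (yy F) n) :
    (Algebra.norm F[X] u).natDegree ≤ 4 * n := by
  rw [Algebra.norm_eq_matrix_det (bas F), Matrix.det_apply]
  refine natDegree_sum_le_of_forall_le _ _ fun σ _ => ?_
  refine (natDegree_smul_le _ _).trans ?_
  by_cases h0 : ∃ i, Algebra.leftMulMatrix (bas F) u (σ i) i = 0
  · obtain ⟨i, hi⟩ := h0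
    have : ∏ i, Algebra.leftMulMatrix (bas F) u (σ i) i = 0 :=
      Finset.prod_eq_zero (Finset.mem_univ i) hi
    rw [this]
    simp
  push Not at h0
  refine (natDegree_prod_le _ _).trans ?_
  have h1 : ∀ i : Fin 4, (Algebra.leftMulMatrix (bas F) u (σ i) i).natDegree + 3 * (σ i : ℕ) ≤
      n + 3 * i := by
    intro i
    have := mat_deg hu (σ i) i
    rw [mem_degreeLT, ← natDegree_lt_iff_degree_lt (h0 i)] at this
    omega
  have h2 := Finset.sum_le_sum fun i (_ : i ∈ Finset.univ) => h1 i
  rw [Finset.sum_add_distrib, Finset.sum_add_distrib,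
    Equiv.sum_comp σ (fun i : Fin 4 => 3 * (i : ℕ))] at h2
  simp at h2
  exact h2

lemma exists_norm_mul (u : O F) : ∃ v, AdjoinRoot.of (fpoly F) (Algebra.norm F[X] u) = u * v := by
  set M := Algebra.leftMulMatrix (bas F) u with hM
  refine ⟨∑ i, M.adjugate i 0 • bas F i, ?_⟩
  have h1 : ∀ j, u * bas F j = ∑ i, M i j • bas F i := by
    intro j
    conv_lhs => rw [← (bas F).sum_repr (u * bas F j)]
    refine Finset.sum_congr rfl fun i _ => ?_
    rw [hM, Algebra.leftMulMatrix_eq_repr_mul]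
  rw [Finset.mul_sum]
  simp only [mul_smul_comm, h1, Finset.smul_sum, smul_smul]
  rw [Finset.sum_comm]
  simp only [← Finset.sum_smul]
  have h2 : ∀ k, ∑ i, M.adjugate i 0 * M k i = (M * M.adjugate) k 0 := by
    intro k
    rw [Matrix.mul_apply]
    exact Finset.sum_congr rfl fun i _ => mul_comm _ _
  simp only [h2, Matrix.mul_adjugate]
  rw [Finset.sum_eq_single 0]
  · rw [Algebra.norm_eq_matrix_det (bas F), ← hM, smul_eq_aeval, aeval_xx, bas_apply]
    simp
  · intro b _ hb
    simp [hb]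
  · simp

lemma norm_rho {K : Type*} [Field K] [Algebra F K] (x : K) (y : Fin 4 → K)
    (hy : Function.Injective y) (h : ∀ r, fval F x (y r) = 0) (hg : ∀ r, gval F x (y r) ≠ 0)
    (u : O F) : aeval (PowerSeries.C x + PowerSeries.X) (Algebra.norm F[X] u) =
      ∏ r, rho (h r) u := by
  set M := Algebra.leftMulMatrix (bas F) u with hM
  let φ : F[X] →+* PowerSeries K :=
    ((aeval (PowerSeries.C x + PowerSeries.X) : F[X] →ₐ[F] PowerSeries K) : F[X] →+* PowerSeries K)
  let V : Matrix (Fin 4) (Fin 4) (PowerSeries K) := Matrix.vandermonde fun r => rho (h r) (yy F)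
  have hV : V.det ≠ 0 := by
    rw [Matrix.det_vandermonde_ne_zero_iff]
    intro r s hrs
    have := congrArg PowerSeries.constantCoeff hrs
    simp only [rho_const, evalHom_yy] at this
    exact hy this
  have key : V * (φ.mapMatrix M) = Matrix.diagonal (fun r => rho (h r) u) * V := by
    ext1 r j
    rw [Matrix.mul_apply, Matrix.diagonal_mul]
    have e := congrArg (rho (h r)) ((bas F).sum_repr (u * bas F j))
    rw [map_sum] at e
    have e2 : rho (h r) (u * bas F j) = rho (h r) u * V r j := by
      rw [map_mul, bas_apply, map_pow]; rfl
    rw [← e2, ← e]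
    refine Finset.sum_congr rfl fun i _ => ?_
    have e3 : V r i = rho (h r) (bas F i) := by
      rw [bas_apply, map_pow]; rfl
    have e4 : φ.mapMatrix M i j = aeval (PowerSeries.C x + PowerSeries.X)
        ((bas F).repr (u * bas F j) i) := by
      rw [← Algebra.leftMulMatrix_eq_repr_mul]; rfl
    rw [e3, e4, smul_eq_aeval, RingHom.map_mul (rho (h r)), aeval_xx, rho_of (h r) (hg r), mul_comm]
  have := congrArg Matrix.det key
  rw [Matrix.det_mul, Matrix.det_mul, Matrix.det_diagonal, mul_comm, ← RingHom.map_det] at this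
  have := mul_right_cancel₀ hV this
  rw [Algebra.norm_eq_matrix_det (bas F), ← hM]
  exact this

instance : Module.Finite F[X] (O F) := Module.Finite.of_basis (bas F)
instance : Module.Free F[X] (O F) := Module.Free.of_basis (bas F)

lemma norm_ne_zero [IsDomain (O F)] {u : O F} (hu : u ≠ 0) : Algebra.norm F[X] u ≠ 0 :=
  Algebra.norm_ne_zero_iff.2 hu

/-- Linear independence of the reduced monomials. -/
noncomputable def basF : Module.Basis (ℕ × Fin 4) F (O F) :=
  (Polynomial.basisMonomials F).smulTower (bas F)

lemma basF_apply (p : ℕ × Fin 4) : basF (F := F) p = xx F ^ p.1 * yy F ^ (p.2 : ℕ) := by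
  rw [basF, Module.Basis.smulTower_apply, bas_apply, smul_eq_aeval]
  simp [aeval_monomial]

end Norm
end StepanovCurve

namespace StepanovCurve
open Polynomial

section Nonvanish
variable {F : Type*} [Field F]

lemma aeval_taylor {K : Type*} [Field K] [Algebra F K] (x : F) (c : F[X]) :
    aeval (PowerSeries.C (algebraMap F K x) + PowerSeries.X) c =
      (((c.comp (X + C x)).map (algebraMap F K) : K[X]) : PowerSeries K) := by
  induction c using Polynomial.induction_on' with
  | add p q hp hq => simp only [map_add, hp, hq, add_comp, Polynomial.map_add, coe_add]
  | monomial n a =>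
    simp only [aeval_monomial, monomial_comp, Polynomial.map_mul, map_C, Polynomial.map_pow,
      Polynomial.map_add, map_X, coe_mul, coe_pow, coe_add, coe_C, coe_X,
      PowerSeries.algebraMap_apply]
    rw [add_comm]

lemma le_rootMultiplicity_of_dvd {K : Type*} [Field K] [Algebra F K] (x : F) (c : F[X]) (hc : c ≠ 0)
    (k : ℕ) (h : (PowerSeries.X : PowerSeries K) ^ k ∣
      aeval (PowerSeries.C (algebraMap F K x) + PowerSeries.X) c) : k ≤ c.rootMultiplicity x := by
  rw [aeval_taylor, PowerSeries.X_pow_dvd_iff] at h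
  have hne : c.comp (X + C x) ≠ 0 := by
    intro h0
    apply hc
    have := congrArg (fun p => Polynomial.comp p (X - C x)) h0
    simpa [comp_assoc] using this
  rw [rootMultiplicity_eq_rootMultiplicity, le_rootMultiplicity_iff hne, map_zero, sub_zero,
    X_pow_dvd_iff]
  intro d hd
  have := h d hd
  rw [coeff_coe, coeff_map] at this
  exact (map_eq_zero_iff _ (algebraMap F K).injective).1 this

lemma fval_zero_one : fval F (0 : F) 1 = 0 := by
  simp [fval, k3, k2, k1, k0]

lemma gval_zero_one : gval F (0 : F) 1 = 1 := by
  simp [gval, k3, k2, k1]; norm_num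

lemma eq_zero_of_dvd [IsDomain (O F)] {n : ℕ} {u : O F} (hu : u ∈ W F (xx F) (yy F) n)
    (h : (PowerSeries.X : PowerSeries F) ^ (4 * n + 1) ∣ rho (fval_zero_one (F := F)) u) :
    u = 0 := by
  by_contra hne
  obtain ⟨v, hv⟩ := exists_norm_mul u
  have h1 : (PowerSeries.X : PowerSeries F) ^ (4 * n + 1) ∣
      aeval (PowerSeries.C (algebraMap F F 0) + PowerSeries.X) (Algebra.norm F[X] u) := by
    have := rho_of (fval_zero_one (F := F)) (by rw [gval_zero_one]; exact one_ne_zero)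
      (Algebra.norm F[X] u)
    rw [Algebra.algebraMap_self, RingHom.id_apply, ← this, hv, map_mul]
    exact Dvd.dvd.mul_right h _
  have h2 := le_rootMultiplicity_of_dvd (0 : F) _ (norm_ne_zero hne) _ h1
  have h3 : (Algebra.norm F[X] u).rootMultiplicity 0 ≤ (Algebra.norm F[X] u).natDegree := by
    classical
    rw [← count_roots]
    exact (Multiset.count_le_card _ _).trans (card_roots' _)
  have h4 := norm_deg hu
  omega

abbrev Idx (n : ℕ) : Type := Σ j : Fin 4, Fin (n + 1 - 3 * j)

noncomputable def mon {n : ℕ} (p : Idx n) : O F := xx F ^ (p.2 : ℕ) * yy F ^ (p.1 : ℕ)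

lemma mon_mem {n : ℕ} (p : Idx n) : mon p ∈ W F (xx F) (yy F) n := by
  refine W_mono ?_ (W_mon _ _)
  have := p.2.2
  omega

lemma mon_indep (n : ℕ) : LinearIndependent F (mon : Idx n → O F) := by
  have h := (basF (F := F)).linearIndependent.comp
    (fun p : Idx n => ((p.2 : ℕ), p.1)) (by
      rintro ⟨j, a⟩ ⟨j', a'⟩ h
      simp only [Prod.mk.injEq] at h
      obtain ⟨h1, rfl⟩ := h
      congr 1
      exact Fin.ext h1)
  convert h using 1
  ext p
  simp [basF_apply, mon]

lemma card_Idx (n : ℕ) (hn : 9 ≤ n) : Fintype.card (Idx n) = 4 * n - 14 := by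
  rw [Fintype.card_sigma]
  simp only [Fintype.card_fin, Fin.sum_univ_four]
  simp
  omega

variable [Fintype F]

lemma pow_card_series {K : Type*} [Field K] [Algebra F K] (v : PowerSeries K) :
    ∃ w, v = PowerSeries.X * w + PowerSeries.C (PowerSeries.constantCoeff v) ∧
     v ^ Fintype.card F = PowerSeries.X ^ Fintype.card F * w ^ Fintype.card F +
      PowerSeries.C (PowerSeries.constantCoeff v ^ Fintype.card F) := by
  refine ⟨_, PowerSeries.eq_X_mul_shift_add_const v, ?_⟩
  obtain ⟨p, hp⟩ := CharP.exists F
  have := hp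
  obtain ⟨n, hpr, hn⟩ := FiniteField.card F p
  have : Fact p.Prime := ⟨hpr⟩
  have : CharP K p := charP_of_injective_algebraMap (algebraMap F K).injective p
  have : CharP (PowerSeries K) p :=
    charP_of_injective_algebraMap (algebraMap K (PowerSeries K)).injective p
  conv_lhs => rw [PowerSeries.eq_X_mul_shift_add_const v]
  rw [hn, add_pow_char_pow, mul_pow, map_pow]

lemma nonvanish [IsDomain (O F)] {H U : ℕ} (hH : 4 * H < Fintype.card F)
    (c : Idx U → Idx H → F)
    (h : ∑ k, (∑ l, c k l • (mon l : O F)) * (mon k) ^ Fintype.card F = 0) : c = 0 := by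
  set q := Fintype.card F with hq
  let σ : O F →+* PowerSeries F := rho (fval_zero_one (F := F))
  have hσ : ∀ (a : F) (u : O F), σ (a • u) = PowerSeries.C a * σ u := by
    intro a u
    rw [Algebra.smul_def, map_mul]
    congr 1
    exact rho_algebraMap _ a
  let hh : Idx U → O F := fun k => ∑ l, c k l • (mon l : O F)
  have hhm : ∀ k, hh k ∈ W F (xx F) (yy F) H := fun k =>
    Submodule.sum_mem _ fun l _ => Submodule.smul_mem _ _ (mon_mem l)
  have step : ∀ v : Idx U → PowerSeries F, ∑ k, σ (hh k) * v k ^ q = 0 →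
      ∑ k, PowerSeries.constantCoeff (v k) • hh k = 0 ∧
      ∃ w : Idx U → PowerSeries F, (∀ k, v k = PowerSeries.X * w k +
        PowerSeries.C (PowerSeries.constantCoeff (v k))) ∧ ∑ k, σ (hh k) * w k ^ q = 0 := by
    intro v hv
    choose w hw1 hw2 using fun k => pow_card_series (F := F) (v k)
    have e1 : ∑ k, σ (hh k) * v k ^ q = PowerSeries.X ^ q * ∑ k, σ (hh k) * w k ^ q +
        σ (∑ k, PowerSeries.constantCoeff (v k) • hh k) := by
      rw [map_sum, Finset.mul_sum, ← Finset.sum_add_distrib]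
      refine Finset.sum_congr rfl fun k _ => ?_
      rw [hσ, hw2, FiniteField.pow_card]
      ring
    rw [hv] at e1
    have e2 : ∑ k, PowerSeries.constantCoeff (v k) • hh k = 0 := by
      refine eq_zero_of_dvd (n := H)
        (Submodule.sum_mem _ fun k _ => Submodule.smul_mem _ _ (hhm k)) ?_
      refine (pow_dvd_pow _ (Nat.succ_le_of_lt hH)).trans ?_
      refine ⟨-∑ k, σ (hh k) * w k ^ q, ?_⟩
      change σ _ = _
      linear_combination -e1
    refine ⟨e2, w, hw1, ?_⟩
    rw [e2, map_zero, add_zero] at e1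
    exact (mul_eq_zero.1 e1.symm).resolve_left (pow_ne_zero _ PowerSeries.X_ne_zero)
  have all : ∀ (b : ℕ) (v : Idx U → PowerSeries F), ∑ k, σ (hh k) * v k ^ q = 0 →
      ∑ k, PowerSeries.coeff b (v k) • hh k = 0 := by
    intro b
    induction b with
    | zero => intro v hv; simpa using (step v hv).1
    | succ b ih =>
      intro v hv
      obtain ⟨_, w, hw, hw'⟩ := step v hv
      have := ih w hw'
      convert this using 3 with k
      rw [hw k]
      simp [PowerSeries.coeff_succ_X_mul]
  have h0 : ∑ k, σ (hh k) * (σ (mon k)) ^ q = 0 := by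
    have := congrArg σ h
    rw [map_zero, map_sum] at this
    simpa only [map_mul, map_pow] using this
  have h1 : ∀ b l, ∑ k, PowerSeries.coeff b (σ (mon k)) * c k l = 0 := by
    intro b
    have := all b _ h0
    simp only [hh, Finset.smul_sum, smul_smul] at this
    rw [Finset.sum_comm] at this
    simp only [← Finset.sum_smul] at this
    exact Fintype.linearIndependent_iff.1 (mon_indep H) _ this
  have h2 : ∀ l, ∑ k, c k l • (mon k : O F) = 0 := by
    intro l
    refine eq_zero_of_dvd (n := U)
      (Submodule.sum_mem _ fun k _ => Submodule.smul_mem _ _ (mon_mem k)) ?_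
    have : rho (fval_zero_one (F := F)) (∑ k, c k l • (mon k : O F)) = 0 := by
      change σ _ = 0
      rw [map_sum]
      ext b
      rw [map_sum, map_zero, ← h1 b l]
      refine Finset.sum_congr rfl fun k _ => ?_
      rw [hσ, PowerSeries.coeff_C_mul, mul_comm]
    rw [this]
    exact dvd_zero _
  ext k l
  exact Fintype.linearIndependent_iff.1 (mon_indep U) _ (h2 l) k

end Nonvanish
end StepanovCurve

namespace StepanovCurve
open Polynomial

section LinAlg
variable {F : Type*} [Field F]

noncomputable def ee (m : ℕ) {U H : ℕ} (k : Idx U) (l : Idx H) : R2 F :=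
  zz ^ (k.1 : ℕ) * (iot (xx F) ^ (k.2 : ℕ) * iot (PowerSeries.coeff m (tau F (mon l))))

lemma ee_mem (m : ℕ) {U H : ℕ} (k : Idx U) (l : Idx H) :
    (ee m k l : R2 F) ∈ Red F (iot (xx F)) (iot (yy F)) zz 3 (H + U + 17 * m) := by
  have h1 : PowerSeries.coeff m (tau F (mon l)) ∈ W F (xx F) (yy F) ((H + 17 * m : ℕ) : ℤ) := by
    have := tau_InT (mon_mem (F := F) l) m
    exact_mod_cast this
  have h2 : ∀ (n : ℤ) (u : O F), u ∈ W F (xx F) (yy F) n →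
      iot u ∈ W F (iot (xx F)) (iot (yy F)) n := by
    intro n u hu
    unfold W at hu
    induction hu using Submodule.span_induction with
    | mem r hr =>
      obtain ⟨a, j, h, rfl⟩ := hr
      refine Submodule.subset_span ⟨a, j, h, by simp only [map_mul, map_pow]⟩
    | zero => simp
    | add p q _ _ hp hq => rw [map_add]; exact add_mem hp hq
    | smul c p _ hp => rw [map_smul]; exact Submodule.smul_mem _ _ hp
  have h3 := W_le_Red (z := zz) (d := 3) (by omega) fval_iot _ (h2 _ _ h1)
  have h4 := Red_zpow fval_iot Gval_iot (k.1 : ℕ) (Red_xpow (k.2 : ℕ) h3)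
  refine Red_mono ?_ h4
  have := k.2.2
  omega

lemma exists_coeffs (H : ℕ) (hH : 1981 ≤ H) : ∃ c : Idx 35 → Idx H → F, c ≠ 0 ∧
    ∀ m < 36, ∑ k, ∑ l, c k l • (ee m k l : R2 F) = 0 := by
  let L : (m : Fin 36) → (Idx 35 → Idx H → F) →ₗ[F]
      Red F (iot (xx F)) (iot (yy F)) (zz (F := F)) 3 (H + 35 + 17 * m) := fun m =>
    LinearMap.codRestrict _
      { toFun := fun c => ∑ k, ∑ l, c k l • (ee m k l : R2 F)
        map_add' := fun c c' => by
          simp only [Pi.add_apply, add_smul, Finset.sum_add_distrib]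
        map_smul' := fun r c => by
          simp only [Pi.smul_apply, smul_eq_mul, mul_smul, Finset.smul_sum, RingHom.id_apply] }
      (fun c => by
        change (∑ k, ∑ l, c k l • (ee (m : ℕ) k l : R2 F)) ∈ _
        exact Submodule.sum_mem _ fun k _ => Submodule.sum_mem _ fun l _ =>
          Submodule.smul_mem _ (c k l) (ee_mem (m : ℕ) k l))
  have hker : (LinearMap.pi L).ker ≠ ⊥ := by
    apply LinearMap.ker_ne_bot_of_finrank_lt
    rw [Module.finrank_pi_fintype, Module.finrank_pi_fintype]
    have h1 : ∀ m : Fin 36, Module.finrank F (Red F (iot (xx F)) (iot (yy F)) (zz (F := F)) 3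
        (H + 35 + 17 * m)) ≤ 12 * (H + 35) - 78 + 204 * m := fun m =>
      (Red_finrank _ (by omega)).trans (by omega)
    refine (Finset.sum_le_sum fun m _ => h1 m).trans_lt ?_
    simp only [Module.finrank_fintype_fun_eq_card, Finset.sum_const, Finset.card_univ, smul_eq_mul,
      card_Idx H (by omega), card_Idx 35 (by omega)]
    rw [Finset.sum_add_distrib, ← Finset.mul_sum, Finset.sum_const, Finset.card_univ,
      Fintype.card_fin, Fin.sum_univ_eq_sum_range (fun i => i) 36]
    have : ∑ i ∈ Finset.range 36, i = 630 := by decide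
    rw [this, smul_eq_mul]
    omega
  obtain ⟨c, hc, hc0⟩ := Submodule.exists_mem_ne_zero_of_ne_bot hker
  refine ⟨c, hc0, fun m hm => ?_⟩
  have := congrFun (LinearMap.mem_ker.1 hc) ⟨m, hm⟩
  exact congrArg Subtype.val this

end LinAlg

section Vanish
variable {F : Type*} [Field F] [Fintype F]

lemma fval_frob {K : Type*} [Field K] [Algebra F K] (x0 : F) {y : K}
    (h : fval F (algebraMap F K x0) y = 0) :
    fval F (algebraMap F K x0) (y ^ Fintype.card F) = 0 := by
  have := map_fval (FiniteField.frobeniusAlgHom F K) (algebraMap F K x0) y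
  rw [h, map_zero, AlgHom.commutes] at this
  exact this.symm

/-- The auxiliary function. -/
noncomputable def Phi {U H : ℕ} (c : Idx U → Idx H → F) : O F :=
  ∑ k, (∑ l, c k l • (mon l : O F)) * (mon k) ^ Fintype.card F

lemma Phi_mem {U H : ℕ} (c : Idx U → Idx H → F) :
    Phi c ∈ W F (xx F) (yy F) ((H + Fintype.card F * U : ℕ) : ℤ) := by
  have hp : ∀ (u : O F) (n : ℤ) (e : ℕ), u ∈ W F (xx F) (yy F) n →
      u ^ e ∈ W F (xx F) (yy F) (e * n) := by
    intro u n e hu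
    induction e with
    | zero => simpa using W_one
    | succ e ih =>
      rw [pow_succ]
      refine W_mono (le_of_eq ?_) (W_mul ih hu)
      push_cast; ring
  refine Submodule.sum_mem _ fun k _ => ?_
  have h1 : ∑ l, c k l • (mon l : O F) ∈ W F (xx F) (yy F) H :=
    Submodule.sum_mem _ fun l _ => Submodule.smul_mem _ _ (mon_mem l)
  have := W_mul h1 (hp _ _ (Fintype.card F) (mon_mem (F := F) k))
  exact_mod_cast this

lemma rho_Phi_dvd {U H M : ℕ} (hM : M ≤ Fintype.card F) (c : Idx U → Idx H → F)
    (hc : ∀ m < M, ∑ k, ∑ l, c k l • (ee m k l : R2 F) = 0)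
    {K : Type*} [Field K] [Algebra F K] (x0 : F) {y : K}
    (h : fval F (algebraMap F K x0) y = 0) (hy : y ^ Fintype.card F ≠ y) :
    (PowerSeries.X : PowerSeries K) ^ M ∣ rho h (Phi c) := by
  set q := Fintype.card F with hq
  obtain ⟨ev2, he1, he2⟩ := exists_ev2 h (fval_frob x0 h) hy
  choose w hw1 hw2 using fun k : Idx U => pow_card_series (F := F) (rho h (mon k))
  have hsm : ∀ (a : F) (u : O F), rho h (a • u) = PowerSeries.C (algebraMap F K a) * rho h u := by
    intro a u
    rw [Algebra.smul_def, map_mul, rho_algebraMap]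
  have hx : algebraMap F K x0 ^ q = algebraMap F K x0 := by
    rw [← map_pow, FiniteField.pow_card]
  have hcc : ∀ k : Idx U, PowerSeries.constantCoeff (rho h (mon k)) ^ q =
      algebraMap F K x0 ^ (k.2 : ℕ) * (y ^ q) ^ (k.1 : ℕ) := by
    intro k
    rw [rho_const, mon, map_mul, map_pow, map_pow, evalHom_xx, evalHom_yy, mul_pow,
      ← pow_mul, mul_comm (k.2 : ℕ), pow_mul, hx, ← pow_mul, mul_comm (k.1 : ℕ), pow_mul]
  have e1 : rho h (Phi c) = PowerSeries.X ^ q * ∑ k, rho h (∑ l, c k l • (mon l : O F)) * w k ^ q +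
      ∑ k, rho h (∑ l, c k l • (mon l : O F)) *
        PowerSeries.C (algebraMap F K x0 ^ (k.2 : ℕ) * (y ^ q) ^ (k.1 : ℕ)) := by
    rw [Phi, map_sum, Finset.mul_sum, ← Finset.sum_add_distrib]
    refine Finset.sum_congr rfl fun k _ => ?_
    rw [map_mul, map_pow, hw2, ← hq, hcc]
    ring
  rw [e1]
  refine dvd_add (Dvd.dvd.mul_right (pow_dvd_pow _ hM) _) ?_
  rw [PowerSeries.X_pow_dvd_iff]
  intro m hm
  have h2 := congrArg ev2 (hc m hm)
  rw [map_zero, map_sum] at h2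
  have h3 : PowerSeries.coeff m (∑ k, rho h (∑ l, c k l • (mon l : O F)) *
        PowerSeries.C (algebraMap F K x0 ^ (k.2 : ℕ) * (y ^ q) ^ (k.1 : ℕ))) =
      ((gval F (algebraMap F K x0) y ^ 2)⁻¹) ^ m *
        ∑ k, ev2 (∑ l, c k l • (ee m k l : R2 F)) := by
    rw [map_sum, Finset.mul_sum]
    refine Finset.sum_congr rfl fun k _ => ?_
    rw [PowerSeries.coeff_mul_C, map_sum, map_sum, map_sum, Finset.sum_mul, Finset.mul_sum]
    refine Finset.sum_congr rfl fun l _ => ?_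
    rw [hsm, PowerSeries.coeff_C_mul, coeff_rho, map_smul, Algebra.smul_def, ee, map_mul, map_mul,
      map_pow, map_pow, he2, he1, he1, evalHom_xx]
    ring
  rw [h3, h2, mul_zero]

end Vanish
end StepanovCurve

namespace StepanovCurve
open Polynomial

lemma mem_range_of_pow_card {F K : Type*} [Field F] [Fintype F] [Field K] [Algebra F K] {y : K}
    (hy : y ^ Fintype.card F = y) : ∃ z : F, algebraMap F K z = y := by
  classical
  have hq : 1 < Fintype.card F := Fintype.one_lt_card
  by_contra! hne
  have h0 : (X ^ Fintype.card F - X : K[X]) ≠ 0 := FiniteField.X_pow_card_sub_X_ne_zero K hq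
  have hd := FiniteField.X_pow_card_sub_X_natDegree_eq K hq
  let S : Finset K := insert y (Finset.univ.image (algebraMap F K))
  have hS : S ⊆ (X ^ Fintype.card F - X : K[X]).roots.toFinset := by
    intro w hw
    rw [Multiset.mem_toFinset, mem_roots h0, IsRoot.def]
    simp only [eval_sub, eval_pow, eval_X]
    rcases Finset.mem_insert.1 hw with rfl | hw
    · rw [hy, sub_self]
    · obtain ⟨z, _, rfl⟩ := Finset.mem_image.1 hw
      rw [← map_pow, FiniteField.pow_card, sub_self]
  have h1 := Finset.card_le_card hS
  have h2 : S.card = Fintype.card F + 1 := by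
    rw [Finset.card_insert_of_notMem, Finset.card_image_of_injective _ (algebraMap F K).injective,
      Finset.card_univ]
    simpa using hne
  have h3 := (Multiset.toFinset_card_le (X ^ Fintype.card F - X : K[X]).roots).trans (card_roots' _)
  omega

section Count
variable {F : Type*} [Field F]

lemma gg_ne_zero : gg F ≠ 0 := by
  intro h
  have h1 := map_gval (evalHom (0 : F) 1 fval_zero_one) (xx F) (yy F)
  rw [evalHom_xx, evalHom_yy, gval_zero_one] at h1
  rw [← gg, h, map_zero] at h1
  exact zero_ne_one h1

lemma gval_ne_zero_of_good {K : Type*} [Field K] [Algebra F K] {x0 : F}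
    (hx : (Algebra.norm F[X] (gg F)).eval x0 ≠ 0) {y : K}
    (h : fval F (algebraMap F K x0) y = 0) : gval F (algebraMap F K x0) y ≠ 0 := by
  intro hg
  obtain ⟨v, hv⟩ := exists_norm_mul (gg F)
  have h1 := congrArg (evalHom _ _ h) hv
  have h2 := map_gval (evalHom _ _ h) (xx F) (yy F)
  rw [evalHom_xx, evalHom_yy, hg, ← gg] at h2
  rw [evalHom_of, map_mul, h2, zero_mul, aeval_algebraMap_apply, coe_aeval_eq_eval] at h1
  · apply hx
    exact (algebraMap F K).injective (by rw [map_zero]; exact h1)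

lemma good_roots {K : Type*} [Field K] [IsAlgClosed K] [Algebra F K] {x0 : F}
    (hx : (Algebra.norm F[X] (gg F)).eval x0 ≠ 0) :
    ∃ y : Fin 4 → K, Function.Injective y ∧ ∀ r, fval F (algebraMap F K x0) (y r) = 0 := by
  classical
  set φ : F[X] →+* K := ((aeval (algebraMap F K x0) : F[X] →ₐ[F] K) : F[X] →+* K) with hφ
  set p : K[X] := (fpoly F).map φ with hp
  have hm : p.Monic := (fpoly_monic F).map _
  have hd : p.natDegree = 4 := by rw [hp, (fpoly_monic F).natDegree_map, fpoly_natDegree]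
  have hev : ∀ y, p.eval y = fval F (algebraMap F K x0) y := fun y => by
    rw [hp, eval_map, fpoly_eval₂]
  have hder : ∀ y, p.derivative.eval y = gval F (algebraMap F K x0) y := fun y => by
    rw [hp, fpoly, gval]
    simp [hφ]
    ring
  have hn : p.roots.Nodup := by
    rw [Multiset.nodup_iff_count_le_one]
    intro a
    rw [count_roots]
    by_contra! hlt
    rw [one_lt_rootMultiplicity_iff_isRoot hm.ne_zero] at hlt
    obtain ⟨h1, h2⟩ := hlt
    rw [IsRoot.def, hev] at h1
    rw [IsRoot.def, hder] at h2
    exact gval_ne_zero_of_good hx h1 h2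
  have hc : p.roots.toFinset.card = 4 := by
    rw [Multiset.toFinset_card_of_nodup hn, ← hd]
    exact (IsAlgClosed.splits p).natDegree_eq_card_roots.symm
  let e := Finset.equivFinOfCardEq hc
  refine ⟨fun r => (e.symm r : K), Subtype.val_injective.comp e.symm.injective, fun r => ?_⟩
  have := (e.symm r).2
  rw [Multiset.mem_toFinset, mem_roots hm.ne_zero, IsRoot.def, hev] at this
  exact this

theorem many_points [Fintype F] [IsDomain (O F)] (hq : 7925 ≤ Fintype.card F) :
    5 ≤ Set.ncard {p : F × F | fval F p.1 p.2 = 0 ∧ p.1 ≠ 0} := by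
  classical
  set q := Fintype.card F with hqd
  set K := AlgebraicClosure F
  set Ng := Algebra.norm F[X] (gg F) with hNg
  have hNg0 : Ng ≠ 0 := norm_ne_zero gg_ne_zero
  have hNgd : Ng.natDegree ≤ 36 := norm_deg (n := 9) gval_mem
  set G : Finset F := Finset.univ.filter fun x => Ng.eval x ≠ 0 with hG
  have hGc : q ≤ G.card + 36 := by
    have h1 : G.card + (Finset.univ.filter fun x => ¬ Ng.eval x ≠ 0).card =
        (Finset.univ : Finset F).card := by
      rw [hG]
      exact Finset.card_filter_add_card_filter_not (s := (Finset.univ : Finset F))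
        (fun x => Ng.eval x ≠ 0)
    have h2 : (Finset.univ.filter fun x => ¬ Ng.eval x ≠ 0).card ≤ 36 := by
      refine (Finset.card_le_card (t := Ng.roots.toFinset) ?_).trans
        ((Multiset.toFinset_card_le _).trans ((card_roots' _).trans hNgd))
      intro x hx
      rw [Multiset.mem_toFinset, mem_roots hNg0]
      simpa using hx
    rw [Finset.card_univ] at h1
    omega
  obtain ⟨c, hc0, hc⟩ := exists_coeffs (F := F) ((q - 1) / 4) (by omega)
  have hPhi : Phi c ≠ 0 := fun h => hc0 (nonvanish (by omega) c h)
  set N := Algebra.norm F[X] (Phi c) with hN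
  have hN0 : N ≠ 0 := norm_ne_zero hPhi
  have hNd : N.natDegree ≤ 4 * ((q - 1) / 4 + q * 35) := norm_deg (Phi_mem c)
  have hgood : ∀ x : G, Ng.eval (x : F) ≠ 0 := fun x => (Finset.mem_filter.1 x.2).2
  choose y hyi hyf using fun x : G => good_roots (K := K) (hgood x)
  have hyg : ∀ (x : G) (r : Fin 4), gval F (algebraMap F K (x : F)) (y x r) ≠ 0 := fun x r =>
    gval_ne_zero_of_good (hgood x) (hyf x r)
  let s : G → Finset (Fin 4) := fun x => Finset.univ.filter fun r => y x r ^ q ≠ y x r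
  have hs : ∀ x : G, 36 * (s x).card ≤ N.rootMultiplicity (x : F) := by
    intro x
    apply le_rootMultiplicity_of_dvd (K := K) _ _ hN0
    rw [norm_rho _ (y x) (hyi x) (hyf x) (hyg x), pow_mul, ← Finset.prod_const]
    refine (Finset.prod_dvd_prod_of_dvd _ _ fun r hr => ?_).trans
      (Finset.prod_dvd_prod_of_subset (s x) Finset.univ _ (Finset.subset_univ _))
    exact rho_Phi_dvd (by omega) c hc _ (hyf x r) (Finset.mem_filter.1 hr).2
  have hsum : 36 * ∑ x, (s x).card ≤ N.natDegree := by
    rw [Finset.mul_sum]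
    refine (Finset.sum_le_sum fun x _ => hs x).trans ?_
    rw [Finset.sum_coe_sort G (fun x => N.rootMultiplicity x)]
    refine le_trans ?_ (card_roots' N)
    rw [← Multiset.sum_count_eq_card (s := (Finset.univ : Finset F)) (m := N.roots) (by simp)]
    simp only [count_roots]
    exact Finset.sum_le_sum_of_subset (Finset.subset_univ _)
  let T : Finset (G × Fin 4) := Finset.univ.filter fun p => y p.1 p.2 ^ q = y p.1 p.2
  have hT : T.card + ∑ x, (s x).card = 4 * G.card := by
    have h1 : T.card + (Finset.univ.filter fun p : G × Fin 4 => ¬ y p.1 p.2 ^ q = y p.1 p.2).card =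
        (Finset.univ : Finset (G × Fin 4)).card :=
      Finset.card_filter_add_card_filter_not (s := (Finset.univ : Finset (G × Fin 4)))
        (fun p => y p.1 p.2 ^ q = y p.1 p.2)
    have h2 : (Finset.univ.filter fun p : G × Fin 4 => ¬ y p.1 p.2 ^ q = y p.1 p.2).card =
        ∑ x, (s x).card := by
      simp only [s, Finset.card_filter, ← Finset.univ_product_univ, Finset.sum_product, ne_eq]
    rw [h2, Finset.card_univ, Fintype.card_prod, Fintype.card_coe, Fintype.card_fin] at h1
    omega
  have hz : ∀ p : T, ∃ z : F, algebraMap F K z = y p.1.1 p.1.2 := fun p =>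
    mem_range_of_pow_card (Finset.mem_filter.1 p.2).2
  choose z hz using hz
  have hx0 : ∀ x : G, (x : F) ≠ 0 := by
    intro x hx
    have h1 : fval F (algebraMap F F (x : F)) 0 = 0 := by simp [fval, hx, k0]
    refine gval_ne_zero_of_good (K := F) (hgood x) h1 ?_
    simp [gval, hx, k1]
  let ψ : T → F × F := fun p => ((p.1.1 : F), z p)
  have hψ : Function.Injective ψ := by
    intro p p' h
    obtain ⟨h1, h2⟩ := Prod.mk.inj h
    obtain ⟨⟨x, r⟩, hp⟩ := p
    obtain ⟨⟨x', r'⟩, hp'⟩ := p'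
    obtain rfl : x = x' := Subtype.ext h1
    have h3 := congrArg (algebraMap F K) h2
    rw [hz, hz] at h3
    obtain rfl := hyi x h3
    rfl
  have hcard : Set.ncard (Set.range ψ) = T.card := by
    rw [← Set.image_univ, Set.ncard_image_of_injective _ hψ, Set.ncard_univ, Nat.card_eq_fintype_card,
      Fintype.card_coe]
  have hsub : Set.range ψ ⊆ {p : F × F | fval F p.1 p.2 = 0 ∧ p.1 ≠ 0} := by
    rintro _ ⟨p, rfl⟩
    refine ⟨?_, hx0 _⟩
    have h1 := hyf p.1.1 p.1.2
    rw [← hz] at h1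
    have h2 := map_fval (Algebra.ofId F K) (p.1.1 : F) (z p)
    apply (algebraMap F K).injective
    rw [map_zero, ← h1]
    exact h2
  have := Set.ncard_le_ncard hsub (Set.toFinite _)
  omega

end Count
end StepanovCurve

namespace StepanovCurve
open Polynomial

lemma lin_scalar (F : Type*) [Field F] (r0 r1 r2 r3 x0 x1 x2 x3 x4 x5 x6 x7 y0 y1 y2 y3 y4 y5 y6 y7 z0 z1 z2 z3 z4 z5 z6 z7 : F)
    (p0 : 1 + (-1)*r0 + x0 = 0)
    (p1 : (-2) + (-1)*r1 + x1 = 0)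
    (p2 : (-1)*r2 + x2 = 0)
    (p3 : (-1)*r3 + x3 = 0)
    (p4 : x4 = 0)
    (p5 : x5 = 0)
    (p6 : x6 = 0)
    (p7 : x7 = 0)
    (q0 : y0 + (-1)*r0*x0 = 0)
    (q1 : 1 + y1 + (-1)*r0*x1 + (-1)*r1*x0 = 0)
    (q2 : (-3) + y2 + (-1)*r0*x2 + (-1)*r1*x1 + (-1)*r2*x0 = 0)
    (q3 : 2 + y3 + (-1)*r0*x3 + (-1)*r1*x2 + (-1)*r2*x1 + (-1)*r3*x0 = 0)
    (q4 : y4 + (-1)*r0*x4 + (-1)*r1*x3 + (-1)*r2*x2 + (-1)*r3*x1 = 0)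
    (q5 : (-2) + y5 + (-1)*r0*x5 + (-1)*r1*x4 + (-1)*r2*x3 + (-1)*r3*x2 = 0)
    (q6 : (-1) + y6 + (-1)*r0*x6 + (-1)*r1*x5 + (-1)*r2*x4 + (-1)*r3*x3 = 0)
    (q7 : y7 + (-1)*r0*x7 + (-1)*r1*x6 + (-1)*r2*x5 + (-1)*r3*x4 = 0)
    (u0 : z0 + (-1)*r0*y0 = 0)
    (u1 : z1 + (-1)*r0*y1 + (-1)*r1*y0 = 0)
    (u2 : z2 + (-1)*r0*y2 + (-1)*r1*y1 + (-1)*r2*y0 = 0)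
    (u3 : (-1) + z3 + (-1)*r0*y3 + (-1)*r1*y2 + (-1)*r2*y1 + (-1)*r3*y0 = 0)
    (u4 : 4 + z4 + (-1)*r0*y4 + (-1)*r1*y3 + (-1)*r2*y2 + (-1)*r3*y1 = 0)
    (u5 : (-3) + z5 + (-1)*r0*y5 + (-1)*r1*y4 + (-1)*r2*y3 + (-1)*r3*y2 = 0)
    (u6 : (-2) + z6 + (-1)*r0*y6 + (-1)*r1*y5 + (-1)*r2*y4 + (-1)*r3*y3 = 0)
    (u7 : z7 + (-1)*r0*y7 + (-1)*r1*y6 + (-1)*r2*y5 + (-1)*r3*y4 = 0)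
    (s0 : r0*z0 = 0)
    (s1 : r0*z1 + r1*z0 = 0)
    (s2 : r0*z2 + r1*z1 + r2*z0 = 0)
    (s3 : r0*z3 + r1*z2 + r2*z1 + r3*z0 = 0)
    (s4 : r0*z4 + r1*z3 + r2*z2 + r3*z1 = 0)
    (s5 : r0*z5 + r1*z4 + r2*z3 + r3*z2 = 0)
    (s6 : 1 + r0*z6 + r1*z5 + r2*z4 + r3*z3 = 0)
    (s7 : (-4) + r0*z7 + r1*z6 + r2*z5 + r3*z4 = 0)
    : False := by
  obtain rfl : x4 = 0 := by linear_combination (1) * p4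
  obtain rfl : x5 = 0 := by linear_combination (1) * p5
  obtain rfl : x6 = 0 := by linear_combination (1) * p6
  obtain rfl : x7 = 0 := by linear_combination (1) * p7
  obtain rfl : y7 = 0 := by linear_combination (1) * q7
  obtain rfl : x2 = r2 := by linear_combination (1) * p2
  obtain rfl : x3 = r3 := by linear_combination (1) * p3
  obtain rfl : y0 = r0*x0 := by linear_combination (1) * q0
  obtain rfl : z0 = r0^2*x0 := by linear_combination (1) * u0
  obtain rfl : x0 = (-1) + r0 := by linear_combination (1) * p0
  obtain rfl : x1 = 2 + r1 := by linear_combination (1) * p1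
  obtain rfl : y5 = 2 + 2*x2*x3 := by linear_combination (1) * q5
  obtain rfl : y6 = 1 + x3^2 := by linear_combination (1) * q6
  obtain rfl : y4 = 2*x3 + 2*r1*x3 + x2^2 := by linear_combination (1) * q4
  obtain rfl : z1 = (-1)*r0*r1 + r0*y1 + r0^2*r1 := by linear_combination (1) * u1
  have hh : (r0 - (0))^3 * (r0 - (1))^1 = 0 := by linear_combination (1) * s0
  rcases mul_eq_zero.1 hh with hh | hh
  swap
  · obtain rfl : r0 = 1 := sub_eq_zero.1 (eq_zero_of_pow_eq_zero hh)
    obtain rfl : y1 = 0 := by linear_combination (1) * s1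
    obtain rfl : z2 = 0 := by linear_combination (1) * s2
    obtain rfl : y2 = 0 := by linear_combination (-1) * u2
    obtain rfl : z3 = 0 := by linear_combination (1) * s3
    obtain rfl : z4 = 0 := by linear_combination (1) * s4
    obtain rfl : z5 = 0 := by linear_combination (1) * s5
    obtain rfl : r1 = (-1) := by linear_combination (-1) * q1
    obtain rfl : x2 = (-2) := by linear_combination (-1) * q2
    obtain rfl : y3 = 0 := by linear_combination (1) * u4
    exact one_ne_zero (α := F) (by linear_combination (-1) * u3)
  obtain rfl : r0 = 0 := sub_eq_zero.1 (eq_zero_of_pow_eq_zero hh)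
  obtain rfl : z2 = r1*y1 := by linear_combination (1) * u2
  obtain rfl : y1 = (-1) + (-1)*r1 := by linear_combination (1) * q1
  have hh : (r1 - (-1))^1 * (r1 - (0))^2 = 0 := by linear_combination (-1) * s3
  rcases mul_eq_zero.1 hh with hh | hh
  swap
  · obtain rfl : r1 = 0 := sub_eq_zero.1 (eq_zero_of_pow_eq_zero hh)
    obtain rfl : y2 = 3 + (-1)*x2 := by linear_combination (1) * q2
    obtain rfl : z3 = 1 + (-1)*x2 := by linear_combination (1) * u3
    obtain rfl : y3 = (-2) + 2*x2 + (-1)*x3 := by linear_combination (1) * q3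
    obtain rfl : z7 = 2*x2 + 2*x3^2 + 3*x2^2*x3 := by linear_combination (1) * u7
    have hh : (x2 - (0))^1 * (x2 - (1))^1 = 0 := by linear_combination (-1) * s5
    rcases mul_eq_zero.1 hh with hh | hh
    swap
    · obtain rfl : x2 = 1 := sub_eq_zero.1 (eq_zero_of_pow_eq_zero hh)
      obtain rfl : z4 = (-1) := by linear_combination (1) * s6
      obtain rfl : x3 = (-1) := by linear_combination (1) * u4
      obtain rfl : z6 = 0 := by linear_combination (1) * u6
      obtain rfl : z5 = 2 := by linear_combination (1) * u5
      exact one_ne_zero (α := F) (by linear_combination (-1) * s7)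
    obtain rfl : x2 = 0 := sub_eq_zero.1 (eq_zero_of_pow_eq_zero hh)
    obtain rfl : x3 = (-1) := by linear_combination (1) * s6
    obtain rfl : z5 = 0 := by linear_combination (1) * u5
    obtain rfl : z4 = (-3) := by linear_combination (1) * u4
    exact one_ne_zero (α := F) (by linear_combination (-1) * s7)
  obtain rfl : r1 = -1 := sub_eq_zero.1 (eq_zero_of_pow_eq_zero hh)
  obtain rfl : z3 = 0 := by linear_combination (-1) * s4
  obtain rfl : z4 = 0 := by linear_combination (-1) * s5
  obtain rfl : y2 = 1 := by linear_combination (1) * u3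
  obtain rfl : x2 = 1 := by linear_combination (1) * q2
  obtain rfl : y3 = (-3) := by linear_combination (1) * u4
  obtain rfl : x3 = 1 := by linear_combination (1) * q3
  obtain rfl : z5 = 0 := by linear_combination (1) * u5
  exact one_ne_zero (α := F) (by linear_combination (1) * s6)

lemma quad_scalar (F : Type*) [Field F] (a1 a2 a3 b1 b2 b3 b4 b5 b6 c1 c2 c3 d1 d2 d3 d4 d5 d6 : F)
    (p1 : (-2) + a1 + c1 = 0)
    (p2 : a2 + c2 = 0)
    (p3 : a3 + c3 = 0)
    (q1 : 1 + b1 + (-1)*c1 + d1 = 0)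
    (q2 : (-3) + b2 + (-1)*c2 + d2 + a1*c1 = 0)
    (q3 : 2 + b3 + (-1)*c3 + d3 + a1*c2 + a2*c1 = 0)
    (q4 : b4 + d4 + a1*c3 + a2*c2 + a3*c1 = 0)
    (q5 : (-2) + b5 + d5 + a2*c3 + a3*c2 = 0)
    (q6 : (-1) + b6 + d6 + a3*c3 = 0)
    (u1 : (-1)*d1 = 0)
    (u2 : (-1)*d2 + a1*d1 + b1*c1 = 0)
    (u3 : (-1) + (-1)*d3 + a1*d2 + a2*d1 + b1*c2 + b2*c1 = 0)
    (u4 : 4 + (-1)*d4 + a1*d3 + a2*d2 + a3*d1 + b1*c3 + b2*c2 + b3*c1 = 0)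
    (u5 : (-3) + (-1)*d5 + a1*d4 + a2*d3 + a3*d2 + b2*c3 + b3*c2 + b4*c1 = 0)
    (u6 : (-2) + (-1)*d6 + a1*d5 + a2*d4 + a3*d3 + b3*c3 + b4*c2 + b5*c1 = 0)
    (u7 : a1*d6 + a2*d5 + a3*d4 + b4*c3 + b5*c2 + b6*c1 = 0)
    (s3 : b1*d2 + b2*d1 = 0)
    (s4 : b1*d3 + b2*d2 + b3*d1 = 0)
    (s5 : b1*d4 + b2*d3 + b3*d2 + b4*d1 = 0)
    (s6 : (-1) + b1*d5 + b2*d4 + b3*d3 + b4*d2 + b5*d1 = 0)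
    (s7 : 4 + b1*d6 + b2*d5 + b3*d4 + b4*d3 + b5*d2 + b6*d1 = 0)
    (s9 : (-4) + b3*d6 + b4*d5 + b5*d4 + b6*d3 = 0)
    : False := by
  obtain rfl : d1 = 0 := by linear_combination (-1) * u1
  obtain rfl : a2 = (-1)*c2 := by linear_combination (1) * p2
  obtain rfl : a3 = (-1)*c3 := by linear_combination (1) * p3
  obtain rfl : d2 = b1*c1 := by linear_combination (-1) * u2
  obtain rfl : a1 = 2 + (-1)*c1 := by linear_combination (1) * p1
  obtain rfl : b1 = (-1) + c1 := by linear_combination (1) * q1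
  obtain rfl : b2 = 3 + (-1)*c1 + c2 := by linear_combination (1) * q2
  obtain rfl : b5 = 2 + (-1)*d5 + 2*c2*c3 := by linear_combination (1) * q5
  obtain rfl : b6 = 1 + (-1)*d6 + c3^2 := by linear_combination (1) * q6
  have hh : (c1 - (0))^1 * (c1 - (1))^2 = 0 := by linear_combination (1) * s3
  rcases mul_eq_zero.1 hh with hh | hh
  swap
  · obtain rfl : c1 = 1 := sub_eq_zero.1 (eq_zero_of_pow_eq_zero hh)
    obtain rfl : b4 = (-1)*d4 + c2^2 := by linear_combination (1) * q4
    obtain rfl : d3 = 1 + c2 := by linear_combination (-1) * u3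
    obtain rfl : b3 = (-3) + (-1)*c2 + c3 := by linear_combination (1) * q3
    have hh : (c2 - (-2))^1 * (c2 - (-1))^1 = 0 := by linear_combination (1) * s5
    rcases mul_eq_zero.1 hh with hh | hh
    swap
    · obtain rfl : c2 = -1 := sub_eq_zero.1 (eq_zero_of_pow_eq_zero hh)
      obtain rfl : d5 = 0 := by linear_combination (-1) * u5
      obtain rfl : d4 = 1 := by linear_combination (1) * s6
      obtain rfl : c3 = 0 := by linear_combination (1) * u4
      exact one_ne_zero (α := F) (by linear_combination (-1) * u7)
    obtain rfl : c2 = -2 := sub_eq_zero.1 (eq_zero_of_pow_eq_zero hh)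
    obtain rfl : c3 = 0 := by linear_combination (-1) * s6
    obtain rfl : d4 = 2 := by linear_combination (-1) * u4
    exact one_ne_zero (α := F) (by linear_combination (-1) * s9)
  obtain rfl : c1 = 0 := sub_eq_zero.1 (eq_zero_of_pow_eq_zero hh)
  obtain rfl : d3 = 0 := by linear_combination (-1) * s4
  obtain rfl : d4 = 0 := by linear_combination (-1) * s5
  obtain rfl : c2 = (-1) := by linear_combination (-1) * u3
  obtain rfl : b3 = c3 := by linear_combination (1) * q3
  obtain rfl : b3 = 2 := by linear_combination (-1) * u4
  obtain rfl : b4 = (-3) := by linear_combination (1) * q4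
  obtain rfl : d5 = (-1) := by linear_combination (-1) * u5
  obtain rfl : d6 = 3 := by linear_combination (-1) * u6
  exact one_ne_zero (α := F) (by linear_combination (-1) * s7)

section Irred
variable {F : Type*} [Field F]

lemma cm (n : ℕ) (a b : F[X]) :
    (a * b).coeff n = ∑ i ∈ Finset.range (n + 1), a.coeff i * b.coeff (n - i) := by
  rw [coeff_mul, Finset.Nat.sum_antidiagonal_eq_sum_range_succ_mk]

lemma no_root (r c0 c1 c2 : F[X]) (hr : r.natDegree ≤ 3) (h3 : c2 - r = k3 F)
    (h2 : c1 - r * c2 = k2 F) (h1 : c0 - r * c1 = k1 F) (h0 : r * c0 = - k0 F) : False := by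
  have hz : ∀ n, r.coeff (n + 4) = 0 := fun n => coeff_eq_zero_of_natDegree_lt (by omega)
  have z4 := hz 0
  have z5 := hz 1
  have z6 := hz 2
  have z7 := hz 3
  norm_num at z4 z5 z6 z7
  have e3 := fun n => congrArg (fun p => coeff p n) h3
  have e2 := fun n => congrArg (fun p => coeff p n) h2
  have e1 := fun n => congrArg (fun p => coeff p n) h1
  have e0 := fun n => congrArg (fun p => coeff p n) h0
  simp only [coeff_sub, coeff_neg, cm, k3, k2, k1, k0, coeff_add, coeff_X_pow, coeff_X,
    coeff_one] at e3 e2 e1 e0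
  have p0 := e3 0
  have p1 := e3 1
  have p2 := e3 2
  have p3 := e3 3
  have p4 := e3 4
  have p5 := e3 5
  have p6 := e3 6
  have p7 := e3 7
  have q0 := e2 0
  have q1 := e2 1
  have q2 := e2 2
  have q3 := e2 3
  have q4 := e2 4
  have q5 := e2 5
  have q6 := e2 6
  have q7 := e2 7
  have u0 := e1 0
  have u1 := e1 1
  have u2 := e1 2
  have u3 := e1 3
  have u4 := e1 4
  have u5 := e1 5
  have u6 := e1 6
  have u7 := e1 7
  have s0 := e0 0
  have s1 := e0 1
  have s2 := e0 2
  have s3 := e0 3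
  have s4 := e0 4
  have s5 := e0 5
  have s6 := e0 6
  have s7 := e0 7
  simp [-mul_eq_zero, -neg_eq_zero, Finset.sum_range_succ, z4, z5, z6, z7] at p0 p1 p2 p3 p4 p5 p6 p7 q0 q1 q2 q3 q4 q5 q6 q7 u0 u1 u2 u3 u4 u5 u6 u7 s0 s1 s2 s3 s4 s5 s6 s7
  exact lin_scalar F (r.coeff 0) (r.coeff 1) (r.coeff 2) (r.coeff 3) (c2.coeff 0) (c2.coeff 1) (c2.coeff 2) (c2.coeff 3) (c2.coeff 4) (c2.coeff 5) (c2.coeff 6) (c2.coeff 7) (c1.coeff 0) (c1.coeff 1) (c1.coeff 2) (c1.coeff 3) (c1.coeff 4) (c1.coeff 5) (c1.coeff 6) (c1.coeff 7) (c0.coeff 0) (c0.coeff 1) (c0.coeff 2) (c0.coeff 3) (c0.coeff 4) (c0.coeff 5) (c0.coeff 6) (c0.coeff 7)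
    (by linear_combination p0)
    (by linear_combination p1)
    (by linear_combination p2)
    (by linear_combination p3)
    (by linear_combination p4)
    (by linear_combination p5)
    (by linear_combination p6)
    (by linear_combination p7)
    (by linear_combination q0)
    (by linear_combination q1)
    (by linear_combination q2)
    (by linear_combination q3)
    (by linear_combination q4)
    (by linear_combination q5)
    (by linear_combination q6)
    (by linear_combination q7)
    (by linear_combination u0)
    (by linear_combination u1)
    (by linear_combination u2)
    (by linear_combination u3)
    (by linear_combination u4)
    (by linear_combination u5)
    (by linear_combination u6)
    (by linear_combination u7)
    (by linear_combination s0)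
    (by linear_combination s1)
    (by linear_combination s2)
    (by linear_combination s3)
    (by linear_combination s4)
    (by linear_combination s5)
    (by linear_combination s6)
    (by linear_combination s7)

lemma no_quad (a b a' b' : F[X]) (ha : a.natDegree ≤ 3) (ha' : a'.natDegree ≤ 3)
    (hb : b.natDegree ≤ 6) (hb' : b'.natDegree ≤ 6)
    (h3 : a + a' = k3 F) (h2 : b + b' + a * a' = k2 F) (h1 : a * b' + b * a' = k1 F)
    (h0 : b * b' = k0 F) (a0 : a.coeff 0 = -1) (b0 : b.coeff 0 = 0) (c0 : a'.coeff 0 = 0)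
    (d0 : b'.coeff 0 = 0) : False := by
  have za : ∀ n, 4 ≤ n → a.coeff n = 0 := fun n hn => coeff_eq_zero_of_natDegree_lt (by omega)
  have za' : ∀ n, 4 ≤ n → a'.coeff n = 0 := fun n hn => coeff_eq_zero_of_natDegree_lt (by omega)
  have zb : ∀ n, 7 ≤ n → b.coeff n = 0 := fun n hn => coeff_eq_zero_of_natDegree_lt (by omega)
  have zb' : ∀ n, 7 ≤ n → b'.coeff n = 0 := fun n hn => coeff_eq_zero_of_natDegree_lt (by omega)
  have e3 := fun n => congrArg (fun p => coeff p n) h3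
  have e2 := fun n => congrArg (fun p => coeff p n) h2
  have e1 := fun n => congrArg (fun p => coeff p n) h1
  have e0 := fun n => congrArg (fun p => coeff p n) h0
  simp only [coeff_sub, coeff_neg, cm, k3, k2, k1, k0, coeff_add, coeff_X_pow, coeff_X,
    coeff_one] at e3 e2 e1 e0
  have p1 := e3 1
  have p2 := e3 2
  have p3 := e3 3
  have q1 := e2 1
  have q2 := e2 2
  have q3 := e2 3
  have q4 := e2 4
  have q5 := e2 5
  have q6 := e2 6
  have u1 := e1 1
  have u2 := e1 2
  have u3 := e1 3
  have u4 := e1 4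
  have u5 := e1 5
  have u6 := e1 6
  have u7 := e1 7
  have s3 := e0 3
  have s4 := e0 4
  have s5 := e0 5
  have s6 := e0 6
  have s7 := e0 7
  have s9 := e0 9
  simp [-mul_eq_zero, -neg_eq_zero, Finset.sum_range_succ, a0, b0, c0, d0, za, za', zb, zb'] at p1 p2 p3 q1 q2 q3 q4 q5 q6 u1 u2 u3 u4 u5 u6 u7 s3 s4 s5 s6 s7 s9
  exact quad_scalar F (a.coeff 1) (a.coeff 2) (a.coeff 3) (b.coeff 1) (b.coeff 2) (b.coeff 3) (b.coeff 4) (b.coeff 5) (b.coeff 6) (a'.coeff 1) (a'.coeff 2) (a'.coeff 3) (b'.coeff 1) (b'.coeff 2) (b'.coeff 3) (b'.coeff 4) (b'.coeff 5) (b'.coeff 6)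
    (by linear_combination p1)
    (by linear_combination p2)
    (by linear_combination p3)
    (by linear_combination q1)
    (by linear_combination q2)
    (by linear_combination q3)
    (by linear_combination q4)
    (by linear_combination q5)
    (by linear_combination q6)
    (by linear_combination u1)
    (by linear_combination u2)
    (by linear_combination u3)
    (by linear_combination u4)
    (by linear_combination u5)
    (by linear_combination u6)
    (by linear_combination u7)
    (by linear_combination s3)
    (by linear_combination s4)
    (by linear_combination s5)
    (by linear_combination s6)
    (by linear_combination s7)
    (by linear_combination s9)

end Irred
end StepanovCurve

namespace StepanovCurve
open Polynomial
section Irred2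
variable {F : Type*} [Field F]

lemma k3_deg1 : (k3 F).natDegree ≤ 1 := by unfold k3; compute_degree!
lemma k1_deg6 : (k1 F).natDegree ≤ 6 := by unfold k1; compute_degree!
lemma k0_deg10 : (k0 F).natDegree = 10 := by unfold k0; compute_degree!

lemma root_deg (r : F[X]) (h : r ^ 4 + k3 F * r ^ 3 + k2 F * r ^ 2 + k1 F * r + k0 F = 0) :
    r.natDegree ≤ 3 := by
  by_contra! hr
  have e : r ^ 4 = - (k3 F * r ^ 3 + k2 F * r ^ 2 + k1 F * r + k0 F) := by linear_combination h
  have d := congrArg natDegree e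
  rw [natDegree_pow, natDegree_neg] at d
  have d3 : (k3 F * r ^ 3).natDegree ≤ 1 + 3 * r.natDegree :=
    natDegree_mul_le_of_le k3_deg1 natDegree_pow_le
  have d2 : (k2 F * r ^ 2).natDegree ≤ 6 + 2 * r.natDegree :=
    natDegree_mul_le_of_le (k2_deg F) natDegree_pow_le
  have d1 : (k1 F * r).natDegree ≤ 6 + r.natDegree := natDegree_mul_le_of_le k1_deg6 le_rfl
  have d0 := k0_deg10 (F := F)
  have a1 := natDegree_add_le (k3 F * r ^ 3 + k2 F * r ^ 2 + k1 F * r) (k0 F)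
  have a2 := natDegree_add_le (k3 F * r ^ 3 + k2 F * r ^ 2) (k1 F * r)
  have a3 := natDegree_add_le (k3 F * r ^ 3) (k2 F * r ^ 2)
  omega

lemma quad_deg_aux (a b a' b' : F[X]) (h3 : a + a' = k3 F) (h2 : b + b' + a * a' = k2 F)
    (h1 : a * b' + b * a' = k1 F) (h0 : b * b' = k0 F) (hn : 4 ≤ a.natDegree)
    (hb : b'.natDegree ≤ b.natDegree) : False := by
  have hk0 : k0 F ≠ 0 := by
    intro h
    have := k0_deg10 (F := F)
    rw [h] at this
    simp at this
  have hb0 : b ≠ 0 := by rintro rfl; simp at h0; exact hk0 h0.symm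
  have hb0' : b' ≠ 0 := by rintro rfl; simp at h0; exact hk0 h0.symm
  have ha0 : a ≠ 0 := by rintro rfl; simp at hn
  have d3 := k3_deg1 (F := F)
  have d2 := k2_deg F
  have d1 := k1_deg6 (F := F)
  have ea : a'.natDegree = a.natDegree := by
    rw [show a' = k3 F - a by linear_combination h3]
    exact natDegree_sub_eq_right_of_natDegree_lt (by omega)
  have ha0' : a' ≠ 0 := by rintro rfl; simp at ea; omega
  have e0 : b.natDegree + b'.natDegree = 10 := by
    rw [← natDegree_mul hb0 hb0', h0, k0_deg10]
  have e2 : (b + b').natDegree = 2 * a.natDegree := by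
    rw [show b + b' = k2 F - a * a' by linear_combination h2,
      natDegree_sub_eq_right_of_natDegree_lt, natDegree_mul ha0 ha0', ea, two_mul]
    rw [natDegree_mul ha0 ha0']
    omega
  have e3 := natDegree_add_le b b'
  have e4 : (a * b' + b * a').natDegree = b.natDegree + a.natDegree := by
    rw [natDegree_add_eq_right_of_natDegree_lt, natDegree_mul hb0 ha0', ea]
    rw [natDegree_mul hb0 ha0', natDegree_mul ha0 hb0']
    omega
  rw [h1] at e4
  omega

lemma quad_deg (a b a' b' : F[X]) (h3 : a + a' = k3 F) (h2 : b + b' + a * a' = k2 F)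
    (h1 : a * b' + b * a' = k1 F) (h0 : b * b' = k0 F) :
    a.natDegree ≤ 3 ∧ a'.natDegree ≤ 3 ∧ b.natDegree ≤ 6 ∧ b'.natDegree ≤ 6 := by
  have hk0 : k0 F ≠ 0 := by
    intro h
    have := k0_deg10 (F := F)
    rw [h] at this
    simp at this
  have hb0 : b ≠ 0 := by rintro rfl; simp at h0; exact hk0 h0.symm
  have hb0' : b' ≠ 0 := by rintro rfl; simp at h0; exact hk0 h0.symm
  have e0 : b.natDegree + b'.natDegree = 10 := by
    rw [← natDegree_mul hb0 hb0', h0, k0_deg10]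
  have d3 := k3_deg1 (F := F)
  have d2 := k2_deg F
  have ea' := natDegree_sub_le (k3 F) a'
  rw [show k3 F - a' = a by linear_combination -h3] at ea'
  have ha' : a'.natDegree ≤ 3 := by
    by_contra! hlt
    rcases le_total b.natDegree b'.natDegree with hb | hb
    · exact quad_deg_aux a' b' a b (by linear_combination h3) (by linear_combination h2)
        (by linear_combination h1) (by linear_combination h0) (by omega) hb
    · have e : a.natDegree = a'.natDegree := by
        rw [show a = k3 F - a' by linear_combination h3]
        exact natDegree_sub_eq_right_of_natDegree_lt (by omega)
      exact quad_deg_aux a b a' b' h3 h2 h1 h0 (by omega) hb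
  have ha : a.natDegree ≤ 3 := by omega
  have haa : (a * a').natDegree ≤ 3 + 3 := natDegree_mul_le_of_le ha ha'
  have es : (b + b').natDegree ≤ 6 := by
    rw [show b + b' = k2 F - a * a' by linear_combination h2]
    exact (natDegree_sub_le _ _).trans (by omega)
  refine ⟨ha, ha', ?_, ?_⟩
  · by_contra! hlt
    have := natDegree_add_eq_left_of_natDegree_lt (p := b) (q := b') (by omega)
    omega
  · by_contra! hlt
    have := natDegree_add_eq_right_of_natDegree_lt (p := b) (q := b') (by omega)
    omega

lemma no_quad' (a b a' b' : F[X]) (h3 : a + a' = k3 F) (h2 : b + b' + a * a' = k2 F)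
    (h1 : a * b' + b * a' = k1 F) (h0 : b * b' = k0 F) : False := by
  obtain ⟨ha, ha', hb, hb'⟩ := quad_deg a b a' b' h3 h2 h1 h0
  have e3 := congrArg (fun p => coeff p 0) h3
  have e2 := congrArg (fun p => coeff p 0) h2
  have e1 := congrArg (fun p => coeff p 0) h1
  have e0 := congrArg (fun p => coeff p 0) h0
  simp [-mul_eq_zero, -neg_eq_zero, k3, k2, k1, k0] at e3 e2 e1 e0
  have key : b.coeff 0 = 0 ∧ b'.coeff 0 = 0 := by
    rcases mul_eq_zero.1 e0 with h | h
    · refine ⟨h, ?_⟩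
      rw [h, zero_mul, add_zero] at e1
      rcases mul_eq_zero.1 e1 with h' | h'
      · rw [h, h'] at e2
        linear_combination e2
      · exact h'
    · refine ⟨?_, h⟩
      rw [h, mul_zero, zero_add] at e1
      rcases mul_eq_zero.1 e1 with h' | h'
      · exact h'
      · rw [h, h'] at e2
        linear_combination e2
  rw [key.1, key.2, zero_add, zero_add] at e2
  rcases mul_eq_zero.1 e2 with h | h
  · exact no_quad a' b' a b ha' ha hb' hb (by linear_combination h3) (by linear_combination h2)
      (by linear_combination h1) (by linear_combination h0) (by linear_combination e3 - h)
      key.2 h key.1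
  · exact no_quad a b a' b' ha ha' hb hb' h3 h2 h1 h0 (by linear_combination e3 - h) key.1 h key.2

theorem fpoly_irreducible : Irreducible (fpoly F) := by
  rw [(fpoly_monic F).irreducible_iff_natDegree']
  refine ⟨fun h => ?_, fun u v hu hv huv hmem => ?_⟩
  · have := fpoly_natDegree F
    rw [h] at this
    simp at this
  · rw [fpoly_natDegree, Finset.mem_Ioc] at hmem
    have hd : u.natDegree + v.natDegree = 4 := by
      rw [← hu.natDegree_mul hv, huv, fpoly_natDegree]
    have e := fun n => congrArg (fun p => coeff p n) huv
    simp only [coeff_mul, Finset.Nat.sum_antidiagonal_eq_sum_range_succ_mk, fpoly, coeff_add,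
      coeff_C_mul, coeff_X_pow, coeff_X, coeff_C] at e
    have e3 := e 3
    have e2 := e 2
    have e1 := e 1
    have e0 := e 0
    obtain hv1 | hv2 : v.natDegree = 1 ∨ v.natDegree = 2 := by omega
    · have u3 : u.coeff 3 = 1 := by rw [← hu.coeff_natDegree]; congr 1; omega
      have v1 : v.coeff 1 = 1 := by rw [← hv.coeff_natDegree, hv1]
      have v2 : v.coeff 2 = 0 := coeff_eq_zero_of_natDegree_lt (by omega)
      have v3 : v.coeff 3 = 0 := coeff_eq_zero_of_natDegree_lt (by omega)
      simp [-mul_eq_zero, -neg_eq_zero, Finset.sum_range_succ, u3, v1, v2, v3] at e3 e2 e1 e0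
      refine no_root (-v.coeff 0) (u.coeff 0) (u.coeff 1) (u.coeff 2) (root_deg _ ?_)
        (by linear_combination e3) (by linear_combination e2) (by linear_combination e1)
        (by linear_combination -e0)
      rw [← e3, ← e2, ← e1, ← e0]
      ring
    · have u2 : u.coeff 2 = 1 := by rw [← hu.coeff_natDegree]; congr 1; omega
      have v2 : v.coeff 2 = 1 := by rw [← hv.coeff_natDegree, hv2]
      have u3 : u.coeff 3 = 0 := coeff_eq_zero_of_natDegree_lt (by omega)
      have v3 : v.coeff 3 = 0 := coeff_eq_zero_of_natDegree_lt (by omega)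
      simp [-mul_eq_zero, -neg_eq_zero, Finset.sum_range_succ, u2, u3, v2, v3] at e3 e2 e1 e0
      exact no_quad' (u.coeff 1) (u.coeff 0) (v.coeff 1) (v.coeff 0)
        (by linear_combination e3) (by linear_combination e2) (by linear_combination e1)
        (by linear_combination e0)

instance O_isDomain : IsDomain (O F) :=
  AdjoinRoot.isDomain_of_prime fpoly_irreducible.prime

end Irred2

/-- The polynomial of the statement. -/
def Pv {R : Type*} [CommRing R] (t b : R) : R :=
  t ^ 2 * b ^ 4 + (-t ^ 4 + 2 * t ^ 3) * b ^ 3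
        + (-t ^ 5 + 3 * t ^ 4 - 2 * t ^ 3 + 2 * t + 1) * b ^ 2
        + (t ^ 5 - 4 * t ^ 4 + 3 * t ^ 3 + 2 * t ^ 2) * b
        + (t ^ 4 - 4 * t ^ 3 + 2 * t ^ 2 + 4 * t + 1)

theorem large_card {F : Type*} [Field F] [Fintype F] (hq : 7925 ≤ Fintype.card F) :
    5 ≤ Set.ncard {p : F × F | Pv p.1 p.2 = 0} := by
  refine (many_points hq).trans ?_
  refine Set.ncard_le_ncard_of_injOn (fun p : F × F => (p.1⁻¹, p.2 / p.1 ^ 2)) ?_ ?_ (Set.toFinite _)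
  · rintro ⟨x, y⟩ ⟨h, hx⟩
    simp only at h hx
    simp only [Set.mem_setOf_eq]
    have : Pv x⁻¹ (y / x ^ 2) = fval F x y / x ^ 10 := by
      simp only [Pv, fval, k3, k2, k1, k0]
      simp
      field_simp
      ring
    rw [this, h, zero_div]
  · rintro ⟨x, y⟩ ⟨h, hx⟩ ⟨x', y'⟩ ⟨h', hx'⟩ he
    simp only [Prod.mk.injEq] at he hx hx'
    obtain ⟨h1, h2⟩ := he
    obtain rfl := inv_injective h1
    rw [div_left_inj' (pow_ne_zero 2 hx)] at h2
    rw [h2]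

end StepanovCurve

namespace StepanovCurve
open Polynomial

lemma five {F : Type*} [Field F] [Fintype F] (p1 p2 p3 p4 p5 : F × F)
    (h1 : Pv p1.1 p1.2 = 0) (h2 : Pv p2.1 p2.2 = 0) (h3 : Pv p3.1 p3.2 = 0)
    (h4 : Pv p4.1 p4.2 = 0) (h5 : Pv p5.1 p5.2 = 0) (hn : [p1, p2, p3, p4, p5].Nodup) :
    5 ≤ Set.ncard {q : F × F | Pv q.1 q.2 = 0} := by
  classical
  have hc : [p1, p2, p3, p4, p5].toFinset.card = 5 := List.toFinset_card_of_nodup hn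
  rw [← hc, ← Set.ncard_coe_finset]
  refine Set.ncard_le_ncard ?_ (Set.toFinite _)
  intro q hq
  simp only [List.coe_toFinset, List.mem_cons, List.not_mem_nil, or_false, Set.mem_ofPred_eq] at hq
  rcases hq with rfl | rfl | rfl | rfl | rfl <;> assumption

lemma map_Pv {R S : Type*} [CommRing R] [CommRing S] (f : R →+* S) (t b : R) :
    f (Pv t b) = Pv (f t) (f b) := by
  simp [Pv, map_ofNat]

lemma orbit {F : Type*} [Field F] [Fintype F] (p : ℕ) [Fact p.Prime] [CharP F p] {r : ℕ}
    (hr : r.Prime) (hr5 : 5 ≤ r) {t b : F} (h : Pv t b = 0) (ht : t ^ p ^ r = t)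
    (ht' : t ^ p ≠ t) : 5 ≤ Set.ncard {q : F × F | Pv q.1 q.2 = 0} := by
  classical
  have hper : Function.IsPeriodicPt (frobenius F p) r t := by
    rw [Function.IsPeriodicPt, Function.IsFixedPt, ← coe_iterateFrobenius, iterateFrobenius_def, ht]
  have hmin : Function.minimalPeriod (frobenius F p) t = r := by
    rcases (Nat.dvd_prime hr).1 hper.minimalPeriod_dvd with h1 | h1
    · rw [Function.minimalPeriod_eq_one_iff_isFixedPt] at h1
      exact absurd h1 ht'
    · exact h1
  have hinj := Function.iterate_injOn_Iio_minimalPeriod (f := frobenius F p) (x := t)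
  rw [hmin] at hinj
  have hz : ∀ j : ℕ, Pv ((frobenius F p)^[j] t) ((frobenius F p)^[j] b) = 0 := by
    intro j
    rw [← coe_iterateFrobenius, ← map_Pv, h, map_zero]
  have h5 : Set.ncard ((fun j : ℕ => ((frobenius F p)^[j] t, (frobenius F p)^[j] b)) '' Set.Iio r) = r := by
    rw [Set.InjOn.ncard_image]
    · rw [← Finset.coe_Iio, Set.ncard_coe_finset, Nat.card_Iio]
    · intro i hi j hj hij
      exact hinj hi hj (Prod.mk.inj hij).1
  refine hr5.trans (h5.symm.le.trans (Set.ncard_le_ncard ?_ (Set.toFinite _)))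
  rintro _ ⟨j, _, rfl⟩
  exact hz j

lemma lift_root {F : Type*} [Field F] [Fintype F] {N k : ℕ} (hq : Fintype.card F = N ^ k)
    (m : ℤ[X]) (hm : m.Monic) (hd : m.natDegree ≠ 0)
    (h : ∀ x : AlgebraicClosure F, aeval x m = 0 → x ^ N = x) : ∃ z : F, aeval z m = 0 := by
  obtain ⟨x, hx⟩ := IsAlgClosed.exists_root (m.map (algebraMap ℤ (AlgebraicClosure F))) (by
    rw [hm.degree_map, degree_eq_natDegree hm.ne_zero]
    exact_mod_cast hd)
  rw [IsRoot.def, eval_map_algebraMap] at hx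
  have hN := h x hx
  have hk : ∀ j : ℕ, x ^ N ^ j = x := by
    intro j
    induction j with
    | zero => simp
    | succ j ih => rw [pow_succ, pow_mul, ih, hN]
  obtain ⟨z, rfl⟩ := mem_range_of_pow_card (F := F) (hq ▸ hk k)
  refine ⟨z, (algebraMap F (AlgebraicClosure F)).injective ?_⟩
  rw [map_zero, ← aeval_algebraMap_apply, hx]

lemma frob_2_5 {K : Type*} [Field K] (x : K) (hp : (2 : K) = 0)
    (hm : 1 + x + x^3 + x^4 + x^5 = 0) : x ^ 32 = x := by
  have e0 : x ^ 1 = x := pow_one x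
  have e1 : x ^ 2 = x^2 := by
    linear_combination (x^1 + (x)) * e0 + (0) * hm + (0) * hp
  have e2 : x ^ 4 = x^4 := by
    linear_combination (x^2 + (x^2)) * e1 + (0) * hm + (0) * hp
  have e3 : x ^ 8 = 1 + x + x^2 + x^3 := by
    linear_combination (x^4 + (x^4)) * e2 + (1 + x^2 + x^3) * hm + ((-1) + (-1)*x + (-1)*x^2 + (-2)*x^3 + (-1)*x^4 + (-1)*x^5 + (-1)*x^6 + (-1)*x^7) * hp
  have e4 : x ^ 16 = x^3 + x^4 := by
    linear_combination (x^8 + (1 + x + x^2 + x^3)) * e3 + (1 + x) * hm + (x^2 + x^3) * hp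
  have e5 : x ^ 32 = x := by
    linear_combination (x^16 + (x^3 + x^4)) * e4 + (x + x^2 + x^3) * hm + ((-1)*x + (-1)*x^2 + (-1)*x^3 + (-1)*x^4 + (-1)*x^5 + (-1)*x^6) * hp
  exact e5

lemma root_2_5 {F : Type*} [Field F] [Fintype F] (hp : (2 : F) = 0) {k : ℕ}
    (hq : Fintype.card F = (2 ^ 5) ^ k) : ∃ x : F, 1 + x + x^3 + x^4 + x^5 = 0 := by
  obtain ⟨x, hx⟩ := lift_root hq (1 + X + X^3 + X^4 + X^5 : ℤ[X]) (by monicity!) (by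
      rw [show (1 + X + X^3 + X^4 + X^5 : ℤ[X]).natDegree = 5 by compute_degree!]; norm_num) (by
    intro x hx
    refine (frob_2_5 x ?_ ?_).trans rfl
    · have := congrArg (algebraMap F (AlgebraicClosure F)) hp
      rwa [map_ofNat, map_zero] at this
    · simp [map_ofNat] at hx
      linear_combination hx)
  refine ⟨x, ?_⟩
  simp [map_ofNat] at hx
  linear_combination hx

lemma case_2_5 {F : Type*} [Field F] [Fintype F] [Fact (Nat.Prime 2)] [CharP F 2]
    (hp : (2 : F) = 0) {k : ℕ} (hq : Fintype.card F = (2 ^ 5) ^ k) :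
    5 ≤ Set.ncard {q : F × F | Pv q.1 q.2 = 0} := by
  obtain ⟨x, hm⟩ := root_2_5 hp hq
  refine orbit 2 (r := 5) (by norm_num) (by norm_num) (t := x) (b := 1 + x + x^2) ?_ ?_ ?_
  · unfold Pv
    linear_combination (x^3) * hm + (1 + 4*x + 6*x^2 + 6*x^3 + 10*x^4 + 13*x^5 + 13*x^6 + 11*x^7 + 5*x^8 + x^9) * hp
  · exact (frob_2_5 x hp hm).trans rfl
  · intro h
    obtain h | h : x = 0 ∨ x = 1 := by
      have : x * (x - 1) = 0 := by linear_combination h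
      rcases mul_eq_zero.1 this with h | h
      · exact Or.inl h
      · exact Or.inr (sub_eq_zero.1 h)
    · rw [h] at hm
      exact one_ne_zero (α := F) (by linear_combination (1) * hm + (0) * hp)
    · rw [h] at hm
      exact one_ne_zero (α := F) (by linear_combination (1) * hm + (-2) * hp)

lemma frob_2_7 {K : Type*} [Field K] (x : K) (hp : (2 : K) = 0)
    (hm : 1 + x + x^3 + x^5 + x^7 = 0) : x ^ 128 = x := by
  have e0 : x ^ 1 = x := pow_one x
  have e1 : x ^ 2 = x^2 := by
    linear_combination (x^1 + (x)) * e0 + (0) * hm + (0) * hp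
  have e2 : x ^ 4 = x^4 := by
    linear_combination (x^2 + (x^2)) * e1 + (0) * hm + (0) * hp
  have e3 : x ^ 8 = x + x^2 + x^4 + x^6 := by
    linear_combination (x^4 + (x^4)) * e2 + (x) * hm + ((-1)*x + (-1)*x^2 + (-1)*x^4 + (-1)*x^6) * hp
  have e4 : x ^ 16 = x + x^3 + x^4 + x^5 + x^6 := by
    linear_combination (x^8 + (x + x^2 + x^4 + x^6)) * e3 + (x + x^3 + x^5) * hm + ((-1)*x + (-1)*x^4 + (-1)*x^6 + x^7) * hp
  have e5 : x ^ 32 = x^2 + x^5 := by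
    linear_combination (x^16 + (x + x^3 + x^4 + x^5 + x^6)) * e4 + (x^5) * hm + (x^4 + x^6 + 2*x^7 + x^8 + 2*x^9 + x^10 + x^11) * hp
  have e6 : x ^ 64 = x + x^2 + x^3 + x^4 := by
    linear_combination (x^32 + (x^2 + x^5)) * e5 + (x + x^3) * hm + ((-1)*x + (-1)*x^2 + (-1)*x^3 + (-1)*x^4 + (-1)*x^6 + x^7 + (-1)*x^8) * hp
  have e7 : x ^ 128 = x := by
    linear_combination (x^64 + (x + x^2 + x^3 + x^4)) * e6 + (x) * hm + ((-1)*x + x^3 + x^4 + 2*x^5 + x^6 + x^7) * hp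
  exact e7

lemma root_2_7 {F : Type*} [Field F] [Fintype F] (hp : (2 : F) = 0) {k : ℕ}
    (hq : Fintype.card F = (2 ^ 7) ^ k) : ∃ x : F, 1 + x + x^3 + x^5 + x^7 = 0 := by
  obtain ⟨x, hx⟩ := lift_root hq (1 + X + X^3 + X^5 + X^7 : ℤ[X]) (by monicity!) (by
      rw [show (1 + X + X^3 + X^5 + X^7 : ℤ[X]).natDegree = 7 by compute_degree!]; norm_num) (by
    intro x hx
    refine (frob_2_7 x ?_ ?_).trans rfl
    · have := congrArg (algebraMap F (AlgebraicClosure F)) hp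
      rwa [map_ofNat, map_zero] at this
    · simp [map_ofNat] at hx
      linear_combination hx)
  refine ⟨x, ?_⟩
  simp [map_ofNat] at hx
  linear_combination hx

lemma case_2_7 {F : Type*} [Field F] [Fintype F] [Fact (Nat.Prime 2)] [CharP F 2]
    (hp : (2 : F) = 0) {k : ℕ} (hq : Fintype.card F = (2 ^ 7) ^ k) :
    5 ≤ Set.ncard {q : F × F | Pv q.1 q.2 = 0} := by
  obtain ⟨x, hm⟩ := root_2_7 hp hq
  refine orbit 2 (r := 7) (by norm_num) (by norm_num) (t := x) (b := x^2 + x^3) ?_ ?_ ?_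
  · unfold Pv
    linear_combination (1 + x + x^2 + x^4 + x^6 + x^7) * hm + (x + (-3)*x^3 + x^4 + 3*x^5 + x^6 + (-4)*x^7 + (-1)*x^8 + x^9 + 3*x^10 + 2*x^11 + 2*x^12 + x^13) * hp
  · exact (frob_2_7 x hp hm).trans rfl
  · intro h
    obtain h | h : x = 0 ∨ x = 1 := by
      have : x * (x - 1) = 0 := by linear_combination h
      rcases mul_eq_zero.1 this with h | h
      · exact Or.inl h
      · exact Or.inr (sub_eq_zero.1 h)
    · rw [h] at hm
      exact one_ne_zero (α := F) (by linear_combination (1) * hm + (0) * hp)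
    · rw [h] at hm
      exact one_ne_zero (α := F) (by linear_combination (1) * hm + (-2) * hp)

lemma frob_2_11 {K : Type*} [Field K] (x : K) (hp : (2 : K) = 0)
    (hm : 1 + x^2 + x^4 + x^5 + x^6 + x^10 + x^11 = 0) : x ^ 2048 = x := by
  have e0 : x ^ 1 = x := pow_one x
  have e1 : x ^ 2 = x^2 := by
    linear_combination (x^1 + (x)) * e0 + (0) * hm + (0) * hp
  have e2 : x ^ 4 = x^4 := by
    linear_combination (x^2 + (x^2)) * e1 + (0) * hm + (0) * hp
  have e3 : x ^ 8 = x^8 := by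
    linear_combination (x^4 + (x^4)) * e2 + (0) * hm + (0) * hp
  have e4 : x ^ 16 = x + x^2 + x^5 + x^6 + x^8 + x^9 := by
    linear_combination (x^8 + (x^8)) * e3 + (x + x^2 + x^3 + x^4 + x^5) * hm + ((-1)*x + (-1)*x^2 + (-1)*x^3 + (-1)*x^4 + (-2)*x^5 + (-2)*x^6 + (-2)*x^7 + (-2)*x^8 + (-2)*x^9 + (-1)*x^10 + (-1)*x^11 + (-1)*x^12 + (-1)*x^13 + (-1)*x^14 + (-1)*x^15) * hp
  have e5 : x ^ 32 = x^9 := by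
    linear_combination (x^16 + (x + x^2 + x^5 + x^6 + x^8 + x^9)) * e4 + (x^2 + x^6 + x^7) * hm + (x^3 + x^7 + 2*x^10 + x^11 + (-1)*x^12 + 2*x^14 + x^15) * hp
  have e6 : x ^ 64 = 1 + x^2 + x^3 + x^5 + x^6 + x^7 + x^8 := by
    linear_combination (x^32 + (x^9)) * e5 + (1 + x^3 + x^4 + x^5 + x^6 + x^7) * hm + ((-1) + (-1)*x^2 + (-1)*x^3 + (-1)*x^4 + (-2)*x^5 + (-2)*x^6 + (-2)*x^7 + (-2)*x^8 + (-2)*x^9 + (-2)*x^10 + (-2)*x^11 + (-1)*x^12 + (-1)*x^13 + (-1)*x^14 + (-1)*x^15 + (-1)*x^16 + (-1)*x^17) * hp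
  have e7 : x ^ 128 = 1 + x + x^3 + x^6 + x^8 + x^10 := by
    linear_combination (x^64 + (1 + x^2 + x^3 + x^5 + x^6 + x^7 + x^8)) * e6 + (x + x^4 + x^5) * hm + ((-1)*x + x^2 + x^5 + x^7 + 2*x^8 + x^9 + x^10 + x^11 + x^12 + 2*x^13 + x^14) * hp
  have e8 : x ^ 256 = x^3 := by
    linear_combination (x^128 + (1 + x + x^3 + x^6 + x^8 + x^10)) * e7 + (1 + x^3 + x^4 + x^6 + x^7 + x^8 + x^9) * hm + (x + (-1)*x^5 + (-1)*x^8 + (-1)*x^10 + (-1)*x^12 + (-1)*x^13 + (-1)*x^14 + (-1)*x^15 + x^16 + (-1)*x^17 + (-1)*x^19) * hp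
  have e9 : x ^ 512 = x^6 := by
    linear_combination (x^256 + (x^3)) * e8 + (0) * hm + (0) * hp
  have e10 : x ^ 1024 = 1 + x + x^2 + x^3 + x^4 + x^7 + x^10 := by
    linear_combination (x^512 + (x^6)) * e9 + (1 + x) * hm + ((-1) + (-1)*x + (-1)*x^2 + (-1)*x^3 + (-1)*x^4 + (-1)*x^5 + (-1)*x^6 + (-1)*x^7 + (-1)*x^10 + (-1)*x^11) * hp
  have e11 : x ^ 2048 = x := by
    linear_combination (x^1024 + (1 + x + x^2 + x^3 + x^4 + x^7 + x^10)) * e10 + (1 + x + x^3 + x^5 + x^6 + x^7 + x^8 + x^9) * hm + (x^2 + x^3 + 2*x^4 + (-1)*x^9 + (-1)*x^11 + (-1)*x^12 + (-1)*x^13 + (-1)*x^15 + (-1)*x^16 + (-1)*x^18 + (-1)*x^19) * hp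
  exact e11

lemma root_2_11 {F : Type*} [Field F] [Fintype F] (hp : (2 : F) = 0) {k : ℕ}
    (hq : Fintype.card F = (2 ^ 11) ^ k) : ∃ x : F, 1 + x^2 + x^4 + x^5 + x^6 + x^10 + x^11 = 0 := by
  obtain ⟨x, hx⟩ := lift_root hq (1 + X^2 + X^4 + X^5 + X^6 + X^10 + X^11 : ℤ[X]) (by monicity!) (by
      rw [show (1 + X^2 + X^4 + X^5 + X^6 + X^10 + X^11 : ℤ[X]).natDegree = 11 by compute_degree!]; norm_num) (by
    intro x hx
    refine (frob_2_11 x ?_ ?_).trans rfl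
    · have := congrArg (algebraMap F (AlgebraicClosure F)) hp
      rwa [map_ofNat, map_zero] at this
    · simp [map_ofNat] at hx
      linear_combination hx)
  refine ⟨x, ?_⟩
  simp [map_ofNat] at hx
  linear_combination hx

lemma case_2_11 {F : Type*} [Field F] [Fintype F] [Fact (Nat.Prime 2)] [CharP F 2]
    (hp : (2 : F) = 0) {k : ℕ} (hq : Fintype.card F = (2 ^ 11) ^ k) :
    5 ≤ Set.ncard {q : F × F | Pv q.1 q.2 = 0} := by
  obtain ⟨x, hm⟩ := root_2_11 hp hq
  refine orbit 2 (r := 11) (by norm_num) (by norm_num) (t := x) (b := 1 + x + x^3) ?_ ?_ ?_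
  · unfold Pv
    linear_combination (x^3) * hm + (1 + 4*x + 5*x^2 + 4*x^3 + 8*x^4 + 8*x^5 + 10*x^6 + 9*x^7 + 7*x^8 + 5*x^9 + 6*x^10 + 3*x^12 + (-1)*x^13) * hp
  · exact (frob_2_11 x hp hm).trans rfl
  · intro h
    obtain h | h : x = 0 ∨ x = 1 := by
      have : x * (x - 1) = 0 := by linear_combination h
      rcases mul_eq_zero.1 this with h | h
      · exact Or.inl h
      · exact Or.inr (sub_eq_zero.1 h)
    · rw [h] at hm
      exact one_ne_zero (α := F) (by linear_combination (1) * hm + (0) * hp)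
    · rw [h] at hm
      exact one_ne_zero (α := F) (by linear_combination (1) * hm + (-3) * hp)

lemma frob_3_5 {K : Type*} [Field K] (x : K) (hp : (3 : K) = 0)
    (hm : 2 + x + x^3 + x^5 = 0) : x ^ 243 = x := by
  have e0 : x ^ 1 = x := pow_one x
  have e1 : x ^ 3 = x^3 := by
    linear_combination (x^2 + x^1*(x) + (x)^2) * e0 + (0) * hm + (0) * hp
  have e2 : x ^ 9 = 2*x^2 + x^3 + x^4 := by
    linear_combination (x^6 + x^3*(x^3) + (x^3)^2) * e1 + (2*x^2 + x^4) * hm + ((-2)*x^2 + (-1)*x^3 + (-1)*x^4 + (-1)*x^5 + (-1)*x^7) * hp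
  have e3 : x ^ 27 = 1 + 2*x + 2*x^3 + x^4 := by
    linear_combination (x^18 + x^9*(2*x^2 + x^3 + x^4) + (2*x^2 + x^3 + x^4)^2) * e2 + (1 + x^4 + 2*x^5 + x^7) * hm + ((-1) + (-1)*x + (-1)*x^3 + (-1)*x^4 + (-2)*x^5 + 2*x^6 + 3*x^7 + 5*x^8 + 4*x^9 + 2*x^10 + x^11) * hp
  have e4 : x ^ 81 = 2 + x^2 + 2*x^3 + x^4 := by
    linear_combination (x^54 + x^27*(1 + 2*x + 2*x^3 + x^4) + (1 + 2*x + 2*x^3 + x^4)^2) * e3 + (1 + x + 2*x^2 + 2*x^4 + 2*x^5 + x^7) * hm + ((-1) + x + 2*x^2 + 3*x^3 + 7*x^4 + 9*x^5 + 7*x^6 + 10*x^7 + 8*x^8 + 4*x^9 + 3*x^10 + 2*x^11) * hp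
  have e5 : x ^ 243 = x := by
    linear_combination (x^162 + x^81*(2 + x^2 + 2*x^3 + x^4) + (2 + x^2 + 2*x^3 + x^4)^2) * e4 + (1 + 2*x + 2*x^2 + 2*x^4 + 2*x^5 + x^7) * hm + (2 + (-2)*x + 2*x^2 + 7*x^3 + 4*x^4 + 5*x^5 + 11*x^6 + 8*x^7 + 6*x^8 + 6*x^9 + 4*x^10 + 2*x^11) * hp
  exact e5

lemma root_3_5 {F : Type*} [Field F] [Fintype F] (hp : (3 : F) = 0) {k : ℕ}
    (hq : Fintype.card F = (3 ^ 5) ^ k) : ∃ x : F, 2 + x + x^3 + x^5 = 0 := by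
  obtain ⟨x, hx⟩ := lift_root hq (2 + X + X^3 + X^5 : ℤ[X]) (by monicity!) (by
      rw [show (2 + X + X^3 + X^5 : ℤ[X]).natDegree = 5 by compute_degree!]; norm_num) (by
    intro x hx
    refine (frob_3_5 x ?_ ?_).trans rfl
    · have := congrArg (algebraMap F (AlgebraicClosure F)) hp
      rwa [map_ofNat, map_zero] at this
    · simp [map_ofNat] at hx
      linear_combination hx)
  refine ⟨x, ?_⟩
  simp [map_ofNat] at hx
  linear_combination hx

lemma case_3_5 {F : Type*} [Field F] [Fintype F] [Fact (Nat.Prime 3)] [CharP F 3]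
    (hp : (3 : F) = 0) {k : ℕ} (hq : Fintype.card F = (3 ^ 5) ^ k) :
    5 ≤ Set.ncard {q : F × F | Pv q.1 q.2 = 0} := by
  obtain ⟨x, hm⟩ := root_3_5 hp hq
  refine orbit 3 (r := 5) (by norm_num) (by norm_num) (t := x) (b := x) ?_ ?_ ?_
  · unfold Pv
    linear_combination (2 + x + x^2) * hm + ((-1) + (-1)*x^3 + x^4 + (-3)*x^5 + 2*x^6 + (-1)*x^7) * hp
  · exact (frob_3_5 x hp hm).trans rfl
  · intro h
    obtain h | h | h : x = 0 ∨ x = 1 ∨ x = -1 := by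
      have : x * ((x - 1) * (x + 1)) = 0 := by linear_combination h
      rcases mul_eq_zero.1 this with h | h
      · exact Or.inl h
      · rcases mul_eq_zero.1 h with h | h
        · exact Or.inr (Or.inl (sub_eq_zero.1 h))
        · exact Or.inr (Or.inr (eq_neg_of_add_eq_zero_left h))
    · rw [h] at hm
      exact one_ne_zero (α := F) (by linear_combination (-1) * hm + (1) * hp)
    · rw [h] at hm
      exact one_ne_zero (α := F) (by linear_combination (-1) * hm + (2) * hp)
    · rw [h] at hm
      exact one_ne_zero (α := F) (by linear_combination (-1) * hm + (0) * hp)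

lemma frob_3_7 {K : Type*} [Field K] (x : K) (hp : (3 : K) = 0)
    (hm : 1 + 2*x + 2*x^2 + x^5 + x^7 = 0) : x ^ 2187 = x := by
  have e0 : x ^ 1 = x := pow_one x
  have e1 : x ^ 3 = x^3 := by
    linear_combination (x^2 + x^1*(x) + (x)^2) * e0 + (0) * hm + (0) * hp
  have e2 : x ^ 9 = 1 + 2*x + x^2 + x^3 + x^4 + x^5 := by
    linear_combination (x^6 + x^3*(x^3) + (x^3)^2) * e1 + (2 + x^2) * hm + ((-1) + (-2)*x + (-2)*x^2 + (-1)*x^3 + (-1)*x^4 + (-1)*x^5 + (-1)*x^7) * hp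
  have e3 : x ^ 27 = 2 + x + 2*x^2 + x^3 + x^5 := by
    linear_combination (x^18 + x^9*(1 + 2*x + x^2 + x^3 + x^4 + x^5) + (1 + 2*x + x^2 + x^3 + x^4 + x^5)^2) * e2 + (2 + x + x^2 + x^4 + x^5 + 2*x^6 + x^8) * hm + ((-1) + 2*x^2 + 6*x^3 + 9*x^4 + 11*x^5 + 13*x^6 + 12*x^7 + 11*x^8 + 10*x^9 + 8*x^10 + 5*x^11 + 3*x^12 + x^13 + x^14) * hp
  have e4 : x ^ 81 = 1 + x + x^3 + x^4 + x^5 + x^6 := by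
    linear_combination (x^54 + x^27*(2 + x + 2*x^2 + x^3 + x^5) + (2 + x + 2*x^2 + x^3 + x^5)^2) * e3 + (1 + x^2 + x^3 + x^4 + 2*x^6 + x^8) * hm + (2 + 3*x + 9*x^2 + 11*x^3 + 12*x^4 + 15*x^5 + 11*x^6 + 12*x^7 + 8*x^8 + 5*x^9 + 5*x^10 + x^11 + 2*x^12) * hp
  have e5 : x ^ 243 = 1 + 2*x + x^2 + x^4 + 2*x^5 + x^6 := by
    linear_combination (x^162 + x^81*(1 + x + x^3 + x^4 + x^5 + x^6) + (1 + x + x^3 + x^4 + x^5 + x^6)^2) * e4 + (x + 2*x^3 + x^4 + x^5 + x^7 + x^8 + 2*x^9 + x^11) * hm + (x^4 + x^5 + 3*x^6 + 5*x^7 + 4*x^8 + 5*x^9 + 5*x^10 + 5*x^11 + 5*x^12 + 4*x^13 + 3*x^14 + 3*x^15 + x^16 + x^17) * hp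
  have e6 : x ^ 729 = 1 + 2*x + 2*x^2 + 2*x^3 + x^5 + x^6 := by
    linear_combination (x^486 + x^243*(1 + 2*x + x^2 + x^4 + 2*x^5 + x^6) + (1 + 2*x + x^2 + x^4 + 2*x^5 + x^6)^2) * e5 + (x + 2*x^2 + 2*x^4 + x^5 + 2*x^6 + x^7 + 2*x^8 + 2*x^9 + x^11) * hm + (x + 3*x^2 + 4*x^3 + 4*x^4 + 6*x^5 + 12*x^6 + 17*x^7 + 13*x^8 + 8*x^9 + 13*x^10 + 17*x^11 + 14*x^12 + 6*x^13 + 5*x^14 + 6*x^15 + 4*x^16 + 2*x^17) * hp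
  have e7 : x ^ 2187 = x := by
    linear_combination (x^1458 + x^729*(1 + 2*x + 2*x^2 + 2*x^3 + x^5 + x^6) + (1 + 2*x + 2*x^2 + 2*x^3 + x^5 + x^6)^2) * e6 + (1 + x^2 + x^4 + x^7 + x^8 + 2*x^9 + x^11) * hm + (x + 5*x^2 + 12*x^3 + 19*x^4 + 24*x^5 + 27*x^6 + 27*x^7 + 27*x^8 + 24*x^9 + 19*x^10 + 14*x^11 + 10*x^12 + 7*x^13 + 5*x^14 + 2*x^15 + x^17) * hp
  exact e7

lemma root_3_7 {F : Type*} [Field F] [Fintype F] (hp : (3 : F) = 0) {k : ℕ}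
    (hq : Fintype.card F = (3 ^ 7) ^ k) : ∃ x : F, 1 + 2*x + 2*x^2 + x^5 + x^7 = 0 := by
  obtain ⟨x, hx⟩ := lift_root hq (1 + 2*X + 2*X^2 + X^5 + X^7 : ℤ[X]) (by monicity!) (by
      rw [show (1 + 2*X + 2*X^2 + X^5 + X^7 : ℤ[X]).natDegree = 7 by compute_degree!]; norm_num) (by
    intro x hx
    refine (frob_3_7 x ?_ ?_).trans rfl
    · have := congrArg (algebraMap F (AlgebraicClosure F)) hp
      rwa [map_ofNat, map_zero] at this
    · simp [map_ofNat] at hx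
      linear_combination hx)
  refine ⟨x, ?_⟩
  simp [map_ofNat] at hx
  linear_combination hx

lemma case_3_7 {F : Type*} [Field F] [Fintype F] [Fact (Nat.Prime 3)] [CharP F 3]
    (hp : (3 : F) = 0) {k : ℕ} (hq : Fintype.card F = (3 ^ 7) ^ k) :
    5 ≤ Set.ncard {q : F × F | Pv q.1 q.2 = 0} := by
  obtain ⟨x, hm⟩ := root_3_7 hp hq
  refine orbit 3 (r := 7) (by norm_num) (by norm_num) (t := x) (b := 1 + 2*x + x^2) ?_ ?_ ?_
  · unfold Pv
    linear_combination (2) * hm + (2*x + 5*x^2 + 9*x^3 + 16*x^4 + 25*x^5 + 33*x^6 + 23*x^7 + 8*x^8 + x^9) * hp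
  · exact (frob_3_7 x hp hm).trans rfl
  · intro h
    obtain h | h | h : x = 0 ∨ x = 1 ∨ x = -1 := by
      have : x * ((x - 1) * (x + 1)) = 0 := by linear_combination h
      rcases mul_eq_zero.1 this with h | h
      · exact Or.inl h
      · rcases mul_eq_zero.1 h with h | h
        · exact Or.inr (Or.inl (sub_eq_zero.1 h))
        · exact Or.inr (Or.inr (eq_neg_of_add_eq_zero_left h))
    · rw [h] at hm
      exact one_ne_zero (α := F) (by linear_combination (1) * hm + (0) * hp)
    · rw [h] at hm
      exact one_ne_zero (α := F) (by linear_combination (1) * hm + (-2) * hp)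
    · rw [h] at hm
      exact one_ne_zero (α := F) (by linear_combination (-1) * hm + (0) * hp)

lemma frob_2_2 {K : Type*} [Field K] (x : K) (hp : (2 : K) = 0)
    (hm : 1 + x + x^2 = 0) : x ^ 4 = x := by
  have e0 : x ^ 1 = x := pow_one x
  have e1 : x ^ 2 = 1 + x := by
    linear_combination (x^1 + (x)) * e0 + (1) * hm + ((-1) + (-1)*x) * hp
  have e2 : x ^ 4 = x := by
    linear_combination (x^2 + (1 + x)) * e1 + (1) * hm + (0) * hp
  exact e2

lemma root_2_2 {F : Type*} [Field F] [Fintype F] (hp : (2 : F) = 0) {k : ℕ}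
    (hq : Fintype.card F = (2 ^ 2) ^ k) : ∃ x : F, 1 + x + x^2 = 0 := by
  obtain ⟨x, hx⟩ := lift_root hq (1 + X + X^2 : ℤ[X]) (by monicity!) (by
      rw [show (1 + X + X^2 : ℤ[X]).natDegree = 2 by compute_degree!]; norm_num) (by
    intro x hx
    refine (frob_2_2 x ?_ ?_).trans rfl
    · have := congrArg (algebraMap F (AlgebraicClosure F)) hp
      rwa [map_ofNat, map_zero] at this
    · simp [map_ofNat] at hx
      linear_combination hx)
  refine ⟨x, ?_⟩
  simp [map_ofNat] at hx
  linear_combination hx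

lemma case_2_2 {F : Type*} [Field F] [Fintype F]
    (hp : (2 : F) = 0) {k : ℕ} (hq : Fintype.card F = (2 ^ 2) ^ k) :
    5 ≤ Set.ncard {q : F × F | Pv q.1 q.2 = 0} := by
  obtain ⟨x, hm⟩ := root_2_2 hp hq
  refine five (0, 1) (x, 1) (1, 0) (1, x) (1 + x, 1) ?_ ?_ ?_ ?_ ?_ ?_
  · simp only [Pv]
    linear_combination (0) * hm + (1) * hp
  · simp only [Pv]
    linear_combination (x^2) * hm + (1 + 3*x + 2*x^2 + (-1)*x^3 + (-1)*x^4) * hp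
  · simp only [Pv]
    linear_combination (0) * hm + (2) * hp
  · simp only [Pv]
    linear_combination (x^2) * hm + (2 + x + x^2) * hp
  · simp only [Pv]
    linear_combination (1 + x^2) * hm + (5 + 4*x + (-3)*x^2 + (-3)*x^3 + (-1)*x^4) * hp
  · simp only [List.nodup_cons, List.mem_cons, Prod.mk.injEq, List.not_mem_nil, List.nodup_nil]
    have h10 : (1 : F) ≠ 0 := one_ne_zero
    grind

lemma frob_2_3 {K : Type*} [Field K] (x : K) (hp : (2 : K) = 0)
    (hm : 1 + x + x^3 = 0) : x ^ 8 = x := by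
  have e0 : x ^ 1 = x := pow_one x
  have e1 : x ^ 2 = x^2 := by
    linear_combination (x^1 + (x)) * e0 + (0) * hm + (0) * hp
  have e2 : x ^ 4 = x + x^2 := by
    linear_combination (x^2 + (x^2)) * e1 + (x) * hm + ((-1)*x + (-1)*x^2) * hp
  have e3 : x ^ 8 = x := by
    linear_combination (x^4 + (x + x^2)) * e2 + (x) * hm + ((-1)*x + x^3) * hp
  exact e3

lemma root_2_3 {F : Type*} [Field F] [Fintype F] (hp : (2 : F) = 0) {k : ℕ}
    (hq : Fintype.card F = (2 ^ 3) ^ k) : ∃ x : F, 1 + x + x^3 = 0 := by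
  obtain ⟨x, hx⟩ := lift_root hq (1 + X + X^3 : ℤ[X]) (by monicity!) (by
      rw [show (1 + X + X^3 : ℤ[X]).natDegree = 3 by compute_degree!]; norm_num) (by
    intro x hx
    refine (frob_2_3 x ?_ ?_).trans rfl
    · have := congrArg (algebraMap F (AlgebraicClosure F)) hp
      rwa [map_ofNat, map_zero] at this
    · simp [map_ofNat] at hx
      linear_combination hx)
  refine ⟨x, ?_⟩
  simp [map_ofNat] at hx
  linear_combination hx

lemma case_2_3 {F : Type*} [Field F] [Fintype F]
    (hp : (2 : F) = 0) {k : ℕ} (hq : Fintype.card F = (2 ^ 3) ^ k) :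
    5 ≤ Set.ncard {q : F × F | Pv q.1 q.2 = 0} := by
  obtain ⟨x, hm⟩ := root_2_3 hp hq
  refine five (0, 1) (1, 0) (x, x) (x, x + x^2) (x, 1 + x^2) ?_ ?_ ?_ ?_ ?_ ?_
  · simp only [Pv]
    linear_combination (0) * hm + (1) * hp
  · simp only [Pv]
    linear_combination (0) * hm + (2) * hp
  · simp only [Pv]
    linear_combination (1 + x + x^3) * hm + (x + x^2 + (-1)*x^3 + x^4 + (-3)*x^5 + 3*x^6 + (-1)*x^7) * hp
  · simp only [Pv]
    linear_combination (1 + x + x^3 + x^4) * hm + (x + x^2 + 4*x^4 + (-1)*x^5 + (-1)*x^6 + 6*x^7 + 5*x^8 + x^9) * hp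
  · simp only [Pv]
    linear_combination (x^2 + x^6) * hm + (1 + 3*x + 3*x^2 + x^3 + 3*x^4 + 3*x^5 + 2*x^6 + x^7 + 2*x^8) * hp
  · simp only [List.nodup_cons, List.mem_cons, Prod.mk.injEq, List.not_mem_nil, List.nodup_nil]
    have h10 : (1 : F) ≠ 0 := one_ne_zero
    grind

lemma frob_3_2 {K : Type*} [Field K] (x : K) (hp : (3 : K) = 0)
    (hm : 1 + x^2 = 0) : x ^ 9 = x := by
  have e0 : x ^ 1 = x := pow_one x
  have e1 : x ^ 3 = 2*x := by
    linear_combination (x^2 + x^1*(x) + (x)^2) * e0 + (x) * hm + ((-1)*x) * hp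
  have e2 : x ^ 9 = x := by
    linear_combination (x^6 + x^3*(2*x) + (2*x)^2) * e1 + (2*x) * hm + ((-1)*x + 2*x^3) * hp
  exact e2

lemma root_3_2 {F : Type*} [Field F] [Fintype F] (hp : (3 : F) = 0) {k : ℕ}
    (hq : Fintype.card F = (3 ^ 2) ^ k) : ∃ x : F, 1 + x^2 = 0 := by
  obtain ⟨x, hx⟩ := lift_root hq (1 + X^2 : ℤ[X]) (by monicity!) (by
      rw [show (1 + X^2 : ℤ[X]).natDegree = 2 by compute_degree!]; norm_num) (by
    intro x hx
    refine (frob_3_2 x ?_ ?_).trans rfl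
    · have := congrArg (algebraMap F (AlgebraicClosure F)) hp
      rwa [map_ofNat, map_zero] at this
    · simp [map_ofNat] at hx
      linear_combination hx)
  refine ⟨x, ?_⟩
  simp [map_ofNat] at hx
  linear_combination hx

lemma case_3_2 {F : Type*} [Field F] [Fintype F]
    (hp : (3 : F) = 0) {k : ℕ} (hq : Fintype.card F = (3 ^ 2) ^ k) :
    5 ≤ Set.ncard {q : F × F | Pv q.1 q.2 = 0} := by
  obtain ⟨x, hm⟩ := root_3_2 hp hq
  refine five (0, x) (0, 2*x) (2, x) (2, 2*x) (1 + x, 0) ?_ ?_ ?_ ?_ ?_ ?_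
  · simp only [Pv]
    linear_combination (1) * hm + (0) * hp
  · simp only [Pv]
    linear_combination (1) * hm + (x^2) * hp
  · simp only [Pv]
    linear_combination (1 + x^2) * hm + (x^2 + x^4) * hp
  · simp only [Pv]
    linear_combination (1 + x^2) * hm + (6*x^2 + 21*x^4) * hp
  · simp only [Pv]
    linear_combination (1 + x^2) * hm + (1 + (-2)*x^2) * hp
  · simp only [List.nodup_cons, List.mem_cons, Prod.mk.injEq, List.not_mem_nil, List.nodup_nil]
    have h10 : (1 : F) ≠ 0 := one_ne_zero
    grind

lemma frob_3_3 {K : Type*} [Field K] (x : K) (hp : (3 : K) = 0)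
    (hm : 2 + 2*x + x^3 = 0) : x ^ 27 = x := by
  have e0 : x ^ 1 = x := pow_one x
  have e1 : x ^ 3 = 1 + x := by
    linear_combination (x^2 + x^1*(x) + (x)^2) * e0 + (1) * hm + ((-1) + (-1)*x) * hp
  have e2 : x ^ 9 = 2 + x := by
    linear_combination (x^6 + x^3*(1 + x) + (1 + x)^2) * e1 + (1) * hm + ((-1) + x^2) * hp
  have e3 : x ^ 27 = x := by
    linear_combination (x^18 + x^9*(2 + x) + (2 + x)^2) * e2 + (1) * hm + (2 + 3*x + 2*x^2) * hp
  exact e3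

lemma root_3_3 {F : Type*} [Field F] [Fintype F] (hp : (3 : F) = 0) {k : ℕ}
    (hq : Fintype.card F = (3 ^ 3) ^ k) : ∃ x : F, 2 + 2*x + x^3 = 0 := by
  obtain ⟨x, hx⟩ := lift_root hq (2 + 2*X + X^3 : ℤ[X]) (by monicity!) (by
      rw [show (2 + 2*X + X^3 : ℤ[X]).natDegree = 3 by compute_degree!]; norm_num) (by
    intro x hx
    refine (frob_3_3 x ?_ ?_).trans rfl
    · have := congrArg (algebraMap F (AlgebraicClosure F)) hp
      rwa [map_ofNat, map_zero] at this
    · simp [map_ofNat] at hx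
      linear_combination hx)
  refine ⟨x, ?_⟩
  simp [map_ofNat] at hx
  linear_combination hx

lemma case_3_3 {F : Type*} [Field F] [Fintype F]
    (hp : (3 : F) = 0) {k : ℕ} (hq : Fintype.card F = (3 ^ 3) ^ k) :
    5 ≤ Set.ncard {q : F × F | Pv q.1 q.2 = 0} := by
  obtain ⟨x, hm⟩ := root_3_3 hp hq
  refine five (x, 1 + x^2) (x, 2 + 2*x + x^2) (x^2, 1 + x^2) (x^2, 1 + 2*x) (2*x, 2 + 2*x) ?_ ?_ ?_ ?_ ?_ ?_
  · simp only [Pv]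
    linear_combination (1 + 2*x + x^3 + x^4 + x^5 + x^6) * hm + (x^2 + x^5 + x^8) * hp
  · simp only [Pv]
    linear_combination (1 + 2*x^2 + x^5) * hm + (1 + 6*x + 14*x^2 + 31*x^3 + 58*x^4 + 69*x^5 + 56*x^6 + 29*x^7 + 8*x^8 + x^9) * hp
  · simp only [Pv]
    linear_combination (1 + 2*x + 2*x^2 + 2*x^3 + 2*x^4 + x^6 + x^7 + x^8 + x^11) * hm + ((-2)*x + (-3)*x^3 + (-2)*x^5 + x^6 + (-2)*x^7 + 2*x^8 + (-1)*x^9 + 2*x^10 + (-1)*x^11 + (-1)*x^14) * hp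
  · simp only [Pv]
    linear_combination (1 + x + x^2 + x^3 + 2*x^4 + 2*x^5 + 2*x^7 + 2*x^8 + 2*x^9) * hm + (2*x^2 + x^3 + 2*x^4 + x^5 + 6*x^6 + 12*x^7 + 7*x^8 + 2*x^9 + (-2)*x^10 + (-4)*x^11 + (-2)*x^12) * hp
  · simp only [Pv]
    linear_combination (1 + 2*x^2 + 2*x^4) * hm + (1 + 10*x + 40*x^2 + 121*x^3 + 212*x^4 + 126*x^5 + (-64)*x^6 + (-86)*x^7) * hp
  · simp only [List.nodup_cons, List.mem_cons, Prod.mk.injEq, List.not_mem_nil, List.nodup_nil]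
    have h10 : (1 : F) ≠ 0 := one_ne_zero
    grind

end StepanovCurve

namespace StepanovCurve

/-- Positive part of the polynomial over the naturals. -/
def pos (t b : ℕ) : ℕ :=
  t ^ 2 * b ^ 4 + 2 * t ^ 3 * b ^ 3 + (3 * t ^ 4 + 2 * t + 1) * b ^ 2
    + (t ^ 5 + 3 * t ^ 3 + 2 * t ^ 2) * b + t ^ 4 + 2 * t ^ 2 + 4 * t + 1

/-- Negative part of the polynomial over the naturals. -/
def neg (t b : ℕ) : ℕ :=
  t ^ 4 * b ^ 3 + (t ^ 5 + 2 * t ^ 3) * b ^ 2 + 4 * t ^ 4 * b + 4 * t ^ 3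

def good (n c : ℕ) : Bool := pos (c / n) (c % n) % n == neg (c / n) (c % n) % n

def entryOk (n : ℕ) : List ℕ → Bool
  | [d] => Nat.blt 1 d && Nat.blt d n && n % d == 0
  | [c1, c2, c3, c4, c5] => Nat.blt c1 c2 && Nat.blt c2 c3 && Nat.blt c3 c4 && Nat.blt c4 c5
      && Nat.blt c5 (n * n) && good n c1 && good n c2 && good n c3 && good n c4 && good n c5
  | _ => false

def chk : ℕ → List (List ℕ) → Bool
  | _, [] => true
  | n, e :: l => entryOk n e && chk (n + 4) l

/-- There are five codes of zeros modulo `p`. -/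
def Five (p : ℕ) : Prop := ∃ c1 c2 c3 c4 c5 : ℕ, c1 < c2 ∧ c2 < c3 ∧ c3 < c4 ∧ c4 < c5 ∧ c5 < p * p ∧
  good p c1 = true ∧ good p c2 = true ∧ good p c3 = true ∧ good p c4 = true ∧ good p c5 = true

lemma entry_spec {p : ℕ} (hp : p.Prime) (e : List ℕ) (h : entryOk p e = true) : Five p := by
  unfold entryOk at h
  split at h
  · rename_i d
    simp only [Bool.and_eq_true, Nat.blt_eq, beq_iff_eq] at h
    obtain ⟨⟨h1, h2⟩, h3⟩ := h
    rcases (Nat.dvd_prime hp).1 (Nat.dvd_of_mod_eq_zero h3) with h | h <;> omega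
  · rename_i c1 c2 c3 c4 c5
    simp only [Bool.and_eq_true, Nat.blt_eq] at h
    exact ⟨c1, c2, c3, c4, c5, by tauto⟩
  · simp at h

lemma chk_spec {p : ℕ} (hp : p.Prime) : ∀ (l : List (List ℕ)) (n : ℕ), chk n l = true → n ≤ p →
    p < n + 4 * l.length → p % 4 = n % 4 → Five p := by
  intro l
  induction l with
  | nil => intro n _ h1 h2; simp at h2; omega
  | cons e l ih =>
    intro n hc h1 h2 h3
    simp only [chk, Bool.and_eq_true] at hc
    by_cases h : n = p
    · subst h; exact entry_spec hp e hc.1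
    · refine ih (n + 4) hc.2 (by omega) ?_ (by omega)
      simp only [List.length_cons] at h2
      omega

def tab0 : List (List ℕ) := [
  [26,28,30,34,35], [12,13,35,40,46], [3], [23,29,82,86,129], [94,128,130,138,233], [3],
  [112,172,180,190,207], [5], [3], [130,157,193,197,223], [303,318,347,353,372], [3], [5],
  [88,98,112,114,496], [3], [378,401,427,455,633], [96,108,227,240,251], [3],
  [131,155,328,357,508], [335,366,461,485,488], [3], [7], [5], [3], [380,397,434,488,535],
  [429,441,453,504,544], [3], [5], [7], [3], [443,452,797,852,942], [160,179,202,244,1335], [3],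
  [158,183,239,253,1824], [11], [3], [200,225,923,987,1002], [5], [3], [504,574,594,613,1048],
  [506,512,564,592,2338], [3], [5], [217,245,556,672,2541], [3], [11], [297,364,1477,1519,2297],
  [3], [218,241,814,843,865], [7], [3], [253,412,1076,1078,1083], [5], [3],
  [1141,1161,1283,1336,1351], [751,828,915,1078,2304], [3], [5], [349,352,1228,1305,1575], [3],
  [13], [1172,1221,1530,1654,2977], [3], [7], [819,976,2217,2330,2340], [3],
  [356,368,440,461,1984], [5], [3], [1291,1330,1766,1768,2322], [7], [3], [5], [13], [3],
  [1700,1759,2263,2319,2589], [419,455,1875,1975,2230], [3], [11], [17], [3],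
  [593,614,2702,2854,4026], [5], [3], [7], [2608,2694,8142,8159,8206], [3], [5],
  [387,436,445,526,1490], [3], [1732,1827,3260,3285,3419], [7], [3], [1970,2088,2089,2206,2444],
  [1631,1885,2339,2476,2533], [3], [17], [5], [3], [13]]

lemma tab0_ok : chk 7 tab0 = true := by decide +kernel

def tab1 : List (List ℕ) := [
  [11], [3], [5], [1697,2060,3453,3591,3602], [3], [7], [1752,2128,2250,2331,2342], [3],
  [815,871,3238,3290,4227], [1385,1387,1444,1546,2304], [3], [11], [5], [3],
  [2925,3231,4217,4243,4318], [1477,1741,1971,1987,3866], [3], [5], [812,853,1611,1760,2167],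
  [3], [1754,1866,2815,2902,5448], [1823,1834,3438,3853,3930], [3], [756,965,1820,1824,2743],
  [3067,3266,3304,3465,4083], [3], [7], [5], [3], [2114,2237,2502,2569,3251], [17], [3], [5],
  [7], [3], [2742,2844,6150,6331,6389], [19], [3], [13], [1946,2095,2266,2463,3033], [3],
  [611,828,2687,2742,3152], [5], [3], [11], [4753,4898,7737,7949,8001], [3], [5],
  [637,876,945,1135,4820], [3], [4909,5156,5178,5443,6091], [13], [3],
  [2599,2709,2749,3093,3769], [7], [3], [2921,2944,5221,5570,9041], [5], [3],
  [1978,2154,2371,2502,3280], [1976,1998,2132,2308,3883], [3], [5], [790,986,2879,2916,7932],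
  [3], [23], [11], [3], [7], [4838,5113,5515,5566,6850], [3], [756,1095,2086,2321,7935], [5],
  [3], [19], [7], [3], [5], [811,1016,4198,4257,4396], [3], [2291,2767,3409,3557,4583], [17],
  [3], [4571,4870,8888,8937,8958], [2489,2490,6229,6351,7807], [3], [973,1069,3016,3135,3229],
  [5], [3], [7], [13], [3], [5], [19], [3], [6392,6535,6545,6547,7952], [7], [3], [17], [11]]

lemma tab1_ok : chk 407 tab1 = true := by decide +kernel

def tab2 : List (List ℕ) := [
  [3], [2609,2860,7532,7584,9471], [5], [3], [4562,4720,5002,5283,7694],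
  [3075,3140,3918,4115,4302], [3], [5], [844,1175,2649,2767,3528], [3], [7], [23], [3],
  [985,1009,1042,1258,2692], [4943,5084,5190,5765,13043], [3], [13], [5], [3],
  [2696,3413,4982,5165,6621], [6081,6097,8091,8671,9282], [3], [5], [29], [3],
  [3947,4048,4095,4244,6198], [1006,1102,1659,1698,3843], [3], [1446,1627,4133,4320,5414], [13],
  [3], [7], [5], [3], [23], [2943,3429,5065,5488,7060], [3], [5], [7], [3],
  [6182,6196,8873,8909,9364], [1780,1930,2985,3875,5341], [3], [11], [2990,3157,3702,3916,4191],
  [3], [1468,1473,6954,7503,8002], [5], [3], [17], [19], [3], [5], [1102,1461,4158,4179,4306],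
  [3], [13], [1488,1498,4320,4483,4699], [3], [1153,1677,3214,4131,11480], [7], [3],
  [1164,1916,5930,6287,8432], [5], [3], [3195,3307,5517,5576,9686], [11], [3], [5], [13], [3],
  [8756,9604,14376,14457,14848], [1457,2027,2058,2094,7099], [3], [7],
  [10193,10926,10971,10990,13492], [3], [11], [5], [3], [4528,5342,5756,6464,9595], [7], [3],
  [5], [17], [3], [31], [1191,1669,3509,4097,5983], [3], [19], [3575,3996,4075,4639,7030], [3],
  [4229,4515,4940,5207,5307], [5], [3], [7], [4934,5024,14409,14410,20316], [3], [5], [11], [3]]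

lemma tab2_ok : chk 807 tab2 = true := by decide +kernel

def tab3 : List (List ℕ) := [
  [17], [7], [3], [23], [4060,4305,6222,6339,9894], [3], [11131,12252,16628,16879,19885], [5],
  [3], [11], [29], [3], [5], [1672,2140,5228,5595,11411], [3], [7], [31], [3],
  [5799,6041,6199,6270,9097], [4089,4658,10424,11135,11605], [3], [2062,2114,2422,2438,4255],
  [5], [3], [9380,9729,11882,12242,12452], [5781,5836,8340,8423,8461], [3], [5],
  [1981,2375,6699,6964,7593], [3], [4028,4438,4988,5127,9836], [11], [3], [13], [17], [3], [7],
  [5], [3], [29], [4189,4712,5780,6433,7797], [3], [5], [7], [3], [19], [13], [3],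
  [2015,2421,2577,2779,4422], [23], [3], [17], [5], [3], [7266,7818,7977,8260,8549],
  [5180,5299,8786,9697,11711], [3], [5], [1490,1668,1948,2088,8806], [3],
  [7205,7223,11726,12783,13336], [4660,4727,5460,5470,17442], [3], [1479,1605,9492,9669,12011],
  [7], [3], [6407,7066,8986,9183,10396], [5], [3], [4572,4627,4662,5421,6949],
  [7596,7859,8547,8727,12271], [3], [5], [12505,12549,16794,16959,22880], [3], [11],
  [1520,1847,16805,17322,17366], [3], [7], [7951,8157,8440,8973,10246], [3],
  [2248,2257,10602,10666,17773], [5], [3], [7889,7942,11076,11633,16537], [7], [3], [5],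
  [1780,1847,2857,2869,8360], [3], [4929,4953,5019,5473,15894], [2647,3069,7125,7211,12737],
  [3], [1603,2014,2040,2237,9506], [5281,5446,5715,5723,6642], [3], [37], [5], [3], [7]]

lemma tab3_ok : chk 1207 tab3 = true := by decide +kernel

def tab4 : List (List ℕ) := [
  [8864,9352,13017,13506,13783], [3], [5], [2535,2714,2997,3086,10261], [3],
  [15424,15917,23278,23491,23820], [7], [3], [11], [31], [3], [13], [5], [3],
  [6952,7884,10354,10496,11130], [5702,6538,13382,13431,16764], [3], [5], [23], [3], [7], [19],
  [3], [5305,6246,7283,7683,8603], [13], [3], [29], [5], [3], [5768,5842,5949,6566,7486], [11],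
  [3], [5], [37], [3], [7747,7831,14482,15515,15533], [17], [3], [5431,6107,8119,8352,9363],
  [41], [3], [7], [5], [3], [12855,13523,19362,19412,27248], [13660,13775,13985,14012,14392],
  [3], [5], [7], [3], [13], [2287,2960,9623,10250,12679], [3], [17],
  [5778,6645,10024,10137,14606], [3], [3085,3186,8087,8739,8837], [5], [3], [19],
  [11100,12125,13056,14429,27041], [3], [5], [11], [3], [6216,6280,11761,12337,15053],
  [2297,2644,5900,7258,9903], [3], [2444,3615,13591,14527,15584], [7], [3], [31], [5], [3],
  [11], [8053,8190,9825,10524,11481], [3], [5], [19], [3], [41], [2303,2502,3024,3756,6498],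
  [3], [7], [29], [3], [2607,3099,8396,8721,10989], [5], [3], [13], [7], [3], [5],
  [2843,3138,16757,17301,17575], [3], [12198,13771,19969,21028,26871], [11], [3],
  [2438,2509,3201,3845,12206], [12896,13994,23163,23676,26103]]

lemma tab4_ok : chk 1607 tab4 = true := by decide +kernel

def tab5 : List (List ℕ) := [
  [3], [2635,2662,2972,3796,8815], [5], [3], [7], [6210,7359,18317,18529,24654], [3], [5],
  [3548,3801,9585,10134,17517], [3], [23], [7], [3], [29], [16649,17496,17960,18085,24904], [3],
  [19], [5], [3], [7434,8182,13542,14024,14754], [8845,9634,10592,10868,11184], [3], [5],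
  [2394,2469,2554,3077,11120], [3], [7], [2467,2787,3373,4038,6623], [3], [13], [11], [3],
  [10835,12535,13401,13509,13711], [5], [3], [10851,11402,26294,27360,28352], [19], [3], [5],
  [17], [3], [11], [13], [3], [2196,2820,7516,7818,8661], [37], [3], [7], [5], [3],
  [8625,8651,12526,13041,13635], [11073,13149,22828,24247,24994], [3], [5], [7], [3], [17],
  [23], [3], [11659,12206,12494,12914,19637], [11617,12107,12351,13286,13624], [3],
  [3038,3970,4349,4399,6821], [5], [3], [31], [7898,8302,13866,14548,14727], [3], [5], [43],
  [3], [7501,7546,7964,9010,27875], [29], [3], [11], [7], [3], [2451,4589,7013,7530,10018], [5],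
  [3], [23], [13], [3], [5], [15817,16061,16407,16707,32504], [3],
  [14211,16244,20023,20575,20616], [2677,4327,7077,7317,7617], [3], [7], [17], [3],
  [3158,3793,14799,16137,20650], [5], [3], [15201,16670,31711,31736,32305], [7], [3], [5],
  [2641,2739,4342,4671,14598], [3]]

lemma tab5_ok : chk 2007 tab5 = true := by decide +kernel

def tab6 : List (List ℕ) := [
  [29], [9812,10523,11455,11616,16398], [3], [41], [17608,18979,26966,28330,34143], [3], [11],
  [5], [3], [7], [7643,9183,17201,17663,28306], [3], [5], [2726,3540,3776,4711,7782], [3],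
  [8921,9525,17447,17661,27616], [7], [3], [37], [13], [3], [47], [5], [3],
  [16372,16650,17078,17505,28070], [23], [3], [5], [11], [3], [7], [3577,4128,8364,8572,8963],
  [3], [2857,3050,25592,27528,27950], [18045,18066,20066,20148,23597], [3],
  [8604,8768,10326,10335,10832], [5], [3], [11], [17], [3], [5], [8051,8572,9619,9867,13242],
  [3], [13], [12998,14148,44392,45421,45712], [3], [23], [19], [3], [7], [5], [3], [43], [37],
  [3], [5], [7], [3], [8939,9131,15075,15123,31967], [11], [3], [3240,4302,8357,9438,9689],
  [8602,9676,15335,15814,19859], [3], [3734,4847,13519,15811,16632], [5], [3],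
  [8785,9495,13777,14672,14922], [12282,12966,28301,28304,30113], [3], [5],
  [3342,3379,13585,14605,15093], [3], [9008,9298,17683,17861,19708],
  [3382,3470,4016,5397,11058], [3], [3568,3952,12777,13182,14084], [7], [3],
  [3736,4717,5212,5451,11571], [5], [3], [13], [41], [3], [5], [31], [3],
  [12055,13104,16935,17847,22889], [17], [3], [7], [11], [3], [2908,2958,32819,32997,45846],
  [5], [3], [14311,15000,15943,16427,18111]]

lemma tab6_ok : chk 2407 tab6 = true := by decide +kernel

def tab7 : List (List ℕ) := [
  [7], [3], [5], [20018,20342,20487,20939,26136], [3], [11], [19], [3], [17],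
  [10422,10560,11738,12269,13479], [3], [5048,5423,17525,17617,17875], [5], [3], [7], [47], [3],
  [5], [4593,4698,5318,5543,9217], [3], [18282,19592,23495,25803,29103], [7], [3], [13],
  [10708,11460,12234,13088,15627], [3], [41], [5], [3], [37], [9788,10587,14697,17392,20548],
  [3], [5], [3274,3790,10150,11695,21072], [3], [7], [13], [3], [11],
  [13437,14679,27112,27702,32718], [3], [3177,4644,22735,23284,30988], [5], [3], [19], [29],
  [3], [5], [5243,5712,27881,28091,28930], [3], [31], [3982,4360,4377,5346,13530], [3],
  [3763,4423,21658,21676,27425], [9118,11619,12944,13576,15128], [3], [7], [5], [3], [17], [11],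
  [3], [5], [7], [3], [17147,17184,17836,18389,19614], [37], [3], [4401,4587,4594,4891,13170],
  [10006,10912,26237,27025,28667], [3], [11], [5], [3], [29], [13], [3], [5],
  [5676,6127,9670,10018,11851], [3], [53], [31], [3], [43], [7], [3], [23], [5], [3],
  [10945,12610,22192,22894,25881], [10533,12445,21907,22167,23637], [3], [5], [11], [3],
  [38765,39525,39877,41303,54615], [3761,5755,10423,10775,11626], [3], [7],
  [24086,24979,29551,30690,46276]]

lemma tab7_ok : chk 2807 tab7 = true := by decide +kernel

def tab8 : List (List ℕ) := [
  [3], [13], [5], [3], [11], [7], [3], [5], [41], [3], [17], [4807,4818,9994,10273,10299], [3],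
  [16610,18149,18258,18696,29520], [13], [3], [10765,11266,11683,12083,13428], [5], [3], [7],
  [19], [3], [5], [4085,6002,10041,10065,20599], [3], [17180,18229,18282,19078,20003], [7], [3],
  [10701,10754,11967,13047,38755], [14443,14619,15126,15634,17520], [3],
  [5104,5593,6099,6520,11152], [5], [3], [11668,12892,21842,23084,34541],
  [33524,34319,34710,34754,41281], [3], [5], [5757,5970,23931,25499,29501], [3], [7],
  [4007,4161,5368,6689,20392], [3], [31], [17], [3], [6136,6761,14223,14696,15428], [5], [3],
  [41], [17633,18473,18672,20191,38902], [3], [5], [13], [3], [23], [47], [3], [19], [11], [3],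
  [7], [5], [3], [17456,17649,18279,19354,42044], [11404,11809,15469,16151,22816], [3], [5],
  [7], [3], [11], [4827,4855,11395,11932,27490], [3], [3953,5025,11584,11980,12173], [31], [3],
  [4982,5683,10551,10663,12112], [5], [3], [13], [34367,34422,35902,36284,46621], [3], [5],
  [4828,5848,15386,15566,16147], [3], [10755,11617,13462,13827,21376], [53], [3],
  [4048,4658,6061,6586,15318], [7], [3], [3808,3811,4434,5801,12877], [5], [3],
  [22456,23618,25859,26380,27085], [17], [3], [5], [59], [3]]

lemma tab8_ok : chk 3207 tab8 = true := by decide +kernel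

def tab9 : List (List ℕ) := [
  [11129,11672,16032,17244,19111], [23], [3], [7], [10966,11367,18286,18615,21347], [3],
  [4873,5346,5695,5871,15056], [5], [3], [27774,27819,40740,41714,48043], [7], [3], [5],
  [19249,19642,27469,28039,28796], [3], [19], [4985,6895,14811,15674,23303], [3], [13], [29],
  [3], [14822,15989,22552,23578,24870], [5], [3], [7], [11], [3], [5],
  [6392,7374,12818,12940,49114], [3], [12843,13268,20483,20865,22122], [7], [3],
  [42215,44555,60515,60824,62592], [19], [3], [11], [5], [3], [53],
  [23268,26336,28709,28798,30289], [3], [5], [6537,7273,30621,31392,32521], [3], [7], [17], [3],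
  [29], [11939,14217,19818,21921,23455], [3], [37], [5], [3], [18643,18708,21021,22869,27221],
  [43], [3], [5], [11], [3], [23690,24416,31113,32250,50717], [5502,5780,20120,20504,21462],
  [3], [17], [15977,16621,18375,18569,20479], [3], [7], [5], [3], [11], [13], [3], [5], [7],
  [3], [12059,13740,13820,15082,16972], [36969,37797,44930,46569,62910], [3],
  [4450,5277,19614,19877,20918], [28300,30193,39547,41189,63759], [3],
  [5308,7043,7351,7814,20586], [5], [3], [13467,15037,16173,17770,18413],
  [13681,14019,16623,17754,18288], [3], [5], [37], [3], [16087,16742,18875,19710,20802], [11],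
  [3], [23], [7], [3], [13], [5], [3], [14566,15307,25241,27248,33171]]

lemma tab9_ok : chk 3607 tab9 = true := by decide +kernel

def tab10 : List (List ℕ) := [
  [21485,21556,22013,23115,28183], [3], [5], [68336,70395,70662,72192,81843], [3],
  [12196,12893,13435,13830,20848], [29], [3], [7], [13], [3], [5456,5665,5823,7361,20398], [5],
  [3], [17], [7], [3], [5], [13426,16077,65940,67591,67684], [3], [61],
  [6241,7020,7330,8045,16949], [3], [16414,17136,21459,24395,26983], [11], [3],
  [5772,8024,17111,17250,17751], [5], [3], [7], [18719,19243,20817,21054,24303], [3], [5],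
  [16706,18606,19405,19793,38342], [3], [11], [7], [3], [21670,22953,23144,23746,35235], [23],
  [3], [43], [5], [3], [47], [53], [3], [5], [13], [3], [7], [4407,5629,84227,86170,87496], [3],
  [6552,7295,7749,7936,14367], [41], [3], [4886,5418,6858,8223,16976], [5], [3],
  [13248,16397,17943,18083,22721], [31], [3], [5], [5316,5770,6452,8015,24222], [3], [17],
  [6381,7202,21835,23551,25727], [3], [11], [17245,17710,20796,21351,22658], [3], [7], [5], [3],
  [13], [59], [3], [5], [7], [3], [28710,30136,30707,31655,33010], [61], [3],
  [4931,5585,15056,16087,16669], [43], [3], [19], [5], [3], [15545,15897,48385,49877,64161],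
  [11], [3], [5], [29], [3], [41], [17993,20064,36914,38275,39155], [3], [53], [7]]

lemma tab10_ok : chk 4007 tab10 = true := by decide +kernel

def tab11 : List (List ℕ) := [
  [3], [11], [5], [3], [19355,19511,19526,21230,22473], [19], [3], [5], [23], [3],
  [37581,38260,46585,47442,48540], [4884,7044,7273,7504,16357], [3], [7],
  [14310,15610,28218,29072,31989], [3], [17], [5], [3], [14894,16054,18358,19671,22581], [7],
  [3], [5], [11], [3], [16118,16369,17491,17630,20989], [13], [3],
  [13770,16308,20622,22386,27173], [13631,13691,15563,15917,46333], [3], [23], [5], [3], [7],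
  [14797,15196,24171,24249,25283], [3], [5], [47], [3], [25625,26008,27999,29099,36775], [7],
  [3], [19], [27821,31005,37412,37786,41706], [3], [6400,6410,6860,7875,21240], [5], [3],
  [15269,17607,25780,25891,30441], [17], [3], [5], [31], [3], [7], [11], [3],
  [6417,6815,33466,36498,47447], [20333,20616,23473,26879,34020], [3],
  [6590,6792,7008,7515,22495], [5], [3], [20539,22085,22771,23210,28287], [13], [3], [5],
  [4839,7077,7097,9060,14163], [3], [43], [6525,7479,20249,20359,21194], [3], [37],
  [20745,22085,37696,38024,44224], [3], [7], [5], [3], [35334,36873,47902,50191,62942], [29],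
  [3], [5], [7], [3], [47], [6832,7778,9265,9381,43865], [3], [5804,8844,18442,18582,20630],
  [11], [3], [13], [5], [3], [20392,21570,30617,30704,34143], [25581,25780,29387,32524,33861],
  [3], [5], [4850,5413,6681,7050,28844], [3]]

lemma tab11_ok : chk 4407 tab11 = true := by decide +kernel

def tab12 : List (List ℕ) := [
  [11], [17], [3], [61], [7], [3], [8832,9208,16866,17259,34500], [5], [3], [29], [37], [3],
  [5], [43], [3], [31], [15760,19375,27944,28919,29229], [3], [7], [19], [3], [67], [5], [3],
  [15642,16000,26697,28361,28491], [7], [3], [5], [5334,7272,7875,9032,15308], [3], [13],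
  [5538,5654,15473,18907,29742], [3], [11], [14896,16034,16429,16903,24726], [3],
  [5035,6955,8048,9667,25346], [5], [3], [7], [33112,34151,50192,50828,56808], [3], [5], [13],
  [3], [17267,17974,19651,19916,22396], [7], [3], [5325,9906,46366,49460,65397],
  [36813,39886,43925,44266,56046], [3], [22160,22884,38014,39689,43628], [5], [3],
  [25266,25268,40678,43256,95927], [11], [3], [5], [5301,5349,6697,7847,31739], [3], [7],
  [23267,23392,32132,34594,38844], [3], [21437,22954,30785,31831,35962], [61], [3], [11], [5],
  [3], [13], [36917,39057,41492,44953,66456], [3], [5], [5470,7944,37634,38657,43587], [3],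
  [18330,18664,33585,35124,42823], [19], [3], [5635,7242,26851,26953,31532], [47], [3], [7],
  [5], [3], [37], [27600,28598,30946,33308,43736], [3], [5], [7], [3],
  [43574,45062,46040,46217,48310], [38490,40253,109077,112168,114880], [3],
  [8620,9470,16564,17028,31079], [71], [3], [29], [5], [3], [11]]

lemma tab12_ok : chk 4807 tab12 = true := by decide +kernel

def tab13 : List (List ℕ) := [
  [41], [3], [5], [17], [3], [18100,19842,27468,28154,28156], [8714,8852,17968,20458,31896],
  [3], [13], [7], [3], [59], [5], [3], [19], [23], [3], [5], [6910,7221,7261,10281,69139], [3],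
  [17], [11], [3], [7], [16283,18310,19253,20399,64096], [3], [47], [5], [3],
  [21776,25265,27000,29983,117557], [7], [3], [5], [19], [3], [16470,18405,19001,20985,37859],
  [6467,7557,9038,9043,22407], [3], [23], [31], [3], [41], [5], [3], [7],
  [22817,23540,32384,36507,50066], [3], [5], [5758,8482,23084,24206,24398], [3],
  [50336,50549,72618,74706,78140], [7], [3], [6602,8937,25265,25664,26015], [11], [3],
  [7004,10206,55940,58178,68386], [5], [3], [22281,22752,22812,24694,30285], [13], [3], [5],
  [53], [3], [7], [6230,6560,7154,7410,18264], [3], [6616,9575,24703,26328,29685],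
  [19428,19481,27630,29751,39237], [3], [17], [5], [3], [31777,32532,39465,40880,41264],
  [23182,23987,25388,26577,28199], [3], [5], [5881,6545,7379,7789,17311], [3],
  [23496,24867,25486,25645,34036], [17918,21278,23780,24052,41324], [3], [29], [23], [3], [7],
  [5], [3], [17167,19583,22374,27416,62454], [19], [3], [5], [7], [3], [37],
  [5609,8076,29644,29914,41573], [3], [11], [13]]

lemma tab13_ok : chk 5207 tab13 = true := by decide +kernel

def tab14 : List (List ℕ) := [
  [3], [31], [5], [3], [55240,55426,68440,71754,83777], [17], [3], [5],
  [8970,10374,76864,76948,97201], [3], [17002,17373,81139,84642,93209],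
  [7418,8977,39842,42719,43116], [3], [87927,90417,94240,96094,105313], [7], [3], [53], [5],
  [3], [19475,20555,31516,31735,35801], [11], [3], [5], [41], [3], [13],
  [5985,7837,20959,22640,29362], [3], [7], [59], [3], [11], [5], [3],
  [30522,30638,31542,33659,46139], [7], [3], [5], [13], [3], [73], [29], [3],
  [68355,68820,71057,72971,95219], [18102,23004,23345,25528,52286], [3],
  [7162,8545,9235,9803,18313], [5], [3], [7], [23474,26161,35417,40378,44196], [3], [5], [11],
  [3], [18484,19892,21447,21758,32512], [7], [3], [6417,10688,35829,37573,38497],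
  [30231,30984,32701,34645,36113], [3], [8464,9165,35267,36917,45790], [5], [3], [11],
  [18238,19762,21454,22687,50382], [3], [5], [5957,6482,7500,9455,25372], [3], [7], [43], [3],
  [17], [19767,23111,24628,24973,47372], [3], [23], [5], [3], [49704,50776,54891,58822,59891],
  [31527,33621,36774,39788,48870], [3], [5], [6672,9423,18558,20697,60814], [3], [19], [11],
  [3], [59], [67], [3], [7], [5], [3], [31], [26176,28420,29361,29804,30679], [3], [5], [7], [3]]

lemma tab14_ok : chk 5607 tab14 = true := by decide +kernel

def tab15 : List (List ℕ) := [
  [39088,41672,75983,76343,80989], [21155,23958,50948,52337,53302], [3], [13], [19], [3], [37],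
  [5], [3], [28020,28144,74020,77516,92032], [19528,23675,31752,31847,36916], [3], [5], [73],
  [3], [18371,21962,22172,22436,30477], [13], [3], [9795,11520,22038,22601,23007], [7], [3],
  [19475,23587,30544,33521,33824], [5], [3], [17], [31], [3], [5], [29], [3], [11],
  [8087,11516,32088,32452,34496], [3], [7], [32981,33658,50273,53133,56829], [3],
  [6826,8950,9550,11579,27251], [5], [3], [20609,24433,24728,26213,61739], [7], [3], [5], [37],
  [3], [23], [41], [3], [19734,22995,31389,36615,64405], [64579,64768,64985,66274,81536], [3],
  [31237,31851,36406,37163,70483], [5], [3], [7], [13], [3], [5], [17], [3],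
  [25055,25291,39637,40018,69019], [7], [3], [11], [25444,30616,32391,36202,46081], [3],
  [29716,31201,40405,43425,50878], [5], [3], [61], [22807,22943,23525,25033,35756], [3], [5],
  [10853,12302,38376,43532,52314], [3], [7], [8673,12451,34356,34585,39560], [3], [71],
  [26078,26557,27419,27445,47460], [3], [13], [5], [3], [35742,36131,52694,55757,56695], [11],
  [3], [5], [8500,8545,9140,11968,26427], [3], [21988,25196,27273,30372,35140], [23], [3],
  [8810,11753,20030,22692,32479], [13], [3], [7], [5], [3], [19]]

lemma tab15_ok : chk 6007 tab15 = true := by decide +kernel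

def tab16 : List (List ℕ) := [
  [43], [3], [5], [7], [3], [42560,42890,43386,44717,90074], [59], [3], [47], [17], [3],
  [8720,9749,20170,22414,29683], [5], [3], [23], [29], [3], [5], [11], [3], [13],
  [8931,9944,40061,42093,43121], [3], [67], [7], [3], [17], [5], [3], [11], [61], [3], [5],
  [13], [3], [26795,28089,39770,39992,41263], [8018,8529,10378,12380,29113], [3], [7],
  [53981,55208,55515,58486,64419], [3], [7810,9472,36374,38154,63851], [5], [3], [29], [7], [3],
  [5], [28556,32898,49758,51638,74124], [3], [47014,51199,53176,56575,56901], [11], [3],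
  [8474,12001,12924,12933,39931], [37], [3], [19], [5], [3], [7], [17], [3], [5],
  [11141,13214,42318,44929,47268], [3], [59], [7], [3], [7729,9536,11208,11600,20381], [41],
  [3], [27374,31253,40935,42694,45001], [5], [3], [22820,24811,26180,26737,34612], [19], [3],
  [5], [48608,48868,61574,62955,64103], [3], [7], [53], [3], [23], [11], [3], [43], [5], [3],
  [75520,79365,83474,84139,90292], [67], [3], [5], [9228,11911,31066,31721,32510], [3], [11],
  [10126,11786,35471,37372,41311], [3], [13], [68560,69925,72497,74824,89302]]

lemma tab16_ok : chk 6407 tab16 = true := by decide +kernel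

def tab17 : List (List ℕ) := [
  [3], [7], [5], [3], [27571,30086,61487,67794,69720], [22282,23725,24596,24978,35727], [3],
  [5], [7], [3], [41], [13], [3], [19], [38595,39824,44163,44972,50567], [3],
  [7247,9539,42433,43115,58025], [5], [3], [41410,41595,42460,46634,63320], [71], [3], [5],
  [8601,9704,32430,32513,44678], [3], [36057,36811,39064,40037,42882],
  [44248,45615,48713,49097,54649], [3], [11], [7], [3], [29], [5], [3], [53],
  [22515,23129,24548,27069,35138], [3], [5], [8650,9350,37372,37524,37712], [3],
  [30399,33352,37605,40223,40641], [7616,7976,12853,13380,42710], [3], [7],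
  [28216,30692,52501,53240,70461], [3], [11310,11770,12386,13470,21819], [5], [3], [47], [7],
  [3], [5], [22929,23727,24564,27049,37855], [3], [21120,21436,22102,26696,56350], [79], [3],
  [7395,7474,38241,39020,46372], [31014,31366,31672,32730,39282], [3], [11], [5], [3], [7],
  [37], [3], [5], [10855,12392,23213,25247,39730], [3], [19], [7], [3], [31],
  [23981,24242,28417,31608,72302], [3], [13], [5], [3], [17], [28804,32848,35680,39050,40608],
  [3], [5], [11], [3], [7], [8023,11891,31435,33116,102512], [3],
  [21809,24926,25114,28380,51779], [13], [3], [71], [5], [3], [11],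
  [46643,48756,51753,56593,57761], [3], [5], [23], [3]]

lemma tab17_ok : chk 6807 tab17 = true := by decide +kernel

def tab18 : List (List ℕ) := [
  [87221,89011,102563,107691,116657], [43580,44696,44941,47082,67791], [3],
  [12144,13217,53416,55825,59700], [31], [3], [7], [5], [3], [44087,44260,45922,46830,68836],
  [23585,27209,39674,42720,46352], [3], [5], [7], [3], [13], [11], [3], [29],
  [29276,34354,38768,41985,43164], [3], [23], [5], [3], [67], [44351,48754,53152,53404,59333],
  [3], [5], [13], [3], [17], [28364,29268,30223,31381,47403], [3], [41], [7], [3],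
  [11588,11704,22073,22298,22389], [5], [3], [37], [53], [3], [5], [47], [3], [83], [19], [3],
  [7], [11], [3], [23192,28830,31562,36913,49886], [5], [3], [13], [7], [3], [5], [43], [3],
  [11], [7671,8738,30073,32747,34847], [3], [8360,12600,30813,31006,48096], [17], [3], [31],
  [5], [3], [7], [39228,41295,46508,47697,49072], [3], [5], [61056,62692,64937,66329,106808],
  [3], [23652,29674,45864,47625,77258], [7], [3], [73], [38471,43201,58310,59427,70536], [3],
  [17], [5], [3], [19], [42918,44655,53238,54465,58768], [3], [5],
  [13376,14875,30486,32749,36000], [3], [7], [67], [3], [11], [47342,48134,49430,52276,53614],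
  [3], [7983,9024,23949,25265,26831], [5], [3], [39246,41743,47685,52676,58726]]

lemma tab18_ok : chk 7207 tab18 = true := by decide +kernel

def tab19 : List (List ℕ) := [
  [30593,33052,35473,37816,69101], [3], [5], [19], [3], [29], [13], [3],
  [8103,8989,24309,30406,77791], [41811,42550,60316,60635,78643], [3], [7], [5], [3], [79],
  [11], [3], [5], [7], [3], [49901,51207,61512,62017,62997], [8729,9573,23781,24757,25108], [3],
  [8133,9593,13695,14772,24956], [48237,53563,116014,116906,122049], [3], [11], [5], [3],
  [54237,60618,63207,66965,78700], [38739,42231,43619,45420,93077], [3], [5], [71], [3], [61],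
  [23], [3], [10872,11226,12121,12334,23512], [7], [3], [19], [5], [3], [43], [13], [3], [5],
  [11], [3], [37], [73], [3], [7], [42101,42808,80697,85610,88403], [3], [41], [5], [3], [11],
  [7], [3], [5], [29], [3], [94645,95658,114723,116907,138979], [17], [3],
  [8684,13869,39764,46232,75940], [32845,33899,57572,60393,91059], [3], [13], [5], [3], [7],
  [56782,62504,64983,70328,73383], [3], [5], [9215,9691,24262,27118,29626], [3]]

lemma tab19_ok : chk 7607 tab19 = true := by decide +kernel

lemma small_prime {p : ℕ} (hp : p.Prime) (h4 : p % 4 = 3) (h7 : 7 ≤ p) (hlt : p < 7925) : Five p := by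
  by_cases g0 : p < 407
  · exact chk_spec hp tab0 7 tab0_ok (by omega) (by change p < 7 + 4 * 100; omega) (by omega)
  by_cases g1 : p < 807
  · exact chk_spec hp tab1 407 tab1_ok (by omega) (by change p < 407 + 4 * 100; omega) (by omega)
  by_cases g2 : p < 1207
  · exact chk_spec hp tab2 807 tab2_ok (by omega) (by change p < 807 + 4 * 100; omega) (by omega)
  by_cases g3 : p < 1607
  · exact chk_spec hp tab3 1207 tab3_ok (by omega) (by change p < 1207 + 4 * 100; omega) (by omega)
  by_cases g4 : p < 2007
  · exact chk_spec hp tab4 1607 tab4_ok (by omega) (by change p < 1607 + 4 * 100; omega) (by omega)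
  by_cases g5 : p < 2407
  · exact chk_spec hp tab5 2007 tab5_ok (by omega) (by change p < 2007 + 4 * 100; omega) (by omega)
  by_cases g6 : p < 2807
  · exact chk_spec hp tab6 2407 tab6_ok (by omega) (by change p < 2407 + 4 * 100; omega) (by omega)
  by_cases g7 : p < 3207
  · exact chk_spec hp tab7 2807 tab7_ok (by omega) (by change p < 2807 + 4 * 100; omega) (by omega)
  by_cases g8 : p < 3607
  · exact chk_spec hp tab8 3207 tab8_ok (by omega) (by change p < 3207 + 4 * 100; omega) (by omega)
  by_cases g9 : p < 4007
  · exact chk_spec hp tab9 3607 tab9_ok (by omega) (by change p < 3607 + 4 * 100; omega) (by omega)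
  by_cases g10 : p < 4407
  · exact chk_spec hp tab10 4007 tab10_ok (by omega) (by change p < 4007 + 4 * 100; omega) (by omega)
  by_cases g11 : p < 4807
  · exact chk_spec hp tab11 4407 tab11_ok (by omega) (by change p < 4407 + 4 * 100; omega) (by omega)
  by_cases g12 : p < 5207
  · exact chk_spec hp tab12 4807 tab12_ok (by omega) (by change p < 4807 + 4 * 100; omega) (by omega)
  by_cases g13 : p < 5607
  · exact chk_spec hp tab13 5207 tab13_ok (by omega) (by change p < 5207 + 4 * 100; omega) (by omega)
  by_cases g14 : p < 6007
  · exact chk_spec hp tab14 5607 tab14_ok (by omega) (by change p < 5607 + 4 * 100; omega) (by omega)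
  by_cases g15 : p < 6407
  · exact chk_spec hp tab15 6007 tab15_ok (by omega) (by change p < 6007 + 4 * 100; omega) (by omega)
  by_cases g16 : p < 6807
  · exact chk_spec hp tab16 6407 tab16_ok (by omega) (by change p < 6407 + 4 * 100; omega) (by omega)
  by_cases g17 : p < 7207
  · exact chk_spec hp tab17 6807 tab17_ok (by omega) (by change p < 6807 + 4 * 100; omega) (by omega)
  by_cases g18 : p < 7607
  · exact chk_spec hp tab18 7207 tab18_ok (by omega) (by change p < 7207 + 4 * 100; omega) (by omega)
  by_cases g19 : p < 7927
  · exact chk_spec hp tab19 7607 tab19_ok (by omega) (by change p < 7607 + 4 * 80; omega) (by omega)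
  omega


lemma good_zero {F : Type*} [Field F] {p : ℕ} [CharP F p] {c : ℕ} (h : good p c = true) :
    Pv ((c / p : ℕ) : F) ((c % p : ℕ) : F) = 0 := by
  have h1 : pos (c / p) (c % p) ≡ neg (c / p) (c % p) [MOD p] := by
    simpa [good, Nat.ModEq] using h
  have h2 : ((pos (c / p) (c % p) : ℕ) : F) = (neg (c / p) (c % p) : ℕ) :=
    (CharP.natCast_eq_natCast F p).2 h1
  generalize c / p = t at *
  generalize c % p = b at *
  simp only [pos, neg] at h2
  push_cast at h2
  simp only [Pv]
  linear_combination h2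

lemma code_ne {F : Type*} [Field F] {p : ℕ} [CharP F p] {c d : ℕ} (hcd : c < d) (hd : d < p * p) :
    (((c / p : ℕ) : F), ((c % p : ℕ) : F)) ≠ (((d / p : ℕ) : F), ((d % p : ℕ) : F)) := by
  intro h
  have hp : 0 < p := by
    rcases Nat.eq_zero_or_pos p with rfl | h
    · simp at hd
    · exact h
  obtain ⟨h1, h2⟩ := Prod.mk.inj h
  have e1 := (CharP.natCast_eq_natCast F p).1 h1
  have e2 := (CharP.natCast_eq_natCast F p).1 h2
  have e1' := Nat.ModEq.eq_of_lt_of_lt e1 (Nat.div_lt_of_lt_mul (hcd.trans hd)) (Nat.div_lt_of_lt_mul hd)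
  have e2' := Nat.ModEq.eq_of_lt_of_lt e2 (Nat.mod_lt _ hp) (Nat.mod_lt _ hp)
  have a := Nat.div_add_mod c p
  have b := Nat.div_add_mod d p
  rw [e1', e2', b] at a
  omega

lemma nodup5 {α : Type*} {a b c d e : α} (h1 : a ≠ b) (h2 : a ≠ c) (h3 : a ≠ d) (h4 : a ≠ e)
    (h5 : b ≠ c) (h6 : b ≠ d) (h7 : b ≠ e) (h8 : c ≠ d) (h9 : c ≠ e) (h10 : d ≠ e) :
    [a, b, c, d, e].Nodup := by
  simp_all

lemma five_field {F : Type*} [Field F] [Fintype F] {p : ℕ} [CharP F p] (h : Five p) :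
    5 ≤ Set.ncard {q : F × F | Pv q.1 q.2 = 0} := by
  obtain ⟨c1, c2, c3, c4, c5, h1, h2, h3, h4, h5, g1, g2, g3, g4, g5⟩ := h
  refine five (((c1 / p : ℕ) : F), ((c1 % p : ℕ) : F)) (((c2 / p : ℕ) : F), ((c2 % p : ℕ) : F))
    (((c3 / p : ℕ) : F), ((c3 % p : ℕ) : F)) (((c4 / p : ℕ) : F), ((c4 % p : ℕ) : F))
    (((c5 / p : ℕ) : F), ((c5 % p : ℕ) : F)) (good_zero (F := F) g1) (good_zero (F := F) g2) (good_zero (F := F) g3)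
    (good_zero (F := F) g4) (good_zero (F := F) g5) ?_
  have k12 := code_ne (F := F) (p := p) (c := c1) (d := c2) (by omega) (by omega)
  have k13 := code_ne (F := F) (p := p) (c := c1) (d := c3) (by omega) (by omega)
  have k14 := code_ne (F := F) (p := p) (c := c1) (d := c4) (by omega) (by omega)
  have k15 := code_ne (F := F) (p := p) (c := c1) (d := c5) (by omega) (by omega)
  have k23 := code_ne (F := F) (p := p) (c := c2) (d := c3) (by omega) (by omega)
  have k24 := code_ne (F := F) (p := p) (c := c2) (d := c4) (by omega) (by omega)
  have k25 := code_ne (F := F) (p := p) (c := c2) (d := c5) (by omega) (by omega)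
  have k34 := code_ne (F := F) (p := p) (c := c3) (d := c4) (by omega) (by omega)
  have k35 := code_ne (F := F) (p := p) (c := c3) (d := c5) (by omega) (by omega)
  have k45 := code_ne (F := F) (p := p) (c := c4) (d := c5) (by omega) (by omega)
  exact nodup5 k12 k13 k14 k15 k23 k24 k25 k34 k35 k45

lemma five_sqrt {F : Type*} [Field F] [Fintype F] (h2 : (2 : F) ≠ 0) (h3 : (3 : F) ≠ 0)
    (hs : IsSquare (-1 : F)) : 5 ≤ Set.ncard {q : F × F | Pv q.1 q.2 = 0} := by
  obtain ⟨i, hi⟩ := hs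
  have hi0 : i ≠ 0 := by
    rintro rfl
    simp at hi
  obtain ⟨j, hj⟩ : ∃ j : F, i = 2 * j := ⟨i / 2, by field_simp⟩
  have hj0 : j ≠ 0 := by
    rintro rfl
    simp at hj
    exact hi0 hj
  subst hj
  have e : 4 * j ^ 2 + 1 = 0 := by linear_combination -hi
  have d1 : 2 * j ≠ - (2 * j) := by
    intro h
    have : 2 * (2 * j) = 0 := by linear_combination h
    exact mul_ne_zero h2 (mul_ne_zero h2 hj0) this
  have d2 : 2 * j ≠ j := by
    intro h
    exact hj0 (by linear_combination h)
  have d3 : - (2 * j) ≠ j := by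
    intro h
    have : 3 * j = 0 := by linear_combination -h
    exact mul_ne_zero h3 hj0 this
  refine five (0, 2 * j) (0, -(2 * j)) (2, 2 * j) (2, -(2 * j)) (2, j) ?_ ?_ ?_ ?_ ?_ ?_
  · simp only [Pv]
    linear_combination e
  · simp only [Pv]
    linear_combination e
  · simp only [Pv]
    linear_combination (16 * j ^ 2 + 1) * e
  · simp only [Pv]
    linear_combination (16 * j ^ 2 + 1) * e
  · simp only [Pv]
    linear_combination (j ^ 2 + 1) * e
  · have h2' : (0 : F) ≠ 2 := h2.symm
    simp only [List.nodup_cons, List.mem_cons, List.not_mem_nil, or_false, not_or,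
      not_false_eq_true, List.nodup_nil, and_true, Prod.mk.injEq, not_and]
    exact ⟨⟨fun _ => d1, fun h => absurd h h2', fun h => absurd h h2', fun h => absurd h h2'⟩,
      ⟨fun h => absurd h h2', fun h => absurd h h2', fun h => absurd h h2'⟩,
      ⟨fun _ => d1, fun _ => d2⟩, fun _ => d3⟩

lemma main_aux (F : Type*) [Field F] [Fintype F]
    (h2 : Fintype.card F ≠ 2) (h3 : Fintype.card F ≠ 3) :
    5 ≤ Set.ncard {q : F × F | Pv q.1 q.2 = 0} := by
  by_cases hL : 7925 ≤ Fintype.card F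
  · exact large_card hL
  push Not at hL
  obtain ⟨p, hchar⟩ := CharP.exists F
  obtain ⟨n, hp, hcard⟩ := FiniteField.card F p
  have := Fact.mk hp
  have hn : 0 < (n : ℕ) := n.pos
  generalize (n : ℕ) = k at hcard hn
  have hpz : (p : F) = 0 := CharP.cast_eq_zero F p
  have hmul : ∀ r m : ℕ, k = r * m → Fintype.card F = (p ^ r) ^ m := by
    intro r m h
    rw [hcard, h, pow_mul]
  by_cases hp2 : p = 2
  · subst hp2
    have hk : k < 13 := by
      by_contra! h
      have := Nat.pow_le_pow_right (n := 2) (by norm_num) h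
      omega
    have hk1 : k ≠ 1 := by
      rintro rfl
      exact h2 (by simpa using hcard)
    have h : 2 ∣ k ∨ 3 ∣ k ∨ 5 ∣ k ∨ 7 ∣ k ∨ 11 ∣ k := by
      clear hmul hcard
      interval_cases k <;> first | omega | decide
    rcases h with ⟨m, h⟩ | ⟨m, h⟩ | ⟨m, h⟩ | ⟨m, h⟩ | ⟨m, h⟩
    · exact case_2_2 (by exact_mod_cast hpz) (hmul _ _ h)
    · exact case_2_3 (by exact_mod_cast hpz) (hmul _ _ h)
    · exact case_2_5 (by exact_mod_cast hpz) (hmul _ _ h)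
    · exact case_2_7 (by exact_mod_cast hpz) (hmul _ _ h)
    · exact case_2_11 (by exact_mod_cast hpz) (hmul _ _ h)
  by_cases hp3 : p = 3
  · subst hp3
    have hk : k < 9 := by
      by_contra! h
      have := Nat.pow_le_pow_right (n := 3) (by norm_num) h
      omega
    have hk1 : k ≠ 1 := by
      rintro rfl
      exact h3 (by simpa using hcard)
    have h : 2 ∣ k ∨ 3 ∣ k ∨ 5 ∣ k ∨ 7 ∣ k := by
      clear hmul hcard
      interval_cases k <;> first | omega | decide
    rcases h with ⟨m, h⟩ | ⟨m, h⟩ | ⟨m, h⟩ | ⟨m, h⟩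
    · exact case_3_2 (by exact_mod_cast hpz) (hmul _ _ h)
    · exact case_3_3 (by exact_mod_cast hpz) (hmul _ _ h)
    · exact case_3_5 (by exact_mod_cast hpz) (hmul _ _ h)
    · exact case_3_7 (by exact_mod_cast hpz) (hmul _ _ h)
  have two_ne : (2 : F) ≠ 0 := by
    intro h
    have : ((2 : ℕ) : F) = 0 := by exact_mod_cast h
    rw [CharP.cast_eq_zero_iff F p] at this
    exact hp2 ((Nat.prime_dvd_prime_iff_eq hp Nat.prime_two).1 this)
  have three_ne : (3 : F) ≠ 0 := by
    intro h
    have : ((3 : ℕ) : F) = 0 := by exact_mod_cast h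
    rw [CharP.cast_eq_zero_iff F p] at this
    exact hp3 ((Nat.prime_dvd_prime_iff_eq hp Nat.prime_three).1 this)
  by_cases h4 : Fintype.card F % 4 = 3
  · have hodd : p % 4 = 3 := by
      have hpo := hp.eq_two_or_odd
      by_contra h
      have h1 : p % 4 = 1 := by omega
      rw [hcard, Nat.pow_mod, h1] at h4
      simp at h4
    have hle : p ≤ Fintype.card F := by
      rw [hcard]
      exact Nat.le_self_pow hn.ne' p
    exact five_field (small_prime hp hodd (by omega) (by omega))
  · exact five_sqrt two_ne three_ne (FiniteField.isSquare_neg_one_iff.2 h4)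

end StepanovCurve



/-- For a finite field `F` with `#F ∉ {2,3}`, the plane curve
`P(t,b) = t²b⁴ + (−t⁴+2t³)b³ + (−t⁵+3t⁴−2t³+2t+1)b² + (t⁵−4t⁴+3t³+2t²)b
  + (t⁴−4t³+2t²+4t+1) = 0` has at least 5 points over `F`. -/
theorem curve_has_at_least_five_points (F : Type*) [Field F] [Fintype F]
    (h2 : Fintype.card F ≠ 2) (h3 : Fintype.card F ≠ 3) :
    5 ≤ Set.ncard {p : F × F |
      p.1 ^ 2 * p.2 ^ 4 + (-p.1 ^ 4 + 2 * p.1 ^ 3) * p.2 ^ 3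
        + (-p.1 ^ 5 + 3 * p.1 ^ 4 - 2 * p.1 ^ 3 + 2 * p.1 + 1) * p.2 ^ 2
        + (p.1 ^ 5 - 4 * p.1 ^ 4 + 3 * p.1 ^ 3 + 2 * p.1 ^ 2) * p.2
        + (p.1 ^ 4 - 4 * p.1 ^ 3 + 2 * p.1 ^ 2 + 4 * p.1 + 1) = 0} := by
  exact StepanovCurve.main_aux F h2 h3
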